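/- Let Ω ⊆ ℝⁿ be a connected open set, let f : Ω → ℝ be measurable with 0 < λ ≤ f ≤ Λ, let F, G : ℝⁿ × ℝ → ℝ satisfy 0 < λ ≤ F ≤ Λ, 0 < λ ≤ G ≤ Λ and be locally Lipschitz, and let u ≥ v be convex functions on Ω that are both generalized (Aleksandrov) solutions of det D²w = f(x)·F(x,w)/G(∇w, w*∘∇w) on Ω. If u is not identically equal to v on Ω, then every point x ∈ Ω with u(x) = v(x) belongs to Σ_u ∩ Σ_v. -/

import Mathlib

open MeasureTheory Set
open scoped RealInnerProductSpace ENNReal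

noncomputable section

abbrev En (n : ℕ) := EuclideanSpace ℝ (Fin n)

/-- The subgradient of `u` (as a convex function on `Ω`) at `x`. -/
def subgrad {n : ℕ} (Ω : Set (En n)) (u : En n → ℝ) (x : En n) : Set (En n) :=
  {p | ∀ y ∈ Ω, u x + ⟪p, y - x⟫ ≤ u y}

/-- The Monge–Ampère measure of `u` on a set `s`. -/
def MAm {n : ℕ} (Ω : Set (En n)) (u : En n → ℝ) (s : Set (En n)) : ℝ≥0∞ :=
  volume (⋃ x ∈ s, subgrad Ω u x)

/-- `x₀` is a strictly convex point of `u` on `Ω`. -/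
def IsStrictConvexPt {n : ℕ} (Ω : Set (En n)) (u : En n → ℝ) (x₀ : En n) : Prop :=
  ∀ x ∈ Ω, x ≠ x₀ → u ((1/2 : ℝ) • (x + x₀)) < (u x + u x₀) / 2

/-- `Σ_u`: the set of non-strictly convex points of `u` in `Ω`. -/
def SigmaSet {n : ℕ} (Ω : Set (En n)) (u : En n → ℝ) : Set (En n) :=
  {x ∈ Ω | ¬ IsStrictConvexPt Ω u x}

/-- The Legendre transform of `u` (as a function on `Ω`). -/
def legendreT {n : ℕ} (Ω : Set (En n)) (u : En n → ℝ) (p : En n) : ℝ :=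
  sSup ((fun x => ⟪x, p⟫ - u x) '' Ω)

/-- `w` is a generalized (Aleksandrov) solution of
`det D²w = f(x) · F(x, w) / G(∇w, w* ∘ ∇w)` on `Ω`. -/
def IsGenSol {n : ℕ} (Ω : Set (En n)) (f : En n → ℝ) (F G : En n × ℝ → ℝ)
    (w : En n → ℝ) : Prop :=
  ∀ s : Set (En n), s ⊆ Ω → MeasurableSet s →
    MAm Ω w s = ∫⁻ x in s, ENNReal.ofReal
      (f x * F (x, w x) / G (gradient w x, legendreT Ω w (gradient w x)))

section Subgradient

variable {n : ℕ} {Ω : Set (En n)} {u : En n → ℝ}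

/-- The gap between a function and the affine function with slope `p` touching it at `x`. -/
def gap (u : En n → ℝ) (x p X : En n) : ℝ := u X - u x - ⟪p, X - x⟫

lemma gap_self (u : En n → ℝ) (x p : En n) : gap u x p x = 0 := by simp [gap]

lemma mem_subgrad_iff {x p : En n} : p ∈ subgrad Ω u x ↔ ∀ y ∈ Ω, 0 ≤ gap u x p y := by
  simp only [subgrad, gap, mem_ofPred_eq]
  refine forall₂_congr fun y _ => ?_
  constructor <;> intro h <;> linarith

lemma convexOn_gap (hu : ConvexOn ℝ Ω u) (x p : En n) : ConvexOn ℝ Ω (gap u x p) := by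
  refine ⟨hu.1, fun a ha b hb s t hs ht hst => ?_⟩
  have h := hu.2 ha hb hs ht hst
  simp only [gap, smul_eq_mul, inner_sub_right, inner_add_right, inner_smul_right] at *
  have : s = 1 - t := by linarith
  subst this
  nlinarith [h]

lemma continuousOn_gap (hΩo : IsOpen Ω) (hu : ConvexOn ℝ Ω u) (x p : En n) :
    ContinuousOn (gap u x p) Ω :=
  (convexOn_gap hu x p).continuousOn hΩo

lemma mem_subgrad_of_eventually (hu : ConvexOn ℝ Ω u) {x p : En n} (hx : x ∈ Ω)
    (h : ∀ᶠ y in nhds x, 0 ≤ gap u x p y) : p ∈ subgrad Ω u x := by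
  rw [mem_subgrad_iff]
  intro y hy
  have hc : Filter.Tendsto (fun t : ℝ => x + t • (y - x)) (nhdsWithin 0 (Ioi 0)) (nhds x) := by
    have : Continuous (fun t : ℝ => x + t • (y - x)) := by fun_prop
    have h2 := this.tendsto 0
    simp only [zero_smul, add_zero] at h2
    exact h2.mono_left nhdsWithin_le_nhds
  have h1 : ∀ᶠ t : ℝ in nhdsWithin 0 (Ioi 0), t ∈ Ioo (0:ℝ) 1 := Ioo_mem_nhdsGT one_pos
  obtain ⟨t, ht, ht'⟩ := ((hc.eventually h).and h1).exists
  have h3 := (convexOn_gap hu x p).2 hx hy (by linarith [ht'.2] : 0 ≤ 1 - t) ht'.1.le (by ring)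
  have h4 : (1 - t) • x + t • y = x + t • (y - x) := by module
  rw [h4, gap_self] at h3
  simp only [smul_eq_mul, mul_zero, zero_add] at h3
  exact nonneg_of_mul_nonneg_right (ht.trans h3) ht'.1

lemma subgrad_nonempty (hΩo : IsOpen Ω) (hu : ConvexOn ℝ Ω u) {x : En n} (hx : x ∈ Ω) :
    (subgrad Ω u x).Nonempty := by
  have hconv := hu.convex_strict_epigraph
  have hop : IsOpen {p : En n × ℝ | p.1 ∈ Ω ∧ u p.1 < p.2} := by
    rw [isOpen_iff_mem_nhds]
    rintro ⟨y, t⟩ ⟨hy, hyt⟩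
    have hc : ContinuousAt u y := (hu.continuousOn hΩo).continuousAt (hΩo.mem_nhds hy)
    have h1 : ∀ᶠ p : En n × ℝ in nhds (y, t), u p.1 < p.2 := by
      have ha : ContinuousAt (fun p : En n × ℝ => u p.1) (y, t) :=
        ContinuousAt.comp (f := Prod.fst) (x := (y, t)) hc continuousAt_fst
      exact ha.eventually_lt continuousAt_snd hyt
    have h2 : ∀ᶠ p : En n × ℝ in nhds (y, t), p.1 ∈ Ω :=
      continuousAt_fst.eventually (hΩo.mem_nhds hy)
    exact h2.and h1
  obtain ⟨F, hF⟩ := geometric_hahn_banach_open_point (x := (x, u x)) hconv hop (by simp)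
  set a : ℝ := F (0, 1) with ha
  have hsplit : ∀ y : En n, ∀ t : ℝ, F (y, t) = F (y, 0) + t * a := by
    intro y t
    have : ((y, t) : En n × ℝ) = (y, 0) + t • ((0 : En n), (1:ℝ)) := by simp
    rw [this, map_add, map_smul, smul_eq_mul]
  have haneg : a < 0 := by
    have := hF (x, u x + 1) ⟨hx, by simp⟩
    rw [hsplit x (u x + 1), hsplit x (u x)] at this
    linarith
  let ℓ : En n →L[ℝ] ℝ := F.comp (ContinuousLinearMap.inl ℝ (En n) ℝ)
  refine ⟨(InnerProductSpace.toDual ℝ (En n)).symm ((-a⁻¹) • ℓ), fun y hy => ?_⟩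
  rw [InnerProductSpace.toDual_symm_apply]
  have hle : F (y, u y) ≤ F (x, u x) := by
    have hcont : Filter.Tendsto (fun ε : ℝ => F (y, u y + ε)) (nhdsWithin 0 (Ioi 0))
        (nhds (F (y, u y))) := by
      have : Continuous (fun ε : ℝ => F (y, u y + ε)) := by fun_prop
      have h2 := this.tendsto 0
      simp only [add_zero] at h2
      exact h2.mono_left nhdsWithin_le_nhds
    refine le_of_tendsto hcont ?_
    filter_upwards [self_mem_nhdsWithin] with ε hε
    exact (hF (y, u y + ε) ⟨hy, by simpa using hε⟩).le
  rw [hsplit y, hsplit x] at hle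
  have hℓ : ℓ (y - x) = F (y, 0) - F (x, 0) := by
    have : ((y - x, 0) : En n × ℝ) = (y, 0) - (x, 0) := by simp
    simp only [ℓ, ContinuousLinearMap.comp_apply, ContinuousLinearMap.inl_apply]
    rw [this, map_sub]
  rw [smul_apply, hℓ, smul_eq_mul]
  have : a⁻¹ * (F (y, 0) - F (x, 0)) ≥ a⁻¹ * ((u x - u y) * a) := by
    have hai : a⁻¹ < 0 := inv_neg''.mpr haneg
    nlinarith
  have h3 : a⁻¹ * ((u x - u y) * a) = u x - u y := by
    rw [mul_comm (u x - u y), inv_mul_cancel_left₀ haneg.ne]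
  linarith

lemma exists_subgrad_bound (hΩo : IsOpen Ω) (hu : ConvexOn ℝ Ω u) {K : Set (En n)}
    (hK : IsCompact K) (hKΩ : K ⊆ Ω) :
    ∃ R : ℝ, 0 < R ∧ ∀ x ∈ K, ∀ p ∈ subgrad Ω u x, ‖p‖ ≤ R := by
  obtain ⟨δ, hδ, hsub⟩ := hK.exists_cthickening_subset_open hΩo hKΩ
  have hcpt : IsCompact (Metric.cthickening δ K) := hK.cthickening
  obtain ⟨M, hM⟩ := hcpt.exists_bound_of_continuousOn ((hu.continuousOn hΩo).mono hsub)
  refine ⟨max 1 (2 * M / δ), by positivity, fun x hx p hp => ?_⟩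
  rcases eq_or_ne p 0 with rfl | hp0
  · simp
  have hn : 0 < ‖p‖ := norm_pos_iff.mpr hp0
  have hy : x + (δ / ‖p‖) • p ∈ Metric.cthickening δ K := by
    refine Metric.mem_cthickening_of_dist_le _ x δ K hx ?_
    simp only [dist_self_add_left, norm_smul, norm_div, Real.norm_eq_abs, abs_of_pos hδ, abs_norm]
    rw [div_mul_cancel₀ _ hn.ne']
  have h1 := hp _ (hsub hy)
  have hx' : x ∈ Metric.cthickening δ K := Metric.self_subset_cthickening K hx
  have h2 := abs_le.mp (hM _ hy)
  have h3 := abs_le.mp (hM _ hx')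
  simp only [add_sub_cancel_left, inner_smul_right, real_inner_self_eq_norm_sq] at h1
  have h4 : δ / ‖p‖ * ‖p‖ ^ 2 = δ * ‖p‖ := by field_simp
  refine le_trans ?_ (le_max_right _ _)
  rw [le_div_iff₀ hδ]
  linarith [h2.2, h3.1]

lemma isCompact_subgrad_graph (hΩo : IsOpen Ω) (hu : ConvexOn ℝ Ω u) {K : Set (En n)}
    (hK : IsCompact K) (hKΩ : K ⊆ Ω) :
    IsCompact {z : En n × En n | z.1 ∈ K ∧ z.2 ∈ subgrad Ω u z.1} := by
  obtain ⟨R, -, hR⟩ := exists_subgrad_bound hΩo hu hK hKΩ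
  have hS : IsCompact (K ×ˢ Metric.closedBall (0 : En n) R) :=
    hK.prod (isCompact_closedBall _ _)
  refine hS.of_isClosed_subset ?_ ?_
  · have : {z : En n × En n | z.1 ∈ K ∧ z.2 ∈ subgrad Ω u z.1} =
        (K ×ˢ Metric.closedBall (0 : En n) R) ∩
          ⋂ y ∈ Ω, ((K ×ˢ Metric.closedBall (0 : En n) R) ∩
            (fun z : En n × En n => u z.1 + ⟪z.2, y - z.1⟫) ⁻¹' (Iic (u y))) := by
      ext ⟨x, p⟩
      simp only [mem_ofPred_eq, mem_inter_iff, mem_iInter, mem_prod, mem_preimage, mem_Iic,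
        Metric.mem_closedBall, dist_zero_right]
      constructor
      · rintro ⟨hx, hp⟩
        exact ⟨⟨hx, hR x hx p hp⟩, fun y hy => ⟨⟨hx, hR x hx p hp⟩, hp y hy⟩⟩
      · rintro ⟨h1, h2⟩
        exact ⟨h1.1, fun y hy => (h2 y hy).2⟩
    rw [this]
    refine hS.isClosed.inter (isClosed_biInter fun y _ => ?_)
    refine ContinuousOn.preimage_isClosed_of_isClosed ?_ hS.isClosed isClosed_Iic
    have h1 : ContinuousOn (fun z : En n × En n => u z.1) (K ×ˢ Metric.closedBall (0 : En n) R) :=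
      ((hu.continuousOn hΩo).mono hKΩ).comp continuousOn_fst fun z hz => hz.1
    exact h1.add (by fun_prop)
  · rintro ⟨x, p⟩ ⟨hx, hp⟩
    exact ⟨hx, by simpa using hR x hx p hp⟩

lemma subgrad_of_tendsto (hΩo : IsOpen Ω) (hu : ConvexOn ℝ Ω u) {ι : Type*} {l : Filter ι}
    [l.NeBot] {xs ps : ι → En n} {x p : En n} (hx : x ∈ Ω)
    (hxs : Filter.Tendsto xs l (nhds x)) (hps : Filter.Tendsto ps l (nhds p))
    (h : ∀ᶠ i in l, ps i ∈ subgrad Ω u (xs i)) : p ∈ subgrad Ω u x := by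
  intro y hy
  have hc : ContinuousAt u x := (hu.continuousOn hΩo).continuousAt (hΩo.mem_nhds hx)
  have h1 : Filter.Tendsto (fun i => u (xs i) + ⟪ps i, y - xs i⟫) l
      (nhds (u x + ⟪p, y - x⟫)) :=
    (hc.tendsto.comp hxs).add (hps.inner (tendsto_const_nhds.sub hxs))
  exact le_of_tendsto h1 (h.mono fun i hi => hi y hy)

/-- Limits of subgradients at points converging to `x` accumulate at subgradients at `x`. -/
lemma exists_subgrad_subseq (hΩo : IsOpen Ω) (hu : ConvexOn ℝ Ω u) {xs ps : ℕ → En n} {x : En n}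
    (hx : x ∈ Ω) (hxs : Filter.Tendsto xs Filter.atTop (nhds x))
    (h : ∀ᶠ k in Filter.atTop, ps k ∈ subgrad Ω u (xs k)) :
    ∃ p ∈ subgrad Ω u x, ∃ φ : ℕ → ℕ, StrictMono φ ∧
      Filter.Tendsto (ps ∘ φ) Filter.atTop (nhds p) := by
  obtain ⟨r, hr, hrs⟩ := Metric.nhds_basis_closedBall.mem_iff.mp (hΩo.mem_nhds hx)
  obtain ⟨R, -, hR⟩ := exists_subgrad_bound hΩo hu (isCompact_closedBall x r) hrs
  have hev : ∀ᶠ k in Filter.atTop, ps k ∈ Metric.closedBall (0 : En n) R := by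
    filter_upwards [h, hxs (Metric.closedBall_mem_nhds x hr)] with k hk hk2
    simpa using hR _ hk2 _ hk
  obtain ⟨p, -, φ, hφ, hlim⟩ :=
    (isCompact_closedBall (0 : En n) R).tendsto_subseq' hev.frequently
  refine ⟨p, ?_, φ, hφ, hlim⟩
  exact subgrad_of_tendsto hΩo hu hx (hxs.comp hφ.tendsto_atTop) hlim
    (hφ.tendsto_atTop.eventually h)

/-- The set of slopes for which `Φ - ⟪q, ·⟫` has two minimizers on a compact set is null. -/
lemma ae_unique_minimizer {K : Set (En n)} (hK : IsCompact K) {Φ : En n → ℝ} {m : ℝ}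
    (hΦ : ∀ x ∈ K, m ≤ Φ x) :
    ∀ᵐ q : En n, ∀ x ∈ K, ∀ z ∈ K, (∀ X ∈ K, Φ x - ⟪q, x⟫ ≤ Φ X - ⟪q, X⟫) →
      (∀ X ∈ K, Φ z - ⟪q, z⟫ ≤ Φ X - ⟪q, X⟫) → x = z := by
  rcases K.eq_empty_or_nonempty with rfl | hne
  · simp
  obtain ⟨R, hR⟩ := hK.isBounded.exists_norm_le
  have hR0 : 0 ≤ R := (norm_nonneg _).trans (hR _ hne.some_mem)
  have : Nonempty K := hne.to_subtype
  let g : En n → ℝ := fun q => ⨆ x : K, (⟪q, (x : En n)⟫ - Φ x)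
  have hbdd : ∀ q : En n, BddAbove (range fun x : K => (⟪q, (x : En n)⟫ - Φ x)) := by
    intro q
    refine ⟨‖q‖ * R - m, ?_⟩
    rintro _ ⟨x, rfl⟩
    have h1 := real_inner_le_norm q (x : En n)
    have h2 := hR x x.2
    have h3 := hΦ x x.2
    have := mul_le_mul_of_nonneg_left h2 (norm_nonneg q)
    simp only
    linarith
  have hlip : LipschitzWith R.toNNReal g := by
    refine LipschitzWith.of_le_add_mul _ fun q q' => ?_
    refine ciSup_le fun x => ?_
    have h1 := le_ciSup (hbdd q') x
    have h2 := real_inner_le_norm (q - q') (x : En n)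
    have h3 := mul_le_mul_of_nonneg_left (hR x x.2) (norm_nonneg (q - q'))
    rw [Real.coe_toNNReal R hR0, dist_eq_norm]
    rw [inner_sub_left] at h2
    change _ ≤ g q' at h1
    linarith
  filter_upwards [hlip.ae_differentiableAt] with q hq x hx z hz hxm hzm
  have key : ∀ y ∈ K, (∀ X ∈ K, Φ y - ⟪q, y⟫ ≤ Φ X - ⟪q, X⟫) →
      fderiv ℝ g q = innerSL ℝ y := by
    intro y hy hym
    have hd : HasFDerivAt (fun q' => g q' - innerSL ℝ y q') (fderiv ℝ g q - innerSL ℝ y) q :=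
      hq.hasFDerivAt.sub (innerSL ℝ y).hasFDerivAt
    have hmin : IsLocalMin (fun q' => g q' - innerSL ℝ y q') q := by
      refine Filter.Eventually.of_forall fun q' => ?_
      have h1 : ⟪q', y⟫ - Φ y ≤ g q' := le_ciSup (hbdd q') ⟨y, hy⟩
      have h2 : g q ≤ ⟪q, y⟫ - Φ y := ciSup_le fun X => by linarith [hym X X.2]
      simp only [innerSL_apply_apply]
      rw [real_inner_comm q y, real_inner_comm q' y]
      linarith
    exact sub_eq_zero.mp (hmin.hasFDerivAt_eq_zero hd)
  have h := (key x hx hxm).symm.trans (key z hz hzm)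
  exact innerSL_inj.mp h

/-- A linear function bounded on a section of a convex function is bounded by that function
outside of the section. -/
lemma inner_le_of_section {D : Set (En n)} {w : En n → ℝ} (hw : ConvexOn ℝ D w) {x : En n}
    (hx : x ∈ D) (hwx : w x = 0) {H c : ℝ} (hH : 0 < H) {r : En n}
    (hr : ∀ X ∈ D, w X ≤ H → ⟪r, X - x⟫ ≤ c * H) {X : En n} (hX : X ∈ D) (hHX : H ≤ w X) :
    ⟪r, X - x⟫ ≤ c * w X := by
  have hpos : 0 < w X := hH.trans_le hHX
  set t := H / w X with ht
  have ht0 : 0 < t := div_pos hH hpos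
  have ht1 : t ≤ 1 := (div_le_one hpos).mpr hHX
  have h1 := hw.2 hx hX (by linarith : 0 ≤ 1 - t) ht0.le (by ring)
  have h2 := hw.1 hx hX (by linarith : 0 ≤ 1 - t) ht0.le (by ring)
  have h4 : (1 - t) • x + t • X = x + t • (X - x) := by module
  rw [h4, hwx] at h1
  rw [h4] at h2
  have htw : t * w X = H := div_mul_cancel₀ _ hpos.ne'
  have h3 := hr _ h2 (by simpa [htw] using h1)
  rw [add_sub_cancel_left, inner_smul_right] at h3
  have h5 : t * ⟪r, X - x⟫ ≤ t * (c * w X) := by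
    calc t * ⟪r, X - x⟫ ≤ c * H := h3
      _ = t * (c * w X) := by rw [← htw]; ring
  exact le_of_mul_le_mul_left h5 ht0

end Subgradient

section Exposed

variable {n : ℕ} {Ω : Set (En n)} {u : En n → ℝ}

/-- Two-sided bounds of the Monge–Ampère measure by multiples of Lebesgue measure. -/
def MABounds (Ω : Set (En n)) (u : En n → ℝ) (c C : ℝ) : Prop :=
  ∀ s ⊆ Ω, MeasurableSet s →
    ENNReal.ofReal c * volume s ≤ MAm Ω u s ∧ MAm Ω u s ≤ ENNReal.ofReal C * volume s

lemma IsGenSol.maBounds {f : En n → ℝ} {F G : En n × ℝ → ℝ} {lam Lam : ℝ} (hlam : 0 < lam)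
    (hLam : lam ≤ Lam) (hfb : ∀ x ∈ Ω, lam ≤ f x ∧ f x ≤ Lam)
    (hFb : ∀ p : En n × ℝ, lam ≤ F p ∧ F p ≤ Lam) (hGb : ∀ p : En n × ℝ, lam ≤ G p ∧ G p ≤ Lam)
    (h : IsGenSol Ω f F G u) : MABounds Ω u (lam * lam / Lam) (Lam * Lam / lam) := by
  intro s hs hm
  rw [h s hs hm]
  have hL : 0 < Lam := hlam.trans_le hLam
  have hb : ∀ x ∈ s, ∀ a b, lam * lam / Lam ≤ f x * F a / G b ∧
      f x * F a / G b ≤ Lam * Lam / lam := by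
    intro x hx a b
    obtain ⟨h1, h2⟩ := hfb x (hs hx)
    obtain ⟨h3, h4⟩ := hFb a
    obtain ⟨h5, h6⟩ := hGb b
    constructor
    · have : 0 < G b := hlam.trans_le h5
      have : 0 < f x := hlam.trans_le h1
      have : 0 < F a := hlam.trans_le h3
      gcongr
    · have : 0 < F a := hlam.trans_le h3
      gcongr
  constructor
  · rw [← setLIntegral_const]
    exact setLIntegral_mono' hm fun x hx => ENNReal.ofReal_le_ofReal (hb x hx _ _).1
  · rw [← setLIntegral_const]
    exact setLIntegral_mono' hm fun x hx => ENNReal.ofReal_le_ofReal (hb x hx _ _).2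

/-- The point `x` is exposed by the slope `p`: the supporting affine function with slope `p`
at `x` touches `u` only at `x`. -/
def IsExp (Ω : Set (En n)) (u : En n → ℝ) (x p : En n) : Prop :=
  p ∈ subgrad Ω u x ∧ ∀ z ∈ Ω, z ≠ x → 0 < gap u x p z

lemma gap_sub_gap (u : En n → ℝ) (x p z X : En n) :
    gap u z p X = gap u x p X - gap u x p z := by
  simp only [gap, inner_sub_right]; ring

lemma mem_subgrad_of_gap_eq_zero {x z p : En n} (hp : p ∈ subgrad Ω u x)
    (h : gap u x p z = 0) : p ∈ subgrad Ω u z := by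
  rw [mem_subgrad_iff] at *
  intro y hy
  rw [gap_sub_gap u x p z, h, sub_zero]
  exact hp y hy

lemma gap_eq_zero_of_mem_subgrad {x z p : En n} (hx : x ∈ Ω) (hz : z ∈ Ω)
    (hp : p ∈ subgrad Ω u x) (hp' : p ∈ subgrad Ω u z) : gap u x p z = 0 := by
  rw [mem_subgrad_iff] at *
  have h1 := hp z hz
  have h2 := hp' x hx
  rw [gap_sub_gap u x p z, gap_self] at h2
  linarith

lemma exists_section_subset (hΩo : IsOpen Ω) (hu : ConvexOn ℝ Ω u) {x p : En n}
    (hp : IsExp Ω u x p) {r : ℝ} (hr : 0 < r) (hrs : Metric.closedBall x r ⊆ Ω) :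
    ∃ h : ℝ, 0 < h ∧ ∀ᶠ z : En n × En n in nhds (x, p), z.2 ∈ subgrad Ω u z.1 → z.1 ∈ Ω →
      ∀ X ∈ Ω, gap u z.1 z.2 X ≤ h → X ∈ Metric.ball x r := by
  have hx : x ∈ Ω := hrs (Metric.mem_closedBall_self hr.le)
  have hK : IsCompact (Metric.sphere x r) := isCompact_sphere x r
  have hKs : Metric.sphere x r ⊆ Ω := Metric.sphere_subset_closedBall.trans hrs
  have hcont := (hu.continuousOn hΩo)
  obtain ⟨m, hm, hmin⟩ : ∃ m : ℝ, 0 < m ∧ ∀ X ∈ Metric.sphere x r, m ≤ gap u x p X := by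
    rcases (Metric.sphere x r).eq_empty_or_nonempty with he | hne
    · exact ⟨1, one_pos, by simp [he]⟩
    · obtain ⟨z, hz, hzm⟩ := hK.exists_isMinOn hne ((continuousOn_gap hΩo hu x p).mono hKs)
      refine ⟨_, hp.2 z (hKs hz) ?_, fun X hX => hzm hX⟩
      rintro rfl
      simp only [Metric.mem_sphere, dist_self] at hz
      exact hr.ne hz
  refine ⟨m / 4, by positivity, ?_⟩
  have hjoint : ∀ X ∈ Ω, ContinuousAt (fun w : (En n × En n) × En n => gap u w.1.1 w.1.2 w.2)
      ((x, p), X) := by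
    intro X hX
    have h1 : ContinuousAt (fun w : (En n × En n) × En n => u w.2) ((x, p), X) :=
      ContinuousAt.comp (f := Prod.snd) (x := ((x, p), X))
        (hcont.continuousAt (hΩo.mem_nhds hX)) continuousAt_snd
    have h2 : ContinuousAt (fun w : (En n × En n) × En n => u w.1.1) ((x, p), X) :=
      ContinuousAt.comp (f := fun w : (En n × En n) × En n => w.1.1) (x := ((x, p), X))
        (hcont.continuousAt (hΩo.mem_nhds hx)) (by fun_prop)
    exact (h1.sub h2).sub (by fun_prop)
  have hsph : ∀ᶠ z : En n × En n in nhds (x, p), ∀ X ∈ Metric.sphere x r,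
      m / 2 < gap u z.1 z.2 X := by
    refine hK.eventually_forall_of_forall_eventually fun X hX => ?_
    exact (hjoint X (hKs hX)).eventually_const_lt (by have := hmin X hX; simp only; linarith)
  have hcen : ∀ᶠ z : En n × En n in nhds (x, p), gap u z.1 z.2 x < m / 4 := by
    have h1 : ContinuousAt (fun z : En n × En n => gap u z.1 z.2 x) (x, p) :=
      ContinuousAt.comp (f := fun z : En n × En n => (z, x)) (x := (x, p)) (hjoint x hx)
        (by fun_prop)
    exact h1.eventually_lt_const (by simp only [gap_self]; positivity)
  filter_upwards [hsph, hcen] with z h1 h2 h3 h4 X hX hXm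
  by_contra hXr
  rw [Metric.mem_ball, not_lt, dist_eq_norm] at hXr
  have hpos : 0 < ‖X - x‖ := hr.trans_le hXr
  set t := r / ‖X - x‖ with ht
  have ht0 : 0 < t := div_pos hr hpos
  have ht1 : t ≤ 1 := (div_le_one hpos).mpr hXr
  have hsp : x + t • (X - x) ∈ Metric.sphere x r := by
    simp only [mem_sphere_iff_norm, add_sub_cancel_left, norm_smul, Real.norm_eq_abs,
      abs_of_pos ht0]
    exact div_mul_cancel₀ _ hpos.ne'
  have h5 := (convexOn_gap hu z.1 z.2).2 hx hX (by linarith : 0 ≤ 1 - t) ht0.le (by ring)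
  rw [show (1 - t) • x + t • X = x + t • (X - x) by module] at h5
  have h6 := h1 _ hsp
  simp only [smul_eq_mul] at h5
  nlinarith

lemma isCompact_section (hΩo : IsOpen Ω) (hu : ConvexOn ℝ Ω u) {x p : En n} {h : ℝ} {K : Set (En n)}
    (hK : IsCompact K) (hKΩ : K ⊆ Ω) (hs : ∀ X ∈ Ω, gap u x p X ≤ h → X ∈ K) :
    IsCompact {X | X ∈ Ω ∧ gap u x p X ≤ h} := by
  have : {X | X ∈ Ω ∧ gap u x p X ≤ h} = K ∩ gap u x p ⁻¹' Iic h := by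
    ext X
    constructor
    · rintro ⟨h1, h2⟩; exact ⟨hs X h1 h2, h2⟩
    · rintro ⟨h1, h2⟩; exact ⟨hKΩ h1, h2⟩
  rw [this]
  exact hK.of_isClosed_subset (((continuousOn_gap hΩo hu x p).mono hKΩ).preimage_isClosed_of_isClosed
    hK.isClosed isClosed_Iic) inter_subset_left

lemma ae_of_locally {P : En n → Prop}
    (h : ∀ x ∈ Ω, ∃ r > 0, ∀ᵐ y : En n, y ∈ Metric.ball x r → P y) :
    ∀ᵐ y : En n, y ∈ Ω → P y := by
  have h1 : volume {y : En n | y ∈ Ω ∧ ¬ P y} = 0 := by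
    refine measure_null_of_locally_null _ fun x hx => ?_
    obtain ⟨r, hr, hP⟩ := h x hx.1
    refine ⟨Metric.ball x r ∩ {y : En n | y ∈ Ω ∧ ¬ P y},
      Filter.inter_mem (mem_nhdsWithin_of_mem_nhds (Metric.ball_mem_nhds x hr))
        self_mem_nhdsWithin, ?_⟩
    refine measure_mono_null ?_ (ae_iff.mp hP)
    rintro y ⟨hy1, hy2⟩
    exact fun h => hy2.2 (h hy1)
  rw [ae_iff]
  convert h1 using 2
  ext y
  simp

lemma ae_differentiableAt (hΩo : IsOpen Ω) (hu : ConvexOn ℝ Ω u) :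
    ∀ᵐ y : En n, y ∈ Ω → DifferentiableAt ℝ u y := by
  refine ae_of_locally fun x hx => ?_
  obtain ⟨K, t, ht, hK⟩ := hu.locallyLipschitzOn hΩo hx
  rw [hΩo.nhdsWithin_eq hx] at ht
  obtain ⟨r, hr, hrt⟩ := Metric.mem_nhds_iff.mp ht
  refine ⟨r, hr, ?_⟩
  filter_upwards [(hK.mono hrt).ae_differentiableWithinAt_of_mem (μ := volume)] with y hy hyb
  exact (hy hyb).differentiableAt (Metric.isOpen_ball.mem_nhds hyb)

lemma eq_gradient_of_mem_subgrad (hΩo : IsOpen Ω) {x p : En n} (hx : x ∈ Ω)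
    (hd : DifferentiableAt ℝ u x) (hp : p ∈ subgrad Ω u x) : p = gradient u x := by
  have h1 : HasFDerivAt (fun y => u y - innerSL ℝ p y) (fderiv ℝ u x - innerSL ℝ p) x :=
    hd.hasFDerivAt.sub (innerSL ℝ p).hasFDerivAt
  have hmin : IsLocalMin (fun y => u y - innerSL ℝ p y) x := by
    filter_upwards [hΩo.mem_nhds hx] with y hy
    have := hp y hy
    rw [inner_sub_right] at this
    simp only [innerSL_apply_apply]
    linarith
  have h2 := sub_eq_zero.mp (hmin.hasFDerivAt_eq_zero h1)
  have h3 : HasGradientAt u p x := by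
    rw [hasGradientAt_iff_hasFDerivAt]
    have := hd.hasFDerivAt
    rw [h2] at this
    exact this
  exact h3.gradient.symm

lemma ae_isExp (hΩo : IsOpen Ω) (hu : ConvexOn ℝ Ω u) {c C : ℝ} (hc : 0 < c)
    (hM : MABounds Ω u c C) :
    ∀ᵐ y : En n, y ∈ Ω → ∀ p ∈ subgrad Ω u y, IsExp Ω u y p := by
  refine ae_of_locally fun x₀ hx₀ => ?_
  obtain ⟨r, hr, hrs⟩ := Metric.nhds_basis_closedBall.mem_iff.mp (hΩo.mem_nhds hx₀)
  refine ⟨r, hr, ?_⟩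
  set B := Metric.closedBall x₀ r with hB
  have hBc : IsCompact B := isCompact_closedBall x₀ r
  set Y : ℝ → Set (En n) := fun δ =>
    {y | y ∈ B ∧ ∃ z ∈ B, δ ≤ dist z y ∧ ∃ p, p ∈ subgrad Ω u y ∧ p ∈ subgrad Ω u z} with hY
  have hYc : ∀ δ, IsCompact (Y δ) := by
    intro δ
    have hg := isCompact_subgrad_graph hΩo hu hBc hrs
    have hcl : IsClosed {w : (En n × En n) × (En n × En n) |
        w.1.2 = w.2.2 ∧ δ ≤ dist w.2.1 w.1.1} :=
      IsClosed.inter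
        (isClosed_eq (f := fun w : (En n × En n) × (En n × En n) => w.1.2)
          (g := fun w => w.2.2) (by fun_prop) (by fun_prop))
        (isClosed_le (f := fun _ : (En n × En n) × (En n × En n) => δ)
          (g := fun w => dist w.2.1 w.1.1) (by fun_prop) (by fun_prop))
    have h2 := (hg.prod hg).inter_right hcl
    convert h2.image (f := fun w => w.1.1) (by fun_prop) using 1
    ext y
    simp only [hY, mem_ofPred_eq, mem_image, mem_inter_iff, mem_prod, Prod.exists]
    constructor
    · rintro ⟨hy, z, hz, hd, p, hp, hp'⟩
      exact ⟨y, p, z, p, ⟨⟨⟨hy, hp⟩, hz, hp'⟩, rfl, hd⟩, rfl⟩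
    · rintro ⟨y, p, z, p', ⟨⟨⟨hy, hp⟩, hz, hp'⟩, hpp, hd⟩, rfl⟩
      subst hpp
      exact ⟨hy, z, hz, hd, p, hp, hp'⟩
  have hnull : ∀ δ > 0, volume (Y δ ∩ {y | DifferentiableAt ℝ u y}) = 0 := by
    intro δ hδ
    obtain ⟨m, hm⟩ := (hBc.image_of_continuousOn ((hu.continuousOn hΩo).mono hrs)).bddBelow
    have hae := ae_unique_minimizer hBc (Φ := u) (m := m) fun x hx => hm ⟨x, hx, rfl⟩
    have hMA : MAm Ω u (Y δ ∩ {y | DifferentiableAt ℝ u y}) = 0 := by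
      refine measure_mono_null ?_ (ae_iff.mp hae)
      intro q hq
      simp only [mem_iUnion, exists_prop] at hq
      obtain ⟨y, ⟨⟨hy, z, hz, hd, p, hp, hp'⟩, hdiff⟩, hq⟩ := hq
      have hqp : q = p := by
        rw [eq_gradient_of_mem_subgrad hΩo (hrs hy) hdiff hq,
          eq_gradient_of_mem_subgrad hΩo (hrs hy) hdiff hp]
      subst hqp
      intro hcon
      have : y = z := by
        refine hcon y hy z hz (fun X hX => ?_) (fun X hX => ?_)
        · have := hp X (hrs hX)
          rw [inner_sub_right] at this
          linarith
        · have := hp' X (hrs hX)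
          rw [inner_sub_right] at this
          linarith
      rw [this, dist_self] at hd
      linarith
    have h1 := (hM _ (inter_subset_left.trans fun y hy => hrs hy.1)
      ((hYc δ).measurableSet.inter (measurableSet_of_differentiableAt ℝ u))).1
    rw [hMA, nonpos_iff_eq_zero, mul_eq_zero] at h1
    rcases h1 with h1 | h1
    · simp only [ENNReal.ofReal_eq_zero] at h1
      linarith
    · exact h1
  have hnull' : ∀ᵐ y : En n, ∀ k : ℕ, y ∉ Y (1 / (k + 1)) ∩ {y | DifferentiableAt ℝ u y} := by
    rw [ae_all_iff]
    intro k
    exact measure_eq_zero_iff_ae_notMem.mp (hnull _ (by positivity))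
  filter_upwards [hnull', ae_differentiableAt hΩo hu] with y hy hdiff hyB p hp
  have hyΩ : y ∈ Ω := hrs (Metric.ball_subset_closedBall hyB)
  refine ⟨hp, fun z hz hzy => ?_⟩
  have h0 := (mem_subgrad_iff.mp hp) z hz
  refine lt_of_le_of_ne h0 fun h0' => ?_
  have hc1 : Filter.Tendsto (fun t : ℝ => y + t • (z - y)) (nhdsWithin 0 (Ioi 0)) (nhds y) := by
    have : Continuous (fun t : ℝ => y + t • (z - y)) := by fun_prop
    have h2 := this.tendsto 0
    simp only [zero_smul, add_zero] at h2
    exact h2.mono_left nhdsWithin_le_nhds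
  have h1 : ∀ᶠ t : ℝ in nhdsWithin 0 (Ioi 0), t ∈ Ioo (0:ℝ) 1 := Ioo_mem_nhdsGT one_pos
  obtain ⟨t, ht, ht'⟩ := ((hc1.eventually (Metric.isOpen_ball.mem_nhds hyB)).and h1).exists
  set z' := y + t • (z - y) with hz'
  have hz'Ω : z' ∈ Ω := hrs (Metric.ball_subset_closedBall ht)
  have h3 := (convexOn_gap hu y p).2 hyΩ hz (by linarith [ht'.2] : 0 ≤ 1 - t) ht'.1.le (by ring)
  rw [show (1 - t) • y + t • z = z' by rw [hz']; module, gap_self, ← h0'] at h3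
  have h4 : gap u y p z' = 0 :=
    le_antisymm (by simpa using h3) ((mem_subgrad_iff.mp hp) z' hz'Ω)
  have hne : 0 < dist z' y := by
    rw [dist_pos, hz']
    intro h
    rw [add_eq_left, smul_eq_zero] at h
    rcases h with h | h
    · exact ht'.1.ne' h
    · exact hzy (sub_eq_zero.mp h)
  obtain ⟨k, hk⟩ := exists_nat_one_div_lt hne
  exact hy k ⟨⟨Metric.ball_subset_closedBall hyB, z', Metric.ball_subset_closedBall ht, hk.le, p,
    hp, mem_subgrad_of_gap_eq_zero hp h4⟩, hdiff hyΩ⟩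

end Exposed

section AffineMeasure

variable {n : ℕ}

lemma volume_image_affine (a : En n) (s : ℝ) (S : Set (En n)) :
    volume ((fun r => a + s • r) '' S) = ENNReal.ofReal (|s| ^ n) * volume S := by
  have : (fun r => a + s • r) '' S = (fun r => a + r) '' ((fun r => s • r) '' S) := by
    rw [image_image]
  rw [this, image_add_left, measure_preimage_add, image_smul, Measure.addHaar_smul,
    finrank_euclideanSpace_fin, abs_pow]

lemma nsmul_volume_le_of_translates {S T : Set (En n)} (hS : MeasurableSet S) (d : En n) (N : ℕ)
    (hd : ∀ x ∈ S, ∀ k : ℕ, 1 ≤ k → k < N → x + (k : ℝ) • d ∉ S)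
    (hT : ∀ x ∈ S, ∀ k : ℕ, k < N → x + (k : ℝ) • d ∈ T) : (N : ℝ≥0∞) * volume S ≤ volume T := by
  have himg : ∀ k : ℕ, (fun x => x + (k : ℝ) • d) '' S = (fun x => x + -((k : ℝ) • d)) ⁻¹' S :=
    fun k => image_add_right
  have hm : ∀ k : ℕ, MeasurableSet ((fun x => x + (k : ℝ) • d) '' S) := by
    intro k
    rw [himg]
    exact (measurable_add_const _) hS
  have hv : ∀ k : ℕ, volume ((fun x => x + (k : ℝ) • d) '' S) = volume S := by
    intro k
    rw [himg, measure_preimage_add_right]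
  have hlt : ∀ i j : ℕ, i < j → j < N → Disjoint ((fun x => x + (i : ℝ) • d) '' S)
      ((fun x => x + (j : ℝ) • d) '' S) := by
    intro i j hij hj
    rw [Set.disjoint_left]
    rintro _ ⟨x, hx, rfl⟩ ⟨y, hy, hxy⟩
    simp only at hxy
    refine hd y hy (j - i) (by omega) (by omega) ?_
    have : y + ((j - i : ℕ) : ℝ) • d = x := by
      rw [Nat.cast_sub hij.le, sub_smul]
      rw [← add_sub_assoc, hxy, add_sub_cancel_right]
    rwa [this]
  have hdis : ((Finset.range N : Finset ℕ) : Set ℕ).PairwiseDisjoint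
      (fun k : ℕ => (fun x => x + (k : ℝ) • d) '' S) := by
    intro i hi j hj hij
    simp only [Finset.coe_range, mem_Iio] at hi hj
    rcases lt_or_gt_of_ne hij with h | h
    · exact hlt i j h hj
    · exact (hlt j i h hi).symm
  have h1 := measure_biUnion_finset (μ := volume) hdis fun k _ => hm k
  simp only [hv, Finset.sum_const, Finset.card_range, nsmul_eq_mul] at h1
  rw [← h1]
  refine measure_mono (iUnion₂_subset fun k hk => ?_)
  rintro _ ⟨x, hx, rfl⟩
  exact hT x hx k (Finset.mem_range.mp hk)

end AffineMeasure

section Sections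

variable {n : ℕ} {Ω : Set (En n)} {u : En n → ℝ}

/-- A slope which is admissible on a section of `u` is attained as a subgradient in it. -/
lemma exists_contact (hΩo : IsOpen Ω) (hu : ConvexOn ℝ Ω u) {D : Set (En n)} (hD : Convex ℝ D)
    (hDΩ : D ⊆ Ω) {x p r : En n} {H c : ℝ} (hx : x ∈ D)
    (hH : 0 < H) (hc : c ≤ 1) (hS : IsCompact {X | X ∈ D ∧ gap u x p X ≤ H})
    (hSi : {X | X ∈ D ∧ gap u x p X ≤ H} ⊆ interior D)
    (hr : ∀ X ∈ D, gap u x p X ≤ H → ⟪r, X - x⟫ ≤ c * H) :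
    ∃ X ∈ {X | X ∈ D ∧ gap u x p X ≤ H}, p + r ∈ subgrad Ω u X := by
  have hxS : x ∈ {X | X ∈ D ∧ gap u x p X ≤ H} := ⟨hx, by rw [gap_self]; exact hH.le⟩
  obtain ⟨z, hz, hzm⟩ := hS.exists_isMinOn ⟨x, hxS⟩
    (((convexOn_gap hu x (p + r)).continuousOn hΩo).mono fun X hX => hDΩ hX.1)
  refine ⟨z, hz, mem_subgrad_of_eventually hu (hDΩ hz.1) ?_⟩
  filter_upwards [isOpen_interior.mem_nhds (hSi hz)] with X hX
  have hXD := interior_subset hX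
  rw [gap_sub_gap u x, sub_nonneg]
  by_cases hXS : gap u x p X ≤ H
  · exact hzm ⟨hXD, hXS⟩
  · have h1 : gap u x (p + r) z ≤ gap u x (p + r) x := hzm hxS
    rw [gap_self] at h1
    refine le_trans h1 ?_
    have hcx := (convexOn_gap hu x p).subset hDΩ hD
    have h2 := inner_le_of_section hcx hx (gap_self u x p) hH hr hXD (not_le.mp hXS).le
    have h3 : gap u x (p + r) X = gap u x p X - ⟪r, X - x⟫ := by
      simp only [gap, inner_add_left]; ring
    rw [h3]
    nlinarith [not_le.mp hXS]

/-- Subgradients at a convex combination of points in a section. -/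
lemma inner_le_of_mem_subgrad {D : Set (En n)} (hDΩ : D ⊆ Ω)
    {x p : En n} (hxp : p ∈ subgrad Ω u x) {a b : En n} (ha : a ∈ D) (hb : b ∈ D) {H : ℝ}
    (hbH : gap u x p b ≤ H) {p' : En n} (hp' : p' ∈ subgrad Ω u a) :
    ⟪p' - p, b - a⟫ ≤ H := by
  have h1 := (mem_subgrad_iff.mp hxp) a (hDΩ ha)
  have h2 := hp' b (hDΩ hb)
  simp only [gap, inner_sub_left, inner_sub_right] at *
  linarith

lemma exists_subgrad_dir (hΩo : IsOpen Ω) (hu : ConvexOn ℝ Ω u) {x : En n} (hx : x ∈ Ω)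
    (e : En n) : ∃ p ∈ subgrad Ω u x, ∀ ε > 0, ∃ τ > 0, ∀ t ∈ Icc 0 τ,
      x + t • e ∈ Ω ∧ gap u x p (x + t • e) ≤ ε * t := by
  have hlim : Filter.Tendsto (fun k : ℕ => x + (1 / ((k : ℝ) + 1)) • e) Filter.atTop (nhds x) := by
    have h1 : Filter.Tendsto (fun k : ℕ => x + (1 / ((k : ℝ) + 1)) • e) Filter.atTop
        (nhds (x + (0 : ℝ) • e)) :=
      tendsto_const_nhds.add (tendsto_one_div_add_atTop_nhds_zero_nat.smul tendsto_const_nhds)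
    simpa using h1
  have hev : ∀ᶠ k : ℕ in Filter.atTop, x + (1 / ((k : ℝ) + 1)) • e ∈ Ω :=
    hlim.eventually (hΩo.mem_nhds hx)
  have hch : ∀ k : ℕ, ∃ q, x + (1 / ((k : ℝ) + 1)) • e ∈ Ω →
      q ∈ subgrad Ω u (x + (1 / ((k : ℝ) + 1)) • e) := by
    intro k
    by_cases h : x + (1 / ((k : ℝ) + 1)) • e ∈ Ω
    · obtain ⟨q, hq⟩ := subgrad_nonempty hΩo hu h
      exact ⟨q, fun _ => hq⟩
    · exact ⟨0, fun h' => absurd h' h⟩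
  choose ps hps using hch
  obtain ⟨p, hp, φ, hφ, hlimp⟩ := exists_subgrad_subseq hΩo hu hx hlim (ps := ps)
    (hev.mono fun k hk => hps k hk)
  refine ⟨p, hp, fun ε hε => ?_⟩
  have h1 : Filter.Tendsto (fun k => ⟪ps (φ k) - p, e⟫) Filter.atTop (nhds 0) := by
    have : Filter.Tendsto (fun k => ⟪ps (φ k) - p, e⟫) Filter.atTop (nhds ⟪p - p, e⟫) :=
      (hlimp.sub tendsto_const_nhds).inner tendsto_const_nhds
    simpa using this
  obtain ⟨k, hk1, hk2⟩ := ((h1.eventually_lt_const hε).and (hφ.tendsto_atTop.eventually hev)).exists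
  set τ : ℝ := 1 / (((φ k : ℕ) : ℝ) + 1) with hτ
  have hτ0 : 0 < τ := by positivity
  refine ⟨τ, hτ0, fun t ht => ?_⟩
  have hs : 0 ≤ t / τ ∧ t / τ ≤ 1 := ⟨div_nonneg ht.1 hτ0.le, (div_le_one hτ0).mpr ht.2⟩
  have heq : (1 - t / τ) • x + (t / τ) • (x + τ • e) = x + t • e := by
    have : t / τ * τ = t := div_mul_cancel₀ _ hτ0.ne'
    rw [smul_add, smul_smul, this]; module
  have h2 := hu.1 hx hk2 (sub_nonneg.mpr hs.2) hs.1 (by ring)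
  have h3 := (convexOn_gap hu x p).2 hx hk2 (sub_nonneg.mpr hs.2) hs.1 (by ring)
  rw [heq] at h2 h3
  refine ⟨h2, h3.trans ?_⟩
  rw [gap_self]
  have h4 : gap u x p (x + τ • e) ≤ ε * τ := by
    have h5 := hps (φ k) hk2 x hx
    simp only [gap, add_sub_cancel_left, inner_smul_right]
    rw [show x - (x + τ • e) = -(τ • e) by abel, inner_neg_right, inner_smul_right] at h5
    rw [inner_sub_left] at hk1
    nlinarith
  have h6 : t / τ * gap u x p (x + τ • e) ≤ t / τ * (ε * τ) :=
    mul_le_mul_of_nonneg_left h4 hs.1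
  have h7 : t / τ * (ε * τ) = ε * t := by field_simp
  simp only [smul_eq_mul]
  linarith

lemma volume_section_pos (hΩo : IsOpen Ω) (hu : ConvexOn ℝ Ω u) {x p : En n} (hx : x ∈ Ω) {H : ℝ}
    (hH : 0 < H) : 0 < volume {X | X ∈ Ω ∧ gap u x p X ≤ H} := by
  refine Measure.measure_pos_of_mem_nhds volume (x := x) ?_
  have hc : ContinuousAt (gap u x p) x :=
    (continuousOn_gap hΩo hu x p).continuousAt (hΩo.mem_nhds hx)
  filter_upwards [hΩo.mem_nhds hx, hc.eventually_lt_const (by rwa [gap_self])] with X h1 h2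
  exact ⟨h1, h2.le⟩

lemma exposed_count_le (hΩo : IsOpen Ω) (hu : ConvexOn ℝ Ω u) {c C : ℝ} (hC : 0 < C)
    (hM : MABounds Ω u c C) {x p p₁ e : En n} (hx : x ∈ Ω) (hp : IsExp Ω u x p)
    (hp₁ : p₁ ∈ subgrad Ω u x) {κ ε : ℝ} (hκ : ⟪p₁ - p, e⟫ ≤ -κ) (hε : 0 < ε) {N : ℕ}
    (hN : 8 * N * ε < κ) {τ : ℝ} (hτ : 0 < τ)
    (hdir : ∀ t ∈ Icc 0 τ, x + t • e ∈ Ω ∧ gap u x p (x + t • e) ≤ ε * t) :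
    c * N ≤ 64 ^ n * C := by
  by_contra! hcon
  obtain ⟨r, hr, hrs⟩ := Metric.nhds_basis_closedBall.mem_iff.mp (hΩo.mem_nhds hx)
  obtain ⟨h₀, hh₀, hev⟩ := exists_section_subset hΩo hu hp hr hrs
  have hsec := hev.self_of_nhds hp.1 hx
  set H := min h₀ (ε * τ) with hHdef
  have hH : 0 < H := lt_min hh₀ (by positivity)
  set S := {X | X ∈ Ω ∧ gap u x p X ≤ H} with hSdef
  have hS : IsCompact S := isCompact_section hΩo hu (isCompact_closedBall x r) hrs
    fun X hX hXH => Metric.ball_subset_closedBall (hsec X hX (hXH.trans (min_le_left _ _)))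
  have hgc := convexOn_gap hu x p
  have hScv : Convex ℝ S := hgc.convex_le H
  have hxS : x ∈ S := ⟨hx, by rw [gap_self]; exact hH.le⟩
  set b := H / (2 * ε) with hb
  have hb0 : 0 < b := by positivity
  have hbb : 2 * b ≤ τ := by
    have : H ≤ ε * τ := min_le_right _ _
    rw [hb, mul_div_assoc', div_le_iff₀ (by positivity)]; nlinarith
  have hbbH : ε * (2 * b) = H := by rw [hb]; field_simp
  have heS : x + (2 * b) • e ∈ S := by
    obtain ⟨h1, h2⟩ := hdir (2 * b) ⟨by positivity, hbb⟩
    exact ⟨h1, h2.trans hbbH.le⟩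
  set Q : Set (En n) := {q | ∀ X ∈ S, ⟪q, X - x⟫ ≤ 1 / 4 * H} with hQ
  have hQcl : IsClosed Q := by
    have : Q = ⋂ X ∈ S, {q | ⟪q, X - x⟫ ≤ 1 / 4 * H} := by ext q; simp [hQ]
    rw [this]
    exact isClosed_biInter fun X _ => isClosed_le (by fun_prop) (by fun_prop)
  have hQvol : volume Q ≤ ENNReal.ofReal C * volume S := by
    have h1 := (hM S (fun X hX => hX.1) hS.measurableSet).2
    refine le_trans ?_ h1
    have h2 : volume Q = volume ((fun q => p + (1 : ℝ) • q) '' Q) := by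
      rw [volume_image_affine]; simp
    rw [h2]
    refine measure_mono ?_
    rintro _ ⟨q, hq, rfl⟩
    obtain ⟨X, hX, hXq⟩ := exists_contact hΩo hu hu.1 subset_rfl hx hH (by norm_num) hS
      (fun X hX => by rw [hΩo.interior_eq]; exact hX.1) (fun X h1 h2 => hq X ⟨h1, h2⟩)
    simp only [mem_iUnion, one_smul]
    exact ⟨X, hX, hXq⟩
  set G₀ : Set (En n) := Q ∩ {q | |⟪q, e⟫| ≤ ε} with hG₀
  have hG₀cl : IsClosed G₀ := hQcl.inter (isClosed_le (by fun_prop) (by fun_prop))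
  set rm : En n := (1 / 4 : ℝ) • (p₁ - p) with hrm
  have hrmQ : rm ∈ Q := by
    intro X hX
    have h1 := hp₁ X hX.1
    have h2 := hX.2
    simp only [hrm, inner_smul_left, gap, inner_sub_left] at *
    simp only [conj_trivial]
    linarith
  have hrme : ⟪rm, e⟫ ≤ -(κ / 4) := by
    simp only [hrm, inner_smul_left, conj_trivial]; linarith
  have hNpos : 0 < N := by
    by_contra! h
    have : N = 0 := by omega
    subst this
    have : 0 < 64 ^ n * C := by positivity
    simp at hcon; linarith
  have hNr : (0:ℝ) < N := by exact_mod_cast hNpos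
  have hcount : (N : ℝ≥0∞) * volume ((fun q => (0 : En n) + (1 / 2 : ℝ) • q) '' G₀) ≤ volume Q := by
    have hinner : ∀ q ∈ G₀, |⟪q, e⟫| ≤ ε := fun q hq => hq.2
    refine nsmul_volume_le_of_translates ?_ ((1 / (2 * N) : ℝ) • rm) N ?_ ?_
    · refine IsClosed.measurableSet ?_
      simp only [zero_add]
      exact (hG₀cl.smul_of_ne_zero (c := (1 / 2 : ℝ)) (by norm_num))
    · rintro _ ⟨q, hq, rfl⟩ k hk1 - ⟨q', hq', heq⟩
      have h1 := abs_le.mp (hinner q hq)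
      have h2 := abs_le.mp (hinner q' hq')
      have h3 := congrArg (fun z => ⟪z, e⟫) heq
      simp only [zero_add, inner_add_left, inner_smul_left, conj_trivial] at h3
      have hk : (1:ℝ) ≤ k := by exact_mod_cast hk1
      have h4 : 1 / (2 * (N:ℝ)) * ⟪rm, e⟫ < - ε := by
        rw [one_div, inv_mul_lt_iff₀ (by positivity)]; nlinarith
      nlinarith
    · rintro _ ⟨q, hq, rfl⟩ k hk
      intro X hX
      have hk' : (k:ℝ) / N ≤ 1 := by rw [div_le_one hNr]; exact_mod_cast hk.le
      have hk0 : 0 ≤ (k:ℝ) / N := by positivity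
      have h1 := hq.1 X hX
      have h2 := hrmQ X hX
      simp only [zero_add, inner_add_left, inner_smul_left, conj_trivial]
      have h3 : (k:ℝ) * (1 / (2 * N) * ⟪rm, X - x⟫) = 1 / 2 * (k / N * ⟪rm, X - x⟫) := by
        field_simp
      rw [h3]
      have h4 : (k:ℝ) / N * ⟪rm, X - x⟫ ≤ k / N * (1 / 4 * H) := mul_le_mul_of_nonneg_left h2 hk0
      nlinarith
  set A : Set (En n) := (fun X => ((1 / 4 : ℝ) • (x + b • e) + (1 / 2 : ℝ) • x) + (1 / 4 : ℝ) • X) '' S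
    with hA
  have hAform : ∀ X ∈ S, ∀ Y ∈ S, ∀ Z ∈ S,
      (1 / 4 : ℝ) • X + (1 / 4 : ℝ) • Y + (1 / 2 : ℝ) • Z ∈ S := by
    intro X hX Y hY Z hZ
    have h1 := hScv hX hY (by norm_num : (0:ℝ) ≤ 1 / 2) (by norm_num : (0:ℝ) ≤ 1 / 2) (by norm_num)
    have h2 := hScv h1 hZ (by norm_num : (0:ℝ) ≤ 1 / 2) (by norm_num : (0:ℝ) ≤ 1 / 2) (by norm_num)
    convert h2 using 1
    module
  have hbS : x + b • e ∈ S := by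
    have h1 := hScv hxS heS (by norm_num : (0:ℝ) ≤ 1 / 2) (by norm_num : (0:ℝ) ≤ 1 / 2) (by norm_num)
    convert h1 using 1
    module
  have hAS : A ⊆ S := by
    rintro _ ⟨X, hX, rfl⟩
    convert hAform X hX _ hbS x hxS using 1
    module
  have hAc : IsCompact A := hS.image (by fun_prop)
  have hMA : MAm Ω u A ≤ ENNReal.ofReal (8 ^ n) * volume G₀ := by
    have h1 := volume_image_affine p 8 G₀
    rw [abs_of_pos (by norm_num : (0:ℝ) < 8)] at h1
    rw [← h1]
    refine measure_mono (iUnion₂_subset ?_)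
    rintro a ha p' hp'
    have haS := hAS ha
    obtain ⟨X, hX, rfl⟩ := ha
    have hSΩ : S ⊆ Ω := fun X hX => hX.1
    refine ⟨(1 / 8 : ℝ) • (p' - p), ⟨fun X' hX' => ?_, ?_⟩, by simp⟩
    · have h2 := hAform X hX _ hbS X' hX'
      have h3 := inner_le_of_mem_subgrad hSΩ hp.1 haS h2 h2.2 hp'
      have h4 : (1 / 4 : ℝ) • X + (1 / 4 : ℝ) • (x + b • e) + (1 / 2 : ℝ) • X' -
          ((1 / 4 : ℝ) • (x + b • e) + (1 / 2 : ℝ) • x + (1 / 4 : ℝ) • X) =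
          (1 / 2 : ℝ) • (X' - x) := by module
      rw [h4, inner_smul_right] at h3
      simp only [inner_smul_left, conj_trivial]
      linarith
    · have h2 := hAform X hX _ heS x hxS
      have h3 := inner_le_of_mem_subgrad hSΩ hp.1 haS h2 h2.2 hp'
      have h4 : (1 / 4 : ℝ) • X + (1 / 4 : ℝ) • (x + (2 * b) • e) + (1 / 2 : ℝ) • x -
          ((1 / 4 : ℝ) • (x + b • e) + (1 / 2 : ℝ) • x + (1 / 4 : ℝ) • X) =
          (1 / 4 * b) • e := by module
      have h2' := hAform X hX _ hxS x hxS
      have h3' := inner_le_of_mem_subgrad hSΩ hp.1 haS h2' h2'.2 hp'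
      have h4' : (1 / 4 : ℝ) • X + (1 / 4 : ℝ) • x + (1 / 2 : ℝ) • x -
          ((1 / 4 : ℝ) • (x + b • e) + (1 / 2 : ℝ) • x + (1 / 4 : ℝ) • X) =
          (-(1 / 4 * b)) • e := by module
      rw [h4, inner_smul_right] at h3
      rw [h4', inner_smul_right] at h3'
      simp only [mem_ofPred_eq, inner_smul_left, conj_trivial]
      rw [abs_le]
      constructor <;> nlinarith
  have hAvol : volume A = ENNReal.ofReal ((1 / 4) ^ n) * volume S := by
    rw [hA, volume_image_affine, abs_of_pos (by norm_num)]
  have hlow := (hM A (hAS.trans fun X hX => hX.1) hAc.measurableSet).1.trans hMA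
  rw [volume_image_affine, abs_of_pos (by norm_num)] at hcount
  have hSpos : 0 < volume S := volume_section_pos hΩo hu hx hH
  have hSfin : volume S ≠ ⊤ := hS.measure_lt_top.ne
  have hQfin : volume Q ≠ ⊤ := (hQvol.trans_lt (ENNReal.mul_lt_top (by simp) hS.measure_lt_top)).ne
  have hGfin : volume G₀ ≠ ⊤ := ne_top_of_le_ne_top hQfin (measure_mono inter_subset_left)
  have hcpos : 0 < c := by
    by_contra! h
    have : 0 < 64 ^ n * C := by positivity
    nlinarith
  rw [hAvol] at hlow
  have e1 := ENNReal.toReal_mono (ENNReal.mul_ne_top (by simp) hSfin) hQvol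
  have e2 := ENNReal.toReal_mono hQfin hcount
  have e3 := ENNReal.toReal_mono (ENNReal.mul_ne_top (by simp) hGfin) hlow
  have hSr : 0 < (volume S).toReal := ENNReal.toReal_pos hSpos.ne' hSfin
  have hGr : 0 ≤ (volume G₀).toReal := ENNReal.toReal_nonneg
  simp only [ENNReal.toReal_mul, ENNReal.toReal_natCast] at e1 e2 e3
  rw [ENNReal.toReal_ofReal (by positivity)] at e1 e2
  rw [ENNReal.toReal_ofReal (by positivity), ENNReal.toReal_ofReal (by positivity),
    ENNReal.toReal_ofReal (by positivity)] at e3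
  set VS := (volume S).toReal
  set VG := (volume G₀).toReal
  set VQ := (volume Q).toReal
  have e4 : c * VS ≤ 32 ^ n * VG := by
    have := mul_le_mul_of_nonneg_left e3 (by positivity : (0:ℝ) ≤ 4 ^ n)
    calc c * VS = 4 ^ n * (c * ((1 / 4) ^ n * VS)) := by
          rw [one_div, inv_pow]; field_simp
      _ ≤ 4 ^ n * (8 ^ n * VG) := this
      _ = 32 ^ n * VG := by rw [← mul_assoc, ← mul_pow]; norm_num
  have e5 : N * VG ≤ 2 ^ n * (C * VS) := by
    have := mul_le_mul_of_nonneg_left (e2.trans e1) (by positivity : (0:ℝ) ≤ 2 ^ n)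
    calc N * VG = 2 ^ n * (N * ((1 / 2) ^ n * VG)) := by
          rw [one_div, inv_pow]; field_simp
      _ ≤ _ := this
  have e6 : c * N * VS ≤ 64 ^ n * C * VS := by
    calc c * N * VS = N * (c * VS) := by ring
      _ ≤ N * (32 ^ n * VG) := mul_le_mul_of_nonneg_left e4 hNr.le
      _ = 32 ^ n * (N * VG) := by ring
      _ ≤ 32 ^ n * (2 ^ n * (C * VS)) := mul_le_mul_of_nonneg_left e5 (by positivity)
      _ = 64 ^ n * C * VS := by
        rw [← mul_assoc, ← mul_pow]; norm_num; ring
  have := le_of_mul_le_mul_right e6 hSr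
  linarith

/-- At an exposed point the subdifferential is a singleton. -/
lemma IsExp.eq_of_mem_subgrad (hΩo : IsOpen Ω) (hu : ConvexOn ℝ Ω u) {c C : ℝ} (hc : 0 < c)
    (hC : 0 < C) (hM : MABounds Ω u c C) {x p p₁ : En n} (hx : x ∈ Ω) (hp : IsExp Ω u x p)
    (hp₁ : p₁ ∈ subgrad Ω u x) : p₁ = p := by
  by_contra hne
  set e := p - p₁ with he
  set κ := ‖e‖ ^ 2 with hκ
  have he0 : e ≠ 0 := fun h => hne (sub_eq_zero.mp h).symm
  have hκ0 : 0 < κ := by positivity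
  obtain ⟨p₂, hp₂, hdir⟩ := exists_subgrad_dir hΩo hu hx e
  obtain ⟨N, hN⟩ := exists_nat_gt (64 ^ n * C / c)
  have hN' : 64 ^ n * C < c * N := by
    rw [div_lt_iff₀ hc] at hN
    linarith
  set ε := κ / (8 * N + 8) with hε
  have hε0 : 0 < ε := by positivity
  have hNε : 8 * N * ε < κ := by
    rw [hε, mul_div_assoc', div_lt_iff₀ (by positivity)]; nlinarith
  obtain ⟨τ, hτ, hτd⟩ := hdir (ε / 2) (by positivity)
  set L := gap u x p (x + τ • e) / τ with hL
  have hτΩ := (hτd τ ⟨hτ.le, le_rfl⟩).1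
  have hL0 : 0 ≤ L := div_nonneg (mem_subgrad_iff.mp hp.1 _ hτΩ) hτ.le
  have hLt : ∀ t ∈ Icc 0 τ, gap u x p (x + t • e) ≤ L * t := by
    intro t ht
    have hs : 0 ≤ t / τ ∧ t / τ ≤ 1 := ⟨div_nonneg ht.1 hτ.le, (div_le_one hτ).mpr ht.2⟩
    have heq : (1 - t / τ) • x + (t / τ) • (x + τ • e) = x + t • e := by
      have : t / τ * τ = t := div_mul_cancel₀ _ hτ.ne'
      rw [smul_add, smul_smul, this]; module
    have h3 := (convexOn_gap hu x p).2 hx hτΩ (sub_nonneg.mpr hs.2) hs.1 (by ring)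
    rw [heq, gap_self] at h3
    refine h3.trans_eq ?_
    simp only [smul_eq_mul, hL]; field_simp; ring
  set s := min (1 / 2) (ε / (2 * (L + 1))) with hs
  have hs0 : 0 < s := lt_min (by norm_num) (by positivity)
  have hs1 : s ≤ 1 / 2 := min_le_left _ _
  have hsL : s * L ≤ ε / 2 := by
    have : s ≤ ε / (2 * (L + 1)) := min_le_right _ _
    rw [le_div_iff₀ (by positivity)] at this
    nlinarith
  set p' := s • p + (1 - s) • p₂ with hp'
  have hgap : ∀ X, gap u x p' X = s * gap u x p X + (1 - s) * gap u x p₂ X := by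
    intro X
    simp only [hp', gap, inner_add_left, inner_smul_left, conj_trivial]; ring
  have hexp : IsExp Ω u x p' := by
    refine ⟨mem_subgrad_iff.mpr fun X hX => ?_, fun X hX hXx => ?_⟩
    · rw [hgap]
      have h1 := mem_subgrad_iff.mp hp.1 X hX
      have h2 := mem_subgrad_iff.mp hp₂ X hX
      have : 0 ≤ 1 - s := by linarith
      positivity
    · rw [hgap]
      have h1 := hp.2 X hX hXx
      have h2 := mem_subgrad_iff.mp hp₂ X hX
      have : 0 ≤ 1 - s := by linarith
      positivity
  have hpe : ⟪p, e⟫ ≤ ⟪p₂, e⟫ := by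
    refine le_of_forall_pos_le_add fun δ hδ => ?_
    obtain ⟨t, ht, htd⟩ := hdir δ hδ
    have h1 := htd t ⟨ht.le, le_rfl⟩
    have h2 := hp.1 _ h1.1
    have h3 := h1.2
    simp only [gap, add_sub_cancel_left, inner_smul_right] at h2 h3
    nlinarith
  have hfin := exposed_count_le hΩo hu hC hM hx hexp hp₁ (e := e) (κ := κ) (ε := ε) ?_ hε0 hNε hτ ?_
  · linarith
  · have h1 : ⟪p - p₁, e⟫ = κ := real_inner_self_eq_norm_sq e
    simp only [hp', inner_sub_left, inner_add_left, inner_smul_left, conj_trivial] at *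
    nlinarith
  · intro t ht
    refine ⟨(hτd t ht).1, ?_⟩
    rw [hgap]
    have h1 := hLt t ht
    have h2 := (hτd t ht).2
    have h3 := mem_subgrad_iff.mp hp₂ _ (hτd t ht).1
    have h4 : s * gap u x p (x + t • e) ≤ s * (L * t) := mul_le_mul_of_nonneg_left h1 hs0.le
    have h5 : s * L * t ≤ ε / 2 * t := mul_le_mul_of_nonneg_right hsL ht.1
    nlinarith

end Sections

section Flat

variable {n : ℕ} {Ω : Set (En n)} {u : En n → ℝ}

/-- The set swept by `S` along the segment from `0` to `b • e`. -/
def sweep (S : Set (En n)) (e : En n) (b : ℝ) : Set (En n) :=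
  (fun z : En n × ℝ => z.1 + z.2 • e) '' (S ×ˢ Icc 0 b)

lemma sweep_mono {S T : Set (En n)} (h : S ⊆ T) (e : En n) (b : ℝ) : sweep S e b ⊆ sweep T e b :=
  image_mono (prod_mono h subset_rfl)

lemma sweep_iUnion {ι : Sort*} (S : ι → Set (En n)) (e : En n) (b : ℝ) :
    sweep (⋃ i, S i) e b = ⋃ i, sweep (S i) e b := by
  simp only [sweep, iUnion_prod_const, image_iUnion]

lemma volume_sweep_one_le (S : Set (En n)) (e : En n) (j : ℕ) :
    volume (sweep S e 1) ≤ ((j + 1 : ℕ) : ℝ≥0∞) * volume (sweep S e (1 / (j + 1))) := by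
  have hj : (0:ℝ) < (j:ℝ) + 1 := by positivity
  have hsub : sweep S e 1 ⊆ ⋃ k ∈ Finset.range (j + 1),
      (fun r => ((k:ℝ) / (j + 1)) • e + (1:ℝ) • r) '' sweep S e (1 / (j + 1)) := by
    rintro _ ⟨⟨x, t⟩, ⟨hx, ht0, ht1⟩, rfl⟩
    simp only at hx ht0 ht1 ⊢
    simp only [mem_iUnion, exists_prop]
    obtain ⟨k, hk, h1, h2⟩ : ∃ k : ℕ, k < j + 1 ∧ (k:ℝ) / (j + 1) ≤ t ∧
        t ≤ (k + 1) / (j + 1) := by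
      rcases ht1.lt_or_eq with h | h
      · refine ⟨⌊t * (j + 1)⌋₊, ?_, ?_, ?_⟩
        · rw [Nat.floor_lt (by positivity)]; push_cast; nlinarith
        · rw [div_le_iff₀ hj]; exact Nat.floor_le (by positivity)
        · rw [le_div_iff₀ hj]; exact (Nat.lt_floor_add_one _).le
      · refine ⟨j, by omega, ?_, ?_⟩
        · rw [h, div_le_one hj]; linarith
        · rw [h, div_self hj.ne']
    refine ⟨k, Finset.mem_range.mpr hk, x + (t - k / (j + 1)) • e,
      ⟨(x, t - k / (j + 1)), ⟨hx, by simpa using h1, ?_⟩, rfl⟩, ?_⟩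
    · rw [add_div] at h2; simp only; linarith
    · simp only; module
  refine (measure_mono hsub).trans ((measure_biUnion_finset_le _ _).trans ?_)
  simp only [volume_image_affine]
  simp

/-- The point `x` lies on a segment `[a₀, a₁]` of contact with an affine function of slope `p`,
crossing the slab `s₀ ≤ x i ≤ s₁`, and the gap above `p` at the midpoint `m` grows slowly in the
direction `e`. -/
structure IsFlat (Ω : Set (En n)) (u : En n → ℝ) (D : Set (En n)) (ρ : ℝ) (e : En n) (i : Fin n)
    (s₀ s₁ ε b : ℝ) (x m p a₀ a₁ : En n) : Prop where
  left_mem : a₀ ∈ D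
  right_mem : a₁ ∈ D
  mem_segment : x ∈ segment ℝ a₀ a₁
  mid : m = (1 / 2 : ℝ) • (a₀ + a₁)
  le_left : a₀ i ≤ s₀
  right_le : s₁ ≤ a₁ i
  mem_subgrad : p ∈ subgrad Ω u m
  gap_left : gap u m p a₀ = 0
  gap_right : gap u m p a₁ = 0
  ball_subset : Metric.closedBall m ρ ⊆ D
  dir : ∀ t ∈ Icc 0 b, m + t • e ∈ D ∧ gap u m p (m + t • e) ≤ ε * t

section

variable {D : Set (En n)} {ρ : ℝ} {e : En n} {i : Fin n} {s₀ s₁ ε b : ℝ} {x m p a₀ a₁ : En n}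

lemma IsFlat.approx (hu : ConvexOn ℝ Ω u) (hD : Convex ℝ D) (hDΩ : D ⊆ Ω)
    (h : IsFlat Ω u D ρ e i s₀ s₁ ε b x m p a₀ a₁) {H : ℝ} (hH : 0 < H) {q : En n}
    (hq : ∀ X ∈ D, gap u m p X ≤ H → ⟪q - p, X - m⟫ ≤ 1 / 8 * H) {y : En n}
    (hy : y ∈ segment ℝ a₀ a₁) {X : En n} (hX : X ∈ D) :
    u y - ⟪q, y⟫ ≤ u X - ⟪q, X⟫ + H / 4 := by
  have hmD : m ∈ D := by
    rw [h.mid]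
    convert hD h.left_mem h.right_mem (by norm_num : (0:ℝ) ≤ 1 / 2)
      (by norm_num : (0:ℝ) ≤ 1 / 2) (by norm_num) using 1
    module
  have hcx := (convexOn_gap hu m p).subset hDΩ hD
  have hyD : y ∈ D := hD.segment_subset h.left_mem h.right_mem hy
  obtain ⟨s, t, hs, ht, hst, rfl⟩ := hy
  set y := s • a₀ + t • a₁ with hydef
  have hgy : gap u m p y ≤ 0 := by
    have := hcx.2 h.left_mem h.right_mem hs ht hst
    rwa [h.gap_left, h.gap_right, smul_zero, smul_zero, add_zero] at this
  have h0 := hq a₀ h.left_mem (by rw [h.gap_left]; exact hH.le)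
  have h1 := hq a₁ h.right_mem (by rw [h.gap_right]; exact hH.le)
  have h01 : ⟪q - p, a₁ - m⟫ = -⟪q - p, a₀ - m⟫ := by
    rw [← inner_neg_right]
    congr 1
    rw [h.mid]
    module
  have hym : y - m = s • (a₀ - m) + t • (a₁ - m) := by
    have : s = 1 - t := by linarith
    rw [hydef, this]; module
  have hyi : ⟪q - p, y - m⟫ ≥ -(1 / 8 * H) := by
    rw [hym, inner_add_right, inner_smul_right, inner_smul_right, h01]
    rw [h01] at h1
    have : s = 1 - t := by linarith
    subst this
    nlinarith
  have key : gap u m p X - ⟪q - p, X - m⟫ ≥ -(1 / 8 * H) := by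
    have hg0 := mem_subgrad_iff.mp h.mem_subgrad X (hDΩ hX)
    by_cases hXH : gap u m p X ≤ H
    · have := hq X hX hXH
      linarith
    · have := inner_le_of_section hcx hmD (gap_self u m p) hH hq hX (not_le.mp hXH).le
      nlinarith
  simp only [gap, inner_sub_left, inner_sub_right] at *
  linarith

lemma IsFlat.mem_section (hu : ConvexOn ℝ Ω u) (hD : Convex ℝ D) (hDΩ : D ⊆ Ω) {x' m' p' a₀' a₁' : En n}
    (h : IsFlat Ω u D ρ e i s₀ s₁ ε b x m p a₀ a₁)
    (h' : IsFlat Ω u D ρ e i s₀ s₁ ε b x' m' p' a₀' a₁') {H : ℝ} (hH : 0 < H) {q : En n}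
    (hq : ∀ X ∈ D, gap u m p X ≤ H → ⟪q - p, X - m⟫ ≤ 1 / 8 * H)
    (hq' : ∀ X ∈ D, gap u m' p' X ≤ H → ⟪q - p', X - m'⟫ ≤ 1 / 8 * H) :
    x' ∈ D ∧ gap u m p x' ≤ H := by
  have hmD : m ∈ D := by
    rw [h.mid]
    convert hD h.left_mem h.right_mem (by norm_num : (0:ℝ) ≤ 1 / 2)
      (by norm_num : (0:ℝ) ≤ 1 / 2) (by norm_num) using 1
    module
  have hcx := (convexOn_gap hu m p).subset hDΩ hD
  have hxD : x' ∈ D := hD.segment_subset h'.left_mem h'.right_mem h'.mem_segment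
  refine ⟨hxD, ?_⟩
  by_contra! hcon
  have h1 := h'.approx hu hD hDΩ hH hq' h'.mem_segment hmD
  have h2 := inner_le_of_section hcx hmD (gap_self u m p) hH hq hxD hcon.le
  simp only [gap, inner_sub_left, inner_sub_right] at *
  linarith

lemma IsFlat.shift_le (hu : ConvexOn ℝ Ω u) (hD : Convex ℝ D) (hDΩ : D ⊆ Ω) {x' m' p' a₀' a₁' : En n}
    (h : IsFlat Ω u D ρ e i s₀ s₁ ε b x m p a₀ a₁)
    (h' : IsFlat Ω u D ρ e i s₀ s₁ ε b x' m' p' a₀' a₁') {H β : ℝ} (hH : 0 < H) {q : En n}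
    (hβ : 0 ≤ β)
    (hq : ∀ X ∈ D, gap u m p X ≤ H → ⟪q - p, X - m⟫ ≤ 1 / 8 * H)
    (hq' : ∀ X ∈ D, gap u m' p' X ≤ H →
      ⟪(q + β • EuclideanSpace.single i (1:ℝ)) - p', X - m'⟫ ≤ 1 / 8 * H) :
    β * (s₁ - s₀) ≤ H / 2 := by
  have h1 := h.approx hu hD hDΩ hH hq (right_mem_segment ℝ a₀ a₁) h'.left_mem
  have h2 := h'.approx hu hD hDΩ hH hq' (left_mem_segment ℝ a₀' a₁') h.right_mem
  have hs : ∀ X : En n, ⟪q + β • EuclideanSpace.single i (1:ℝ), X⟫ = ⟪q, X⟫ + β * X i := by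
    intro X
    rw [inner_add_left, inner_smul_left, EuclideanSpace.inner_single_left]
    simp
  rw [hs, hs] at h2
  have h3 := h'.le_left
  have h4 := h.right_le
  nlinarith

end

lemma volume_section_sweep_le (hΩo : IsOpen Ω) (hu : ConvexOn ℝ Ω u) {c C : ℝ} (hc : 0 < c)
    (hM : MABounds Ω u c C) {D : Set (En n)} (hD : Convex ℝ D) (hDc : IsCompact D) (hDΩ : D ⊆ Ω)
    {m p e : En n} {H b : ℝ} (hm : m ∈ D) (hp : p ∈ subgrad Ω u m) (hH : 0 < H)
    (hdir : ∀ t ∈ Icc 0 b, m + t • e ∈ D ∧ gap u m p (m + t • e) ≤ H) :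
    volume (sweep {X | X ∈ D ∧ gap u m p X ≤ H} e b) ≤ ENNReal.ofReal (64 ^ n / c) *
      volume {q | ∀ X ∈ D, gap u m p X ≤ H → ⟪q - p, X - m⟫ ≤ 1 / 8 * H} := by
  set S := {X | X ∈ D ∧ gap u m p X ≤ H} with hS
  set Q := {q | ∀ X ∈ D, gap u m p X ≤ H → ⟪q - p, X - m⟫ ≤ 1 / 8 * H} with hQ
  have hcx := (convexOn_gap hu m p).subset hDΩ hD
  have hScv : Convex ℝ S := hcx.convex_le H
  have hSc : IsCompact S := by
    have : S = D ∩ gap u m p ⁻¹' Iic H := rfl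
    rw [this]
    exact hDc.of_isClosed_subset (((continuousOn_gap hΩo hu m p).mono hDΩ).preimage_isClosed_of_isClosed
      hDc.isClosed isClosed_Iic) inter_subset_left
  have hmS : m ∈ S := ⟨hm, by rw [gap_self]; exact hH.le⟩
  have hTc : IsCompact (sweep S e b) :=
    (hSc.prod isCompact_Icc).image (by fun_prop)
  set A := (fun y => (3 / 4 : ℝ) • m + (1 / 4 : ℝ) • y) '' sweep S e b with hA
  have hAc : IsCompact A := hTc.image (by fun_prop)
  have hAform : ∀ X ∈ S, ∀ Y ∈ S, ∀ Z ∈ S,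
      (1 / 4 : ℝ) • X + (1 / 4 : ℝ) • Y + (1 / 2 : ℝ) • Z ∈ S := by
    intro X hX Y hY Z hZ
    have h1 := hScv hX hY (by norm_num : (0:ℝ) ≤ 1 / 2) (by norm_num : (0:ℝ) ≤ 1 / 2) (by norm_num)
    have h2 := hScv h1 hZ (by norm_num : (0:ℝ) ≤ 1 / 2) (by norm_num : (0:ℝ) ≤ 1 / 2) (by norm_num)
    convert h2 using 1
    module
  have hAdesc : ∀ a ∈ A, ∃ X ∈ S, ∃ Y ∈ S, a = (1 / 4 : ℝ) • X + (1 / 4 : ℝ) • Y + (1 / 2 : ℝ) • m := by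
    rintro _ ⟨_, ⟨⟨X, t⟩, ⟨hX, ht⟩, rfl⟩, rfl⟩
    refine ⟨X, hX, m + t • e, hdir t ht, ?_⟩
    simp only
    module
  have hAS : A ⊆ S := by
    intro a ha
    obtain ⟨X, hX, Y, hY, rfl⟩ := hAdesc a ha
    exact hAform X hX Y hY m hmS
  have hMA : MAm Ω u A ≤ ENNReal.ofReal (16 ^ n) * volume Q := by
    have h1 := volume_image_affine ((-15 : ℝ) • p) 16 Q
    rw [abs_of_pos (by norm_num : (0:ℝ) < 16)] at h1
    rw [← h1]
    refine measure_mono (iUnion₂_subset ?_)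
    rintro a ha p' hp'
    have haS := hAS ha
    obtain ⟨X, hX, Y, hY, rfl⟩ := hAdesc a ha
    refine ⟨p + (1 / 16 : ℝ) • (p' - p), fun X' hX' hX'H => ?_, by module⟩
    have h2 := hAform X hX Y hY X' ⟨hX', hX'H⟩
    have h3 := inner_le_of_mem_subgrad hDΩ hp haS.1 h2.1 h2.2 hp'
    have h4 : (1 / 4 : ℝ) • X + (1 / 4 : ℝ) • Y + (1 / 2 : ℝ) • X' -
        ((1 / 4 : ℝ) • X + (1 / 4 : ℝ) • Y + (1 / 2 : ℝ) • m) =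
        (1 / 2 : ℝ) • (X' - m) := by module
    rw [h4, inner_smul_right] at h3
    simp only [add_sub_cancel_left, inner_smul_left, conj_trivial]
    linarith
  have hlow := (hM A (hAS.trans fun X hX => hDΩ hX.1) hAc.measurableSet).1.trans hMA
  rw [hA, volume_image_affine, abs_of_pos (by norm_num), ← mul_assoc,
    ← ENNReal.ofReal_mul hc.le] at hlow
  calc volume (sweep S e b)
      = ENNReal.ofReal (4 ^ n / c) * (ENNReal.ofReal (c * (1 / 4) ^ n) * volume (sweep S e b)) := by
        rw [← mul_assoc, ← ENNReal.ofReal_mul (by positivity)]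
        have : (4:ℝ) ^ n / c * (c * (1 / 4) ^ n) = 1 := by
          rw [one_div, inv_pow]; field_simp
        rw [this]; simp
    _ ≤ ENNReal.ofReal (4 ^ n / c) * (ENNReal.ofReal (16 ^ n) * volume Q) := by gcongr
    _ = ENNReal.ofReal (64 ^ n / c) * volume Q := by
        rw [← mul_assoc, ← ENNReal.ofReal_mul (by positivity)]
        congr 2
        rw [div_mul_eq_mul_div, ← mul_pow]; norm_num

end Flat

section FlatNull

variable {n : ℕ} {Ω : Set (En n)} {u : En n → ℝ}

/-- Slopes whose excess over `p` is controlled on a section centred at `m`. -/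
def excessSlopes (u : En n → ℝ) (D : Set (En n)) (m p : En n) (H : ℝ) : Set (En n) :=
  {q | ∀ X ∈ D, gap u m p X ≤ H → ⟪q - p, X - m⟫ ≤ 1 / 8 * H}

lemma isClosed_excessSlopes (D : Set (En n)) (m p : En n) (H : ℝ) :
    IsClosed (excessSlopes u D m p H) := by
  have : excessSlopes u D m p H = ⋂ X ∈ D, ⋂ (_ : gap u m p X ≤ H),
      {q : En n | ⟪q - p, X - m⟫ ≤ 1 / 8 * H} := by
    ext q; simp [excessSlopes]
  rw [this]
  exact isClosed_biInter fun X _ => isClosed_iInter fun _ =>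
    isClosed_le (by fun_prop) continuous_const

lemma mem_interior_excessSlopes {D : Set (En n)} (hD : Bornology.IsBounded D) (m p : En n) {H : ℝ}
    (hH : 0 < H) : p ∈ interior (excessSlopes u D m p H) := by
  obtain ⟨R, hR0, hR⟩ := (hD.subset_closedBall_lt 0 m)
  rw [mem_interior_iff_mem_nhds]
  refine Filter.mem_of_superset (Metric.closedBall_mem_nhds p (div_pos hH (by positivity : 0 < 8 * R)))
    fun q hq X hX _ => ?_
  rw [mem_closedBall_iff_norm] at hq
  have h1 := hR hX
  rw [mem_closedBall_iff_norm] at h1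
  calc ⟪q - p, X - m⟫ ≤ ‖q - p‖ * ‖X - m‖ := real_inner_le_norm _ _
    _ ≤ H / (8 * R) * R := by gcongr
    _ = 1 / 8 * H := by field_simp

lemma norm_sub_le_of_mem_excessSlopes (hΩo : IsOpen Ω) (hu : ConvexOn ℝ Ω u) {D : Set (En n)}
    (hDΩ : D ⊆ Ω) {R ρ H : ℝ} (hR : 0 < R) (hρ : 0 < ρ) (hH : 0 < H) (hH1 : H ≤ 1)
    (hb : ∀ x ∈ D, ∀ p ∈ subgrad Ω u x, ‖p‖ ≤ R) {m p q : En n}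
    (hp : p ∈ subgrad Ω u m) (hball : Metric.closedBall m ρ ⊆ D)
    (hq : q ∈ excessSlopes u D m p H) : ‖q - p‖ ≤ 1 / (8 * ρ) + R / 4 := by
  have hm : m ∈ D := hball (Metric.mem_closedBall_self hρ.le)
  rcases eq_or_ne (q - p) 0 with h0 | h0
  · rw [h0, norm_zero]; positivity
  have hd : 0 < ‖q - p‖ := norm_pos_iff.mpr h0
  set r := min ρ (H / (2 * R)) with hr
  have hr0 : 0 < r := lt_min hρ (by positivity)
  set X := m + (r / ‖q - p‖) • (q - p) with hX
  have hXm : ‖X - m‖ = r := by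
    rw [hX, add_sub_cancel_left, norm_smul, Real.norm_eq_abs, abs_of_pos (by positivity)]
    field_simp
  have hXD : X ∈ D := hball (by rw [mem_closedBall_iff_norm, hXm]; exact min_le_left _ _)
  have hgap : gap u m p X ≤ H := by
    obtain ⟨pX, hpX⟩ := subgrad_nonempty hΩo hu (hDΩ hXD)
    have h1 := mem_subgrad_iff.mp hpX m (hDΩ hm)
    have h2 : gap u m p X ≤ ⟪pX - p, X - m⟫ := by
      simp only [gap, inner_sub_left, inner_sub_right] at *
      linarith
    have h3 : ⟪pX - p, X - m⟫ ≤ (R + R) * r := by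
      rw [← hXm]
      refine (real_inner_le_norm _ _).trans ?_
      gcongr
      exact (norm_sub_le _ _).trans (add_le_add (hb X hXD pX hpX) (hb m hm p hp))
    have h4 : r * (2 * R) ≤ H := by
      rw [← le_div_iff₀ (by positivity)]; exact min_le_right _ _
    linarith
  have h1 := hq X hXD hgap
  rw [hX, add_sub_cancel_left, inner_smul_right, real_inner_self_eq_norm_sq] at h1
  have h2 : r / ‖q - p‖ * ‖q - p‖ ^ 2 = r * ‖q - p‖ := by field_simp
  rw [h2] at h1
  rcases min_choice ρ (H / (2 * R)) with h | h
  · rw [← hr] at h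
    rw [h] at h1
    have : ‖q - p‖ ≤ 1 / (8 * ρ) := by
      rw [le_div_iff₀ (by positivity)]; linarith
    linarith
  · rw [← hr] at h
    rw [h] at h1
    have : ‖q - p‖ ≤ R / 4 := by
      rw [div_mul_eq_mul_div, div_le_iff₀ (by positivity)] at h1
      have : H * ‖q - p‖ ≤ H * (R / 4) := by linarith
      exact le_of_mul_le_mul_left this hH
    have : 0 < 1 / (8 * ρ) := by positivity
    linarith

lemma exists_volume_sweep_isFlat_le (hΩo : IsOpen Ω) (hu : ConvexOn ℝ Ω u) {c C : ℝ} (hc : 0 < c)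
    (hM : MABounds Ω u c C) {D : Set (En n)} (hD : Convex ℝ D) (hDc : IsCompact D) (hDΩ : D ⊆ Ω)
    {ρ : ℝ} (hρ : 0 < ρ) (e : En n) (i : Fin n) {s₀ s₁ : ℝ} (hs : s₀ < s₁) :
    ∃ K : ℝ, 0 ≤ K ∧ ∀ ε : ℝ, 0 < ε → ε ≤ 1 → ε ≤ s₁ - s₀ → ∀ j : ℕ,
      volume (sweep {x | ∃ m p a₀ a₁, IsFlat Ω u D ρ e i s₀ s₁ ε (1 / (j + 1)) x m p a₀ a₁} e 1) ≤
        ENNReal.ofReal (K * ε) := by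
  obtain ⟨R, hR, hRb⟩ := exists_subgrad_bound hΩo hu hDc hDΩ
  set R' := R + (1 / (8 * ρ) + R / 4) + 1 with hR'
  set V := volume (Metric.closedBall (0 : En n) R') with hV
  have hVt : V ≠ ⊤ := measure_closedBall_lt_top.ne
  have hs' : 0 < s₁ - s₀ := by linarith
  refine ⟨64 ^ n / c * (2 / (s₁ - s₀)) * V.toReal, by positivity, fun ε hε hε1 hεs j => ?_⟩
  set b : ℝ := 1 / (j + 1) with hb
  have hj : (0:ℝ) < (j:ℝ) + 1 := by positivity
  have hb0 : 0 < b := by positivity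
  have hb1 : b ≤ 1 := by
    rw [hb, div_le_one hj]; linarith [(Nat.cast_nonneg j : (0:ℝ) ≤ j)]
  set A := {x | ∃ m p a₀ a₁, IsFlat Ω u D ρ e i s₀ s₁ ε b x m p a₀ a₁} with hA
  set H := ε * b with hHdef
  have hH : 0 < H := by positivity
  have hHε : H ≤ ε := by nlinarith
  have hch : ∀ x ∈ A, ∃ m p a₀ a₁, IsFlat Ω u D ρ e i s₀ s₁ ε b x m p a₀ a₁ := fun x hx => hx
  choose! m p a₀ a₁ hfl using hch
  set Q : En n → Set (En n) := fun x => excessSlopes u D (m x) (p x) H with hQ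
  have hQne : ∀ x ∈ A, (interior (Q x)).Nonempty := fun x hx =>
    ⟨p x, mem_interior_excessSlopes hDc.isBounded _ _ hH⟩
  obtain ⟨I, hIA, hId, hIc⟩ := Vitali.exists_disjoint_subfamily_covering_enlargement Q A (fun _ => 1) 2
    one_lt_two (fun _ _ => zero_le_one) 1 (fun _ _ => le_rfl)
    (fun x hx => (hQne x hx).mono interior_subset)
  have hIcount : I.Countable :=
    hId.countable_of_nonempty_interior fun x hx => hQne x (hIA hx)
  have hmD : ∀ x ∈ A, m x ∈ D := fun x hx =>
    (hfl x hx).ball_subset (Metric.mem_closedBall_self hρ.le)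
  set U := ⋃ k ∈ I, Q k with hU
  have hUm : MeasurableSet U :=
    MeasurableSet.biUnion hIcount fun k _ => (isClosed_excessSlopes _ _ _ _).measurableSet
  have hAsub : A ⊆ ⋃ k ∈ I, {X | X ∈ D ∧ gap u (m k) (p k) X ≤ H} := by
    intro x hx
    obtain ⟨k, hk, ⟨q, hq, hq'⟩, -⟩ := hIc x hx
    exact mem_biUnion hk ((hfl k (hIA hk)).mem_section hu hD hDΩ (hfl x hx) hH hq' hq)
  have hsum : volume (sweep A e b) ≤ ENNReal.ofReal (64 ^ n / c) * volume U := by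
    refine (measure_mono (sweep_mono hAsub e b)).trans ?_
    simp only [sweep_iUnion]
    refine (measure_biUnion_le _ hIcount _).trans ?_
    rw [hU, measure_biUnion hIcount hId fun k _ => (isClosed_excessSlopes _ _ _ _).measurableSet,
      ← ENNReal.tsum_mul_left]
    refine ENNReal.tsum_le_tsum fun k => ?_
    have hk := hfl k (hIA k.2)
    refine volume_section_sweep_le hΩo hu hc hM hD hDc hDΩ (hmD k (hIA k.2)) hk.mem_subgrad hH
      fun t ht => ⟨(hk.dir t ht).1, (hk.dir t ht).2.trans ?_⟩
    exact mul_le_mul_of_nonneg_left ht.2 hε.le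
  set β := H / (s₁ - s₀) with hβ
  have hβ0 : 0 < β := by positivity
  have hβ1 : β ≤ 1 := by rw [hβ, div_le_one hs']; linarith
  set N := ⌊1 / β⌋₊ with hN
  have hN1 : (N:ℝ) * β ≤ 1 := by
    rw [← le_div_iff₀ hβ0]; exact Nat.floor_le (by positivity)
  have hN2 : 1 ≤ 2 * (N:ℝ) * β := by
    have h1 := Nat.lt_floor_add_one (1 / β)
    rw [← hN, div_lt_iff₀ hβ0] at h1
    have h2 : 1 ≤ N := Nat.one_le_iff_ne_zero.mpr (by
      rw [hN]; exact (Nat.floor_pos.mpr (by rw [le_div_iff₀ hβ0]; linarith)).ne')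
    have h3 : (1:ℝ) ≤ N := by exact_mod_cast h2
    nlinarith
  have hNV : (N:ℝ≥0∞) * volume U ≤ V := by
    refine nsmul_volume_le_of_translates hUm (β • EuclideanSpace.single i (1:ℝ)) N ?_ ?_
    · intro q hq k hk hkN hq'
      obtain ⟨x, hx, hqx⟩ := mem_iUnion₂.mp hq
      obtain ⟨y, hy, hqy⟩ := mem_iUnion₂.mp hq'
      rw [smul_smul] at hqy
      have h1 := (hfl x (hIA hx)).shift_le hu hD hDΩ (hfl y (hIA hy)) hH
        (by positivity : 0 ≤ (k:ℝ) * β) hqx hqy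
      have h2 : (1:ℝ) ≤ k := by exact_mod_cast hk
      rw [hβ, mul_assoc, div_mul_cancel₀ _ hs'.ne'] at h1
      nlinarith
    · intro q hq k hkN
      obtain ⟨x, hx, hqx⟩ := mem_iUnion₂.mp hq
      have hx' := hfl x (hIA hx)
      have h1 := norm_sub_le_of_mem_excessSlopes hΩo hu hDΩ hR hρ hH (hHε.trans hε1) hRb
        hx'.mem_subgrad hx'.ball_subset hqx
      have h2 := hRb _ (hmD x (hIA hx)) _ hx'.mem_subgrad
      rw [mem_closedBall_zero_iff]
      have h3 : ‖(k:ℝ) • (β • EuclideanSpace.single i (1:ℝ))‖ ≤ 1 := by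
        rw [smul_smul, norm_smul, Real.norm_eq_abs, abs_of_nonneg (by positivity)]
        simp only [PiLp.norm_single, norm_one, mul_one]
        have : (k:ℝ) ≤ N := by exact_mod_cast hkN.le
        nlinarith
      have h4 : q = (q - p x) + p x := by abel
      calc ‖q + (k:ℝ) • (β • EuclideanSpace.single i (1:ℝ))‖ ≤ ‖q‖ + 1 := (norm_add_le _ _).trans (by gcongr)
        _ ≤ (‖q - p x‖ + ‖p x‖) + 1 := by
          gcongr; conv_lhs => rw [h4]
          exact norm_add_le _ _
        _ ≤ R' := by rw [hR']; linarith
  have hUV : volume U ≤ ENNReal.ofReal (2 * β) * V := by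
    calc volume U ≤ ENNReal.ofReal (2 * N * β) * volume U := by
          conv_lhs => rw [← one_mul (volume U)]
          gcongr
          rw [← ENNReal.ofReal_one]
          exact ENNReal.ofReal_le_ofReal hN2
      _ = ENNReal.ofReal (2 * β) * (N * volume U) := by
          rw [← mul_assoc, ← ENNReal.ofReal_natCast, ← ENNReal.ofReal_mul (by positivity)]
          congr 2; ring
      _ ≤ _ := by gcongr
  calc volume (sweep A e 1) ≤ ((j + 1 : ℕ) : ℝ≥0∞) * volume (sweep A e b) := volume_sweep_one_le A e j
    _ ≤ ((j + 1 : ℕ) : ℝ≥0∞) * (ENNReal.ofReal (64 ^ n / c) * (ENNReal.ofReal (2 * β) * V)) := by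
        gcongr; exact hsum.trans (by gcongr)
    _ = ENNReal.ofReal (64 ^ n / c * (2 / (s₁ - s₀)) * V.toReal * ε) := by
        rw [← ENNReal.ofReal_toReal hVt, ← ENNReal.ofReal_natCast, ← ENNReal.ofReal_mul (by positivity),
          ← ENNReal.ofReal_mul (by positivity), ← ENNReal.ofReal_mul (by positivity),
          ENNReal.toReal_ofReal (by positivity)]
        congr 1
        rw [hβ, hHdef, hb]
        push_cast
        field_simp

lemma volume_sweep_iUnion_isFlat_eq_zero (hΩo : IsOpen Ω) (hu : ConvexOn ℝ Ω u) {c C : ℝ}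
    (hc : 0 < c) (hM : MABounds Ω u c C) {D : Set (En n)} (hD : Convex ℝ D) (hDc : IsCompact D)
    (hDΩ : D ⊆ Ω) {ρ : ℝ} (hρ : 0 < ρ) (e : En n) (i : Fin n) {s₀ s₁ : ℝ} (hs : s₀ < s₁) :
    volume (sweep {x | ∀ ε > 0, ∃ j : ℕ, ∃ m p a₀ a₁,
      IsFlat Ω u D ρ e i s₀ s₁ ε (1 / (j + 1)) x m p a₀ a₁} e 1) = 0 := by
  obtain ⟨K, hK0, hK⟩ := exists_volume_sweep_isFlat_le hΩo hu hc hM hD hDc hDΩ hρ e i hs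
  set A := {x | ∀ ε > 0, ∃ j : ℕ, ∃ m p a₀ a₁,
      IsFlat Ω u D ρ e i s₀ s₁ ε (1 / (j + 1)) x m p a₀ a₁}
  have hle : ∀ ε : ℝ, 0 < ε → ε ≤ 1 → ε ≤ s₁ - s₀ →
      volume (sweep A e 1) ≤ ENNReal.ofReal (K * ε) := by
    intro ε hε hε1 hεs
    have hsub : A ⊆ ⋃ j : ℕ, {x | ∃ m p a₀ a₁,
        IsFlat Ω u D ρ e i s₀ s₁ ε (1 / (j + 1)) x m p a₀ a₁} := fun x hx => mem_iUnion.mpr (hx ε hε)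
    refine (measure_mono (sweep_mono hsub e 1)).trans ?_
    rw [sweep_iUnion]
    have hmono : Monotone fun j : ℕ => sweep {x | ∃ m p a₀ a₁,
        IsFlat Ω u D ρ e i s₀ s₁ ε (1 / (j + 1)) x m p a₀ a₁} e 1 := by
      intro j k hjk
      refine sweep_mono ?_ e 1
      rintro x ⟨m, p, a₀, a₁, h⟩
      refine ⟨m, p, a₀, a₁, { h with dir := fun t ht => h.dir t ⟨ht.1, ht.2.trans ?_⟩ }⟩
      have : (j:ℝ) ≤ k := by exact_mod_cast hjk
      gcongr
    rw [hmono.measure_iUnion]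
    exact iSup_le fun j => hK ε hε hε1 hεs j
  have hlim : Filter.Tendsto (fun ε : ℝ => ENNReal.ofReal (K * ε)) (nhdsWithin 0 (Ioi 0)) (nhds 0) := by
    have : Filter.Tendsto (fun ε : ℝ => ENNReal.ofReal (K * ε)) (nhds 0)
        (nhds (ENNReal.ofReal (K * 0))) :=
      (ENNReal.continuous_ofReal.comp (by fun_prop : Continuous fun ε : ℝ => K * ε)).tendsto 0
    rw [mul_zero, ENNReal.ofReal_zero] at this
    exact this.mono_left nhdsWithin_le_nhds
  refine le_antisymm (ge_of_tendsto hlim ?_) zero_le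
  have h1 : Ioc (0:ℝ) (min 1 (s₁ - s₀)) ∈ nhdsWithin (0:ℝ) (Ioi 0) :=
    Ioc_mem_nhdsGT (lt_min one_pos (by linarith))
  filter_upwards [h1] with ε hε
  exact hle ε hε.1 (hε.2.trans (min_le_left _ _)) (hε.2.trans (min_le_right _ _))

lemma exists_isFlat_of_not_isExp (hΩo : IsOpen Ω) (hu : ConvexOn ℝ Ω u) {D' : Set (En n)} {δ : ℝ}
    (hδ : 0 < δ) (hDΩ : Metric.cthickening δ D' ⊆ Ω) (e : En n) {x : En n} (hx : x ∈ D')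
    (hne : ∀ p ∈ subgrad Ω u x, ¬ IsExp Ω u x p) :
    ∃ (i : Fin n) (s₀ s₁ : ℚ), s₀ < s₁ ∧ ∀ ε > 0, ∃ j : ℕ, ∃ m p a₀ a₁,
      IsFlat Ω u (Metric.cthickening δ D') (δ / 2) e i s₀ s₁ ε (1 / (j + 1)) x m p a₀ a₁ := by
  have hball : ∀ y : En n, ‖y - x‖ ≤ δ → y ∈ Metric.cthickening δ D' := fun y hy =>
    Metric.mem_cthickening_of_dist_le y x δ D' hx (by rwa [dist_eq_norm])
  have hxD : x ∈ Metric.cthickening δ D' := hball x (by simpa using hδ.le)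
  have hxΩ := hDΩ hxD
  obtain ⟨p₀, hp₀⟩ := subgrad_nonempty hΩo hu hxΩ
  obtain ⟨z, hz, hzx, hgz⟩ : ∃ z ∈ Ω, z ≠ x ∧ gap u x p₀ z ≤ 0 := by
    by_contra! hcon
    exact hne p₀ hp₀ ⟨hp₀, hcon⟩
  have hzx0 : 0 < ‖z - x‖ := norm_pos_iff.mpr (sub_ne_zero.mpr hzx)
  obtain ⟨t, ht0, ht1, htn⟩ : ∃ t : ℝ, 0 < t ∧ t ≤ 1 ∧ t * ‖z - x‖ ≤ δ / 2 := by
    refine ⟨min 1 (δ / 2 / ‖z - x‖), lt_min one_pos (by positivity), min_le_left _ _, ?_⟩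
    rw [← le_div_iff₀ hzx0]
    exact min_le_right _ _
  have hpt : ∀ s : ℝ, 0 ≤ s → s ≤ t → x + s • (z - x) ∈ Metric.cthickening δ D' ∧
      gap u x p₀ (x + s • (z - x)) = 0 := by
    intro s hs0 hst
    have hD : x + s • (z - x) ∈ Metric.cthickening δ D' := hball _ (by
      rw [add_sub_cancel_left, norm_smul, Real.norm_eq_abs, abs_of_nonneg hs0]
      nlinarith)
    refine ⟨hD, le_antisymm ?_ (mem_subgrad_iff.mp hp₀ _ (hDΩ hD))⟩
    have h5 := (convexOn_gap hu x p₀).2 hxΩ hz (by linarith : 0 ≤ 1 - s) hs0 (by ring)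
    rw [show (1 - s) • x + s • z = x + s • (z - x) by module, gap_self] at h5
    simp only [smul_eq_mul] at h5
    nlinarith
  set y := x + t • (z - x) with hy
  set m := x + (t / 2) • (z - x) with hm
  have hyD := hpt t ht0.le le_rfl
  have hmD := hpt (t / 2) (by positivity) (by linarith)
  have hmxy : m = (1 / 2 : ℝ) • (x + y) := by rw [hm, hy]; module
  obtain ⟨p, hp, hpd⟩ := exists_subgrad_dir hΩo hu (hDΩ hmD.1) e
  have hpx := mem_subgrad_iff.mp hp x hxΩ
  have hpy := mem_subgrad_iff.mp hp y (hDΩ hyD.1)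
  have hsum : gap u m p x + gap u m p y = 0 := by
    have h1 := hyD.2
    have h2 := hmD.2
    simp only [gap, inner_sub_right] at h1 h2 ⊢
    have h3 : ⟪p₀, m⟫ = 1 / 2 * (⟪p₀, x⟫ + ⟪p₀, y⟫) := by
      rw [hmxy, inner_smul_right, inner_add_right]
    have h4 : ⟪p, m⟫ = 1 / 2 * (⟪p, x⟫ + ⟪p, y⟫) := by
      rw [hmxy, inner_smul_right, inner_add_right]
    linarith
  have hgx : gap u m p x = 0 := by linarith
  have hgy : gap u m p y = 0 := by linarith
  have hmx : ‖m - x‖ ≤ δ / 4 := by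
    rw [hm, add_sub_cancel_left, norm_smul, Real.norm_eq_abs, abs_of_nonneg (by positivity)]
    linarith
  have hballm : ∀ w : En n, ‖w - m‖ ≤ δ / 2 → w ∈ Metric.cthickening δ D' := fun w hw => hball w (by
    calc ‖w - x‖ = ‖(w - m) + (m - x)‖ := by congr 1; abel
      _ ≤ ‖w - m‖ + ‖m - x‖ := norm_add_le _ _
      _ ≤ δ := by linarith)
  have hdir : ∀ ε > 0, ∃ j : ℕ, ∀ s ∈ Icc (0:ℝ) (1 / (j + 1)),
      m + s • e ∈ Metric.cthickening δ D' ∧ gap u m p (m + s • e) ≤ ε * s := by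
    intro ε hε
    obtain ⟨τ, hτ, hτd⟩ := hpd ε hε
    obtain ⟨j, hj⟩ := exists_nat_one_div_lt (lt_min hτ (by positivity : 0 < δ / 2 / (‖e‖ + 1)))
    refine ⟨j, fun s hs => ⟨hballm _ ?_, (hτd s ⟨hs.1, ?_⟩).2⟩⟩
    · rw [add_sub_cancel_left, norm_smul, Real.norm_eq_abs, abs_of_nonneg hs.1]
      have h1 : s ≤ δ / 2 / (‖e‖ + 1) := hs.2.trans (hj.le.trans (min_le_right _ _))
      rw [le_div_iff₀ (by positivity)] at h1
      nlinarith [hs.1]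
    · exact hs.2.trans (hj.le.trans (min_le_left _ _))
  have hyx : y ≠ x := by
    rw [hy]; simpa [ht0.ne', sub_eq_zero] using hzx
  obtain ⟨i, hi⟩ : ∃ i, y i ≠ x i := by
    by_contra! hcon
    exact hyx (by ext i; exact hcon i)
  have hbs : Metric.closedBall m (δ / 2) ⊆ Metric.cthickening δ D' := fun w hw =>
    hballm w (by rwa [mem_closedBall_iff_norm] at hw)
  rcases lt_or_gt_of_ne hi with hlt | hlt
  · obtain ⟨s₀, h0, h0'⟩ := exists_rat_btwn hlt
    obtain ⟨s₁, h1, h1'⟩ := exists_rat_btwn h0'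
    refine ⟨i, s₀, s₁, by exact_mod_cast h1, fun ε hε => ?_⟩
    obtain ⟨j, hj⟩ := hdir ε hε
    exact ⟨j, m, p, y, x, hyD.1, hxD, right_mem_segment ℝ y x, by rw [hmxy, add_comm], h0.le, h1'.le,
      hp, hgy, hgx, hbs, hj⟩
  · obtain ⟨s₀, h0, h0'⟩ := exists_rat_btwn hlt
    obtain ⟨s₁, h1, h1'⟩ := exists_rat_btwn h0'
    refine ⟨i, s₀, s₁, by exact_mod_cast h1, fun ε hε => ?_⟩
    obtain ⟨j, hj⟩ := hdir ε hε
    exact ⟨j, m, p, x, y, hxD, hyD.1, left_mem_segment ℝ x y, hmxy, h0.le, h1'.le,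
      hp, hgx, hgy, hbs, hj⟩

/-- The points which are not exposed by any subgradient sweep out a null set in every direction. -/
lemma volume_sweep_not_isExp_eq_zero (hΩo : IsOpen Ω) (hu : ConvexOn ℝ Ω u) {c C : ℝ}
    (hc : 0 < c) (hM : MABounds Ω u c C) {D : Set (En n)} (hD : Convex ℝ D) (hDc : IsCompact D)
    (hDΩ : D ⊆ Ω) (e : En n) :
    volume (sweep {x | x ∈ D ∧ ∀ p ∈ subgrad Ω u x, ¬ IsExp Ω u x p} e 1) = 0 := by
  obtain ⟨δ, hδ, hsub⟩ := hDc.exists_cthickening_subset_open hΩo hDΩ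
  have hcov : {x | x ∈ D ∧ ∀ p ∈ subgrad Ω u x, ¬ IsExp Ω u x p} ⊆
      ⋃ k : {k : Fin n × ℚ × ℚ // k.2.1 < k.2.2}, {x | ∀ ε > 0, ∃ j : ℕ, ∃ m p a₀ a₁,
        IsFlat Ω u (Metric.cthickening δ D) (δ / 2) e k.1.1 k.1.2.1 k.1.2.2 ε (1 / (j + 1))
          x m p a₀ a₁} := by
    rintro x ⟨hx, hne⟩
    obtain ⟨i, s₀, s₁, hs, h⟩ := exists_isFlat_of_not_isExp hΩo hu hδ hsub e hx hne
    exact mem_iUnion.mpr ⟨⟨(i, s₀, s₁), hs⟩, h⟩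
  refine measure_mono_null (sweep_mono hcov e 1) ?_
  rw [sweep_iUnion, measure_iUnion_null_iff]
  rintro ⟨⟨i, s₀, s₁⟩, hs⟩
  exact volume_sweep_iUnion_isFlat_eq_zero hΩo hu hc hM (hD.cthickening δ) hDc.cthickening hsub
    (by positivity) e i (by exact_mod_cast hs)

end FlatNull

section Aleksandrov

variable {n : ℕ} {Ω : Set (En n)} {u : En n → ℝ}

open Classical in
/-- A selection of the subgradient. -/
def subslope (Ω : Set (En n)) (u : En n → ℝ) (x : En n) : En n :=
  if h : (subgrad Ω u x).Nonempty then h.some else 0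

lemma subslope_mem (hΩo : IsOpen Ω) (hu : ConvexOn ℝ Ω u) {x : En n} (hx : x ∈ Ω) :
    subslope Ω u x ∈ subgrad Ω u x := by
  have h := subgrad_nonempty hΩo hu hx
  rw [subslope, dif_pos h]
  exact h.some_mem

lemma continuousAt_subslope (hΩo : IsOpen Ω) (hu : ConvexOn ℝ Ω u) {x p : En n} (hx : x ∈ Ω)
    (h : ∀ q ∈ subgrad Ω u x, q = p) : ContinuousAt (subslope Ω u) x := by
  rw [ContinuousAt, h _ (subslope_mem hΩo hu hx)]
  refine Filter.tendsto_of_seq_tendsto fun xs hxs => ?_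
  refine Filter.tendsto_of_subseq_tendsto fun ns hns => ?_
  have h1 := hxs.comp hns
  obtain ⟨q, hq, φ, hφ, hlim⟩ := exists_subgrad_subseq (ps := fun k => subslope Ω u (xs (ns k))) hΩo hu hx h1 (by
    filter_upwards [h1 (hΩo.mem_nhds hx)] with k hk
    exact subslope_mem hΩo hu hk)
  rw [h q hq] at hlim
  exact ⟨φ, hlim⟩

lemma volume_image_eq_zero_of_lipschitz {K : NNReal} {g : En n → En n} (hg : LipschitzWith K g)
    {s : Set (En n)} (hs : volume s = 0) : volume (g '' s) = 0 := by
  have h1 : (volume : Measure (En n)).AbsolutelyContinuous (μH[Module.finrank ℝ (En n)]) :=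
    Measure.absolutelyContinuous_isAddHaarMeasure _ _
  have h2 : (μH[Module.finrank ℝ (En n)]).AbsolutelyContinuous (volume : Measure (En n)) :=
    Measure.absolutelyContinuous_isAddHaarMeasure _ _
  refine h1 (le_antisymm ?_ zero_le)
  refine (hg.hausdorffMeasure_image_le (by positivity) s).trans ?_
  rw [h2 hs, mul_zero]

lemma ae_differentiableAt_subslope (hΩo : IsOpen Ω) (hu : ConvexOn ℝ Ω u) :
    ∀ᵐ y : En n, y ∈ Ω → DifferentiableAt ℝ (subslope Ω u) y := by
  set g : En n → En n := fun y => y + subslope Ω u y with hg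
  have hmono : ∀ y ∈ Ω, ∀ y' ∈ Ω, dist y y' ≤ dist (g y) (g y') := by
    intro y hy y' hy'
    have h1 := subslope_mem hΩo hu hy y' hy'
    have h2 := subslope_mem hΩo hu hy' y hy
    have h3 : 0 ≤ ⟪subslope Ω u y - subslope Ω u y', y - y'⟫ := by
      rw [inner_sub_left]
      have : ⟪subslope Ω u y, y' - y⟫ = -⟪subslope Ω u y, y - y'⟫ := by
        rw [← inner_neg_right]; congr 1; abel
      linarith
    have h4 : ‖y - y'‖ * ‖y - y'‖ ≤ ‖g y - g y'‖ * ‖y - y'‖ := by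
      refine le_trans ?_ (real_inner_le_norm (g y - g y') (y - y'))
      have : g y - g y' = (y - y') + (subslope Ω u y - subslope Ω u y') := by simp only [hg]; abel
      rw [this, inner_add_left, real_inner_self_eq_norm_mul_norm]
      linarith
    rw [dist_eq_norm, dist_eq_norm]
    rcases (norm_nonneg (y - y')).eq_or_lt with h | h
    · rw [← h]; positivity
    · exact le_of_mul_le_mul_right h4 h
  have hinj : InjOn g Ω := fun y hy y' hy' h => by
    have := hmono y hy y' hy'
    rw [h, dist_self] at this
    exact dist_le_zero.mp this
  have hJ : LipschitzOnWith 1 (Function.invFunOn g Ω) (g '' Ω) := by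
    refine LipschitzOnWith.of_dist_le_mul ?_
    rintro _ ⟨y, hy, rfl⟩ _ ⟨y', hy', rfl⟩
    rw [hinj.leftInvOn_invFunOn hy, hinj.leftInvOn_invFunOn hy']
    simpa using hmono y hy y' hy'
  obtain ⟨J, hJl, hJe⟩ := hJ.extend_finite_dimension
  have hJg : ∀ y ∈ Ω, J (g y) = y := fun y hy => by
    rw [← hJe (mem_image_of_mem g hy), hinj.leftInvOn_invFunOn hy]
  have h1 : volume (J '' {z | ¬ DifferentiableAt ℝ J z}) = 0 :=
    volume_image_eq_zero_of_lipschitz hJl (ae_iff.mp hJl.ae_differentiableAt)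
  have h2 : volume (J '' {z | DifferentiableAt ℝ J z ∧ (fderiv ℝ J z).det = 0}) = 0 :=
    addHaar_image_eq_zero_of_det_fderivWithin_eq_zero volume
      (fun z hz => hz.1.hasFDerivAt.hasFDerivWithinAt) fun z hz => hz.2
  filter_upwards [ae_differentiableAt hΩo hu, measure_eq_zero_iff_ae_notMem.mp h1,
    measure_eq_zero_iff_ae_notMem.mp h2] with y hd hy1 hy2 hy
  have hd1 : DifferentiableAt ℝ J (g y) := by
    by_contra hcon
    exact hy1 ⟨g y, hcon, hJg y hy⟩
  have hdet : (fderiv ℝ J (g y)).det ≠ 0 := fun hcon => hy2 ⟨g y, ⟨hd1, hcon⟩, hJg y hy⟩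
  have hgc : ContinuousAt g y := continuousAt_id.add
    (continuousAt_subslope hΩo hu hy fun q hq => eq_gradient_of_mem_subgrad hΩo hy (hd hy) hq)
  have hgd : HasFDerivAt g
      (((fderiv ℝ J (g y)).toContinuousLinearEquivOfDetNeZero hdet).symm : En n →L[ℝ] En n) y := by
    refine HasFDerivAt.of_local_left_inverse hgc (f := J) ?_ ?_
    · rw [ContinuousLinearMap.coe_toContinuousLinearEquivOfDetNeZero]
      exact hd1.hasFDerivAt
    · filter_upwards [hΩo.mem_nhds hy] with z hz using hJg z hz
  have h3 : subslope Ω u = fun z => g z - z := by ext1 z; simp [hg]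
  rw [h3]
  exact hgd.differentiableAt.sub differentiableAt_id

lemma le_of_quadratic_increments {m : ℝ → ℝ} {T C : ℝ} (hT : 0 ≤ T)
    (h : ∀ t t', 0 ≤ t → t ≤ t' → t' ≤ T → m t' - m t ≤ C * (t' - t) ^ 2) : m T ≤ m 0 := by
  have hN : ∀ N : ℕ, m T - m 0 ≤ C * T ^ 2 * (1 / ((N:ℝ) + 1)) := by
    intro N
    have hN0 : (0:ℝ) < (N:ℝ) + 1 := by positivity
    have hk : ∀ k : ℕ, k ≤ N + 1 → m (k * (T / (N + 1))) - m 0 ≤ k * (C * (T / (N + 1)) ^ 2) := by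
      intro k
      induction k with
      | zero => intro _; simp
      | succ k ih =>
        intro hk
        have h1 := ih (by omega)
        have h2 := h (k * (T / (N + 1))) ((k + 1 : ℕ) * (T / (N + 1))) (by positivity) (by
          push_cast; have : 0 ≤ T / (N + 1) := by positivity
          nlinarith) (by
          have : ((k + 1 : ℕ) : ℝ) ≤ (N:ℝ) + 1 := by exact_mod_cast hk
          calc ((k + 1 : ℕ) : ℝ) * (T / (N + 1)) ≤ ((N:ℝ) + 1) * (T / (N + 1)) := by gcongr
            _ = T := by field_simp)
        have h3 : ((k + 1 : ℕ) : ℝ) * (T / (N + 1)) - k * (T / (N + 1)) = T / (N + 1) := by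
          push_cast; ring
        rw [h3] at h2
        push_cast at h2 ⊢
        linarith
    have h1 := hk (N + 1) le_rfl
    have h2 : ((N + 1 : ℕ) : ℝ) * (T / (N + 1)) = T := by push_cast; field_simp
    rw [h2] at h1
    refine h1.trans (le_of_eq ?_)
    push_cast; field_simp
  have hlim := (tendsto_one_div_add_atTop_nhds_zero_nat (𝕜 := ℝ)).const_mul (C * T ^ 2)
  rw [mul_zero] at hlim
  have := ge_of_tendsto' hlim hN
  linarith

/-- Second-order Taylor expansion along rays at a point of differentiability of the slope. -/
lemma tendsto_second_difference (hΩo : IsOpen Ω) (hu : ConvexOn ℝ Ω u) {y : En n} (hy : y ∈ Ω)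
    {A : En n →L[ℝ] En n} (hA : HasFDerivAt (subslope Ω u) A y) (a : En n) :
    Filter.Tendsto (fun t : ℝ => (u (y + t • a) - u y - t * ⟪subslope Ω u y, a⟫) / t ^ 2)
      (nhdsWithin 0 (Ioi 0)) (nhds (1 / 2 * ⟪A a, a⟫)) := by
  set P := subslope Ω u with hP
  set κ := ⟪A a, a⟫ with hκ
  have hline : Continuous fun t : ℝ => y + t • a := by fun_prop
  have hline0 : Filter.Tendsto (fun t : ℝ => y + t • a) (nhds 0) (nhds y) := by
    have := hline.tendsto 0
    simpa using this
  rw [Metric.tendsto_nhdsWithin_nhds]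
  intro ε hε
  have hd : HasDerivAt (fun t : ℝ => ⟪P (y + t • a), a⟫) κ 0 := by
    have h1 : HasDerivAt (fun t : ℝ => y + t • a) a 0 := by
      simpa using ((hasDerivAt_id (0:ℝ)).smul_const a).const_add y
    have h2 : HasFDerivAt P A (y + (0:ℝ) • a) := by simpa using hA
    have h3 := h2.comp_hasDerivAt (0:ℝ) h1
    have h4 := h3.inner ℝ (hasDerivAt_const (0:ℝ) a)
    simpa [hκ] using h4
  have hlit := (hasDerivAt_iff_isLittleO.mp hd).def (half_pos hε)
  obtain ⟨δ, hδ, hδs⟩ := Metric.eventually_nhds_iff.mp (hlit.and (hline0 (hΩo.mem_nhds hy)))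
  refine ⟨δ, hδ, fun T hT hTd => ?_⟩
  have hT0 : 0 < T := hT
  rw [Real.dist_eq, sub_zero, abs_of_pos hT0] at hTd
  have hpt : ∀ t, 0 ≤ t → t ≤ T → y + t • a ∈ Ω ∧
      |⟪P (y + t • a), a⟫ - ⟪P y, a⟫ - t * κ| ≤ ε / 2 * T := by
    intro t ht0 htT
    have h1 := @hδs t (by rw [Real.dist_eq, sub_zero, abs_of_nonneg ht0]; linarith)
    refine ⟨h1.2, ?_⟩
    have h2 := h1.1
    simp only [zero_smul, add_zero, sub_zero, smul_eq_mul, Real.norm_eq_abs] at h2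
    rw [abs_of_nonneg ht0] at h2
    exact h2.trans (by gcongr)
  have hup : ∀ t t', 0 ≤ t → t ≤ t' → t' ≤ T →
      u (y + t' • a) - u (y + t • a) ≤ (t' - t) * ⟪P (y + t' • a), a⟫ ∧
      (t' - t) * ⟪P (y + t • a), a⟫ ≤ u (y + t' • a) - u (y + t • a) := by
    intro t t' ht0 htt htT
    have h1 := hpt t ht0 (htt.trans htT)
    have h2 := hpt t' (ht0.trans htt) htT
    have h3 := subslope_mem hΩo hu h2.1 _ h1.1
    have h4 := subslope_mem hΩo hu h1.1 _ h2.1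
    rw [show y + t • a - (y + t' • a) = (t - t') • a by module, inner_smul_right] at h3
    rw [show y + t' • a - (y + t • a) = (t' - t) • a by module, inner_smul_right] at h4
    constructor <;> linarith
  have hu1 : u (y + T • a) - T * ⟪P y, a⟫ - T ^ 2 / 2 * κ - ε / 2 * T * T ≤ u y := by
    have := le_of_quadratic_increments (C := κ / 2) (T := T)
      (m := fun t => u (y + t • a) - t * ⟪P y, a⟫ - t ^ 2 / 2 * κ - ε / 2 * T * t) hT0.le ?_
    · simpa using this
    · intro t t' ht0 htt htT
      have h1 := (hup t t' ht0 htt htT).1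
      have h2 := (abs_le.mp (hpt t' (ht0.trans htt) htT).2).2
      have h3 := mul_le_mul_of_nonneg_left h2 (sub_nonneg.mpr htt)
      nlinarith
  have hu2 : u y ≤ u (y + T • a) - T * ⟪P y, a⟫ - T ^ 2 / 2 * κ + ε / 2 * T * T := by
    have := le_of_quadratic_increments (C := κ / 2) (T := T)
      (m := fun t => -(u (y + t • a) - t * ⟪P y, a⟫ - t ^ 2 / 2 * κ + ε / 2 * T * t)) hT0.le ?_
    · simp only [zero_smul, add_zero] at this
      linarith
    · intro t t' ht0 htt htT
      have h1 := (hup t t' ht0 htt htT).2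
      have h2 := (abs_le.mp (hpt t ht0 (htt.trans htT)).2).1
      have h3 := mul_le_mul_of_nonneg_left h2 (sub_nonneg.mpr htt)
      nlinarith
  have hT2 : 0 < T ^ 2 := by positivity
  have h5 : (u (y + T • a) - u y - T * ⟪P y, a⟫) / T ^ 2 - 1 / 2 * κ =
      (u (y + T • a) - u y - T * ⟪P y, a⟫ - T ^ 2 / 2 * κ) / T ^ 2 := by field_simp
  rw [Real.dist_eq, h5, abs_div, abs_of_pos hT2, div_lt_iff₀ hT2]
  refine lt_of_le_of_lt (b := ε / 2 * T ^ 2) ?_ (by nlinarith)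
  rw [abs_le]
  constructor <;> linarith

end Aleksandrov

section SecondDerivative

variable {n : ℕ} {Ω : Set (En n)} {u : En n → ℝ}

lemma tendsto_ray (y a : En n) :
    Filter.Tendsto (fun t : ℝ => y + t • a) (nhdsWithin 0 (Ioi 0)) (nhds y) := by
  have : Filter.Tendsto (fun t : ℝ => y + t • a) (nhds 0) (nhds (y + (0:ℝ) • a)) :=
    (by fun_prop : Continuous fun t : ℝ => y + t • a).tendsto 0
  rw [zero_smul, add_zero] at this
  exact this.mono_left nhdsWithin_le_nhds

lemma tendsto_ray_slope {P : En n → En n} {y : En n} {A : En n →L[ℝ] En n} (hA : HasFDerivAt P A y)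
    (a b : En n) :
    Filter.Tendsto (fun t : ℝ => (⟪P (y + t • a), b⟫ - ⟪P y, b⟫) / t) (nhdsWithin 0 (Ioi 0))
      (nhds ⟪A a, b⟫) := by
  have h1 : HasDerivAt (fun t : ℝ => y + t • a) a 0 := by
    simpa using ((hasDerivAt_id (0:ℝ)).smul_const a).const_add y
  have h2 : HasFDerivAt P A (y + (0:ℝ) • a) := by simpa using hA
  have h3 := h2.comp_hasDerivAt (0:ℝ) h1
  have h4 := h3.inner ℝ (hasDerivAt_const (0:ℝ) b)
  have h5 := h4.hasDerivWithinAt (s := Ioi 0)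
  rw [hasDerivWithinAt_iff_tendsto_slope' self_notMem_Ioi] at h5
  simp only [inner_zero_right, zero_add] at h5
  refine h5.congr fun t => ?_
  simp [slope_def_field]

lemma inner_deriv_subslope_nonneg (hΩo : IsOpen Ω) (hu : ConvexOn ℝ Ω u) {y : En n} (hy : y ∈ Ω)
    {A : En n →L[ℝ] En n} (hA : HasFDerivAt (subslope Ω u) A y) (a : En n) : 0 ≤ ⟪A a, a⟫ := by
  refine ge_of_tendsto (tendsto_ray_slope hA a a) ?_
  filter_upwards [self_mem_nhdsWithin, tendsto_ray y a (hΩo.mem_nhds hy)] with t ht htΩ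
  have ht0 : 0 < t := ht
  have h1 := subslope_mem hΩo hu hy _ htΩ
  have h2 := subslope_mem hΩo hu htΩ _ hy
  rw [show y - (y + t • a) = (-t) • a by module, inner_smul_right] at h2
  rw [add_sub_cancel_left, inner_smul_right] at h1
  have h3 : 0 ≤ t * (⟪subslope Ω u (y + t • a), a⟫ - ⟪subslope Ω u y, a⟫) := by linarith
  exact div_nonneg (nonneg_of_mul_nonneg_right h3 ht0) ht0.le

lemma inner_deriv_subslope_symm (hΩo : IsOpen Ω) (hu : ConvexOn ℝ Ω u) {y : En n} (hy : y ∈ Ω)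
    {A : En n →L[ℝ] En n} (hA : HasFDerivAt (subslope Ω u) A y) (a b : En n) :
    ⟪A a, b⟫ = ⟪A b, a⟫ := by
  have key : ∀ b : En n, ⟪A a, b⟫ ≤ ⟪A b, a⟫ + ⟪A b, b⟫ := by
    intro b
    have h1 := (tendsto_second_difference hΩo hu hy hA (a + b)).sub
      ((tendsto_second_difference hΩo hu hy hA a).add (tendsto_ray_slope hA a b))
    have h2 := ge_of_tendsto h1 (b := 0) (by
      filter_upwards [self_mem_nhdsWithin, tendsto_ray y a (hΩo.mem_nhds hy),
        tendsto_ray y (a + b) (hΩo.mem_nhds hy)] with t ht h3 h4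
      have ht0 : 0 < t := ht
      have h5 := subslope_mem hΩo hu h3 _ h4
      rw [show y + t • (a + b) - (y + t • a) = t • b by module, inner_smul_right] at h5
      rw [inner_add_right]
      have h6 : (u (y + t • (a + b)) - u y - t * (⟪subslope Ω u y, a⟫ + ⟪subslope Ω u y, b⟫)) / t ^ 2 -
          ((u (y + t • a) - u y - t * ⟪subslope Ω u y, a⟫) / t ^ 2 +
          (⟪subslope Ω u (y + t • a), b⟫ - ⟪subslope Ω u y, b⟫) / t) =
          (u (y + t • (a + b)) - (u (y + t • a) + t * ⟪subslope Ω u (y + t • a), b⟫)) / t ^ 2 := by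
        field_simp; ring
      rw [h6]
      exact div_nonneg (by linarith) (by positivity))
    rw [map_add, inner_add_left, inner_add_right, inner_add_right] at h2
    linarith
  have h1 : ∀ s : ℝ, s * (⟪A a, b⟫ - ⟪A b, a⟫) ≤ s ^ 2 * ⟪A b, b⟫ := by
    intro s
    have := key (s • b)
    simp only [map_smul, inner_smul_left, inner_smul_right, conj_trivial] at this
    linarith
  set κ := ⟪A b, b⟫
  set δ := ⟪A a, b⟫ - ⟪A b, a⟫ with hδ
  have hκ : 0 ≤ κ := inner_deriv_subslope_nonneg hΩo hu hy hA b
  have h2 := h1 (δ / (κ + 1))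
  have h3 : δ ^ 2 * (κ + 1) ≤ δ ^ 2 * κ := by
    have h4 : δ / (κ + 1) * δ = δ ^ 2 * (κ + 1) / (κ + 1) ^ 2 := by field_simp
    have h5 : (δ / (κ + 1)) ^ 2 * κ = δ ^ 2 * κ / (κ + 1) ^ 2 := by rw [div_pow]; ring
    rw [h4, h5] at h2
    exact (div_le_div_iff_of_pos_right (by positivity)).mp h2
  have : δ ^ 2 = 0 := by nlinarith [sq_nonneg δ]
  have : δ = 0 := by simpa using this
  linarith

end SecondDerivative

section Determinants

variable {n : ℕ}

/-- The operator with eigenvalues `g` in the orthonormal basis `e`. -/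
def diagOp (e : OrthonormalBasis (Fin n) ℝ (En n)) (g : Fin n → ℝ) : En n →ₗ[ℝ] En n :=
  e.toBasis.constr ℝ (fun i => g i • e i)

lemma diagOp_apply (e : OrthonormalBasis (Fin n) ℝ (En n)) (g : Fin n → ℝ) (i : Fin n) :
    diagOp e g (e i) = g i • e i := by
  simpa only [OrthonormalBasis.coe_toBasis, diagOp] using
    e.toBasis.constr_basis ℝ (fun i => g i • e i) i

lemma inner_diagOp (e : OrthonormalBasis (Fin n) ℝ (En n)) (g : Fin n → ℝ) (x y : En n) :
    ⟪diagOp e g x, y⟫ = ∑ i, g i * ⟪x, e i⟫ * ⟪e i, y⟫ := by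
  have h : diagOp e g x = ∑ i, (⟪e i, x⟫ * g i) • e i := by
    conv_lhs => rw [← e.sum_repr' x]
    simp only [map_sum, map_smul, diagOp_apply, smul_smul]
  rw [h, sum_inner]
  refine Finset.sum_congr rfl fun i _ => ?_
  rw [real_inner_smul_left, real_inner_comm]
  ring

lemma diagOp_comp (e : OrthonormalBasis (Fin n) ℝ (En n)) (g k : Fin n → ℝ) :
    diagOp e g ∘ₗ diagOp e k = diagOp e (fun i => g i * k i) := by
  refine e.toBasis.ext fun i => ?_
  simp [diagOp_apply, smul_smul, mul_comm]

lemma diagOp_one (e : OrthonormalBasis (Fin n) ℝ (En n)) :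
    diagOp e (fun _ => 1) = LinearMap.id := by
  refine e.toBasis.ext fun i => ?_
  simp [diagOp_apply]

lemma isSymmetric_diagOp (e : OrthonormalBasis (Fin n) ℝ (En n)) (g : Fin n → ℝ) :
    (diagOp e g).IsSymmetric := by
  intro x y
  rw [inner_diagOp, real_inner_comm, inner_diagOp]
  refine Finset.sum_congr rfl fun i _ => ?_
  rw [real_inner_comm x, real_inner_comm y]
  ring

lemma LinearMap.IsSymmetric.exists_eq_diagOp {T : En n →ₗ[ℝ] En n} (hT : T.IsSymmetric) :
    ∃ (e : OrthonormalBasis (Fin n) ℝ (En n)) (μ : Fin n → ℝ),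
      T = diagOp e μ ∧ LinearMap.det T = ∏ i, μ i ∧ ∀ i, ⟪T (e i), e i⟫ = μ i := by
  have hn : Module.finrank ℝ (En n) = n := by simp
  refine ⟨hT.eigenvectorBasis hn, hT.eigenvalues hn, ?_, ?_, fun i => ?_⟩
  · refine (hT.eigenvectorBasis hn).toBasis.ext fun i => ?_
    simp [diagOp_apply, hT.apply_eigenvectorBasis hn]
  · simpa using hT.det_eq_prod_eigenvalues hn
  · rw [hT.apply_eigenvectorBasis hn]
    simp [real_inner_smul_left]

lemma LinearMap.IsSymmetric.det_pos {T : En n →ₗ[ℝ] En n} (hT : T.IsSymmetric)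
    (hpos : ∀ a, a ≠ 0 → 0 < ⟪T a, a⟫) : 0 < LinearMap.det T := by
  obtain ⟨e, μ, -, hdet, hμ⟩ := hT.exists_eq_diagOp
  rw [hdet]
  refine Finset.prod_pos fun i _ => ?_
  rw [← hμ]
  exact hpos _ (e.orthonormal.ne_zero i)

lemma LinearMap.IsSymmetric.det_nonneg {T : En n →ₗ[ℝ] En n} (hT : T.IsSymmetric)
    (hpos : ∀ a, 0 ≤ ⟪T a, a⟫) : 0 ≤ LinearMap.det T := by
  obtain ⟨e, μ, -, hdet, hμ⟩ := hT.exists_eq_diagOp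
  rw [hdet]
  refine Finset.prod_nonneg fun i _ => ?_
  rw [← hμ]
  exact hpos _

lemma LinearMap.IsSymmetric.inner_pos_of_det_ne_zero {T : En n →ₗ[ℝ] En n} (hT : T.IsSymmetric)
    (hnn : ∀ a, 0 ≤ ⟪T a, a⟫) (hdet : LinearMap.det T ≠ 0) {a : En n} (ha : a ≠ 0) :
    0 < ⟪T a, a⟫ := by
  obtain ⟨e, μ, hTe, hd, hμ⟩ := hT.exists_eq_diagOp
  have hμpos : ∀ i, 0 < μ i := fun i =>
    lt_of_le_of_ne (by rw [← hμ]; exact hnn _)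
      (Ne.symm (Finset.prod_ne_zero_iff.1 (hd ▸ hdet) i (Finset.mem_univ i)))
  rw [hTe, inner_diagOp]
  have hterm : ∀ i, μ i * ⟪a, e i⟫ * ⟪e i, a⟫ = μ i * ⟪e i, a⟫ ^ 2 := fun i => by
    rw [real_inner_comm]; ring
  simp only [hterm]
  refine lt_of_le_of_ne (Finset.sum_nonneg fun i _ => mul_nonneg (hμpos i).le (sq_nonneg _)) ?_
  intro h0
  have hz := (Finset.sum_eq_zero_iff_of_nonneg
    (fun i _ => mul_nonneg (hμpos i).le (sq_nonneg _))).1 h0.symm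
  apply ha
  rw [← e.sum_repr' a]
  refine Finset.sum_eq_zero fun i hi => ?_
  have h1 := (mul_eq_zero.1 (hz i hi)).resolve_left (hμpos i).ne'
  rw [pow_eq_zero_iff two_ne_zero] at h1
  rw [h1, zero_smul]

/-- Simultaneous diagonalization of a positive definite and a symmetric form. -/
lemma LinearMap.IsSymmetric.exists_simultaneous {U V : En n →ₗ[ℝ] En n} (hU : U.IsSymmetric)
    (hV : V.IsSymmetric) (hpos : ∀ a, a ≠ 0 → 0 < ⟪U a, a⟫) :
    ∃ (ν : Fin n → ℝ) (c : En n → Fin n → ℝ),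
      LinearMap.det V = (∏ i, ν i) * LinearMap.det U ∧
      (∀ a, ⟪U a, a⟫ = ∑ i, c a i ^ 2) ∧ (∀ a, ⟪V a, a⟫ = ∑ i, ν i * c a i ^ 2) ∧
      ∀ i, ∃ a, c a = Pi.single i 1 := by
  obtain ⟨e, μ, hUe, hdet, hμ⟩ := hU.exists_eq_diagOp
  have hμpos : ∀ i, 0 < μ i := fun i => by
    rw [← hμ]
    exact hpos _ (e.orthonormal.ne_zero i)
  set S := diagOp e (fun i => √(μ i)) with hS
  set R := diagOp e (fun i => (√(μ i))⁻¹) with hR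
  have hsq : ∀ i, √(μ i) ≠ 0 := fun i => (Real.sqrt_pos.2 (hμpos i)).ne'
  have hRS : R ∘ₗ S = LinearMap.id := by
    rw [hS, hR, diagOp_comp, ← diagOp_one e]
    congr 1
    exact funext fun i => inv_mul_cancel₀ (hsq i)
  have hSR : S ∘ₗ R = LinearMap.id := by
    rw [hS, hR, diagOp_comp, ← diagOp_one e]
    congr 1
    exact funext fun i => mul_inv_cancel₀ (hsq i)
  have hSS : S ∘ₗ S = U := by
    rw [hS, diagOp_comp, hUe]
    congr 1
    exact funext fun i => Real.mul_self_sqrt (hμpos i).le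
  have hSsym : S.IsSymmetric := isSymmetric_diagOp _ _
  have hRsym : R.IsSymmetric := isSymmetric_diagOp _ _
  have hRS' : ∀ a, R (S a) = a := fun a => LinearMap.congr_fun hRS a
  have hSR' : ∀ a, S (R a) = a := fun a => LinearMap.congr_fun hSR a
  set W := R ∘ₗ V ∘ₗ R with hW
  have hWsym : W.IsSymmetric := fun x y => by
    simp only [hW, LinearMap.comp_apply]
    rw [hRsym, hV, hRsym]
  obtain ⟨w, ν, hWw, hWdet, -⟩ := hWsym.exists_eq_diagOp
  have hVW : V = S ∘ₗ W ∘ₗ S := by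
    ext1 a
    simp only [hW, LinearMap.comp_apply, hRS', hSR']
  refine ⟨ν, fun a i => ⟪w i, S a⟫, ?_, fun a => ?_, fun a => ?_, fun i => ⟨R (w i), ?_⟩⟩
  · clear_value W
    rw [hVW, LinearMap.det_comp, LinearMap.det_comp, ← hSS, LinearMap.det_comp, ← hWdet]
    ring
  · rw [← hSS, LinearMap.comp_apply, hSsym, real_inner_self_eq_norm_sq,
      ← w.sum_sq_norm_inner_right]
    exact Finset.sum_congr rfl fun i _ => by simp
  · conv_lhs => rw [hVW]
    rw [LinearMap.comp_apply, hSsym, LinearMap.comp_apply, hWw, inner_diagOp]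
    exact Finset.sum_congr rfl fun i _ => by rw [real_inner_comm]; ring
  · funext j
    simp only [hSR', orthonormal_iff_ite.1 w.orthonormal, Pi.single_apply]

lemma LinearMap.IsSymmetric.exists_simultaneous_of_le {U V : En n →ₗ[ℝ] En n}
    (hU : U.IsSymmetric) (hV : V.IsSymmetric) (hpos : ∀ a, a ≠ 0 → 0 < ⟪U a, a⟫)
    (hVnn : ∀ a, 0 ≤ ⟪V a, a⟫) {κ : ℝ} (hVU : ∀ a, ⟪V a, a⟫ ≤ κ * ⟪U a, a⟫) :
    ∃ (ν : Fin n → ℝ) (c : En n → Fin n → ℝ), (∀ i, 0 ≤ ν i ∧ ν i ≤ κ) ∧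
      LinearMap.det V = (∏ i, ν i) * LinearMap.det U ∧
      (∀ a, ⟪U a, a⟫ = ∑ i, c a i ^ 2) ∧ ∀ a, ⟪V a, a⟫ = ∑ i, ν i * c a i ^ 2 := by
  obtain ⟨ν, c, hdet, hUc, hVc, hex⟩ := hU.exists_simultaneous hV hpos
  have hν : ∀ i, 0 ≤ ν i ∧ ν i ≤ κ := fun i => by
    obtain ⟨b, hb⟩ := hex i
    have hsum : ∀ g : Fin n → ℝ, ∑ j, g j * c b j ^ 2 = g i := fun g => by
      rw [Finset.sum_eq_single i]
      · simp [hb]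
      · intro j _ hj
        simp [hb, hj]
      · simp
    have h1 := hVnn b
    have h2 := hVU b
    have h3 := hsum fun _ => 1
    simp only [one_mul] at h3
    rw [hVc, hsum] at h1
    rw [hVc, hsum, hUc, h3] at h2
    exact ⟨h1, by linarith⟩
  exact ⟨ν, c, hν, hdet, hUc, hVc⟩

/-- The determinant is comparable when the forms are. -/
lemma LinearMap.IsSymmetric.det_mul_inner_le {U V : En n →ₗ[ℝ] En n} (hU : U.IsSymmetric)
    (hV : V.IsSymmetric) (hpos : ∀ a, a ≠ 0 → 0 < ⟪U a, a⟫) (hVnn : ∀ a, 0 ≤ ⟪V a, a⟫) {κ : ℝ}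
    (hVU : ∀ a, ⟪V a, a⟫ ≤ κ * ⟪U a, a⟫) (a : En n) :
    LinearMap.det V * ⟪U a, a⟫ ≤ κ ^ (n - 1) * LinearMap.det U * ⟪V a, a⟫ := by
  obtain ⟨ν, c, hν, hdet, hUc, hVc⟩ := hU.exists_simultaneous_of_le hV hpos hVnn hVU
  rw [hdet, hVc, hUc, Finset.mul_sum, Finset.mul_sum]
  refine Finset.sum_le_sum fun i _ => ?_
  have hp : ∏ j, ν j ≤ ν i * κ ^ (n - 1) := by
    rw [← Finset.mul_prod_erase _ _ (Finset.mem_univ i)]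
    refine mul_le_mul_of_nonneg_left ?_ (hν i).1
    refine (Finset.prod_le_prod (fun j _ => (hν j).1) fun j _ => (hν j).2).trans ?_
    simp
  have hd := (hU.det_pos hpos).le
  have := mul_le_mul_of_nonneg_right hp (mul_nonneg hd (sq_nonneg (c a i)))
  linarith

lemma LinearMap.IsSymmetric.det_le {U V : En n →ₗ[ℝ] En n} (hU : U.IsSymmetric)
    (hV : V.IsSymmetric) (hpos : ∀ a, a ≠ 0 → 0 < ⟪U a, a⟫) (hVnn : ∀ a, 0 ≤ ⟪V a, a⟫) {κ : ℝ}
    (hVU : ∀ a, ⟪V a, a⟫ ≤ κ * ⟪U a, a⟫) :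
    LinearMap.det V ≤ κ ^ n * LinearMap.det U := by
  obtain ⟨ν, c, hν, hdet, hUc, hVc⟩ := hU.exists_simultaneous_of_le hV hpos hVnn hVU
  rw [hdet]
  refine mul_le_mul_of_nonneg_right ?_ (hU.det_pos hpos).le
  refine (Finset.prod_le_prod (fun j _ => (hν j).1) fun j _ => (hν j).2).trans ?_
  simp

/-- If `V ≤ (1+s)U` and the determinants differ by `O(s)`, then `(1+s)U - V = O(s) U`. -/
lemma LinearMap.IsSymmetric.inner_sub_le {U V : En n →ₗ[ℝ] En n} (hU : U.IsSymmetric)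
    (hV : V.IsSymmetric) (hpos : ∀ a, a ≠ 0 → 0 < ⟪U a, a⟫) (hVnn : ∀ a, 0 ≤ ⟪V a, a⟫) {s C : ℝ}
    (hs : 0 < s) (hC : 0 ≤ C) (hVU : ∀ a, ⟪V a, a⟫ ≤ (1 + s) * ⟪U a, a⟫)
    (hdet : (1 - C * s) * LinearMap.det U ≤ LinearMap.det V) (a : En n) :
    (1 + s) * ⟪U a, a⟫ - ⟪V a, a⟫ ≤ (C + n + 1) * s * ⟪U a, a⟫ := by
  have hUa : 0 ≤ ⟪U a, a⟫ := by
    rcases eq_or_ne a 0 with rfl | ha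
    · simp
    · exact (hpos a ha).le
  have hVa := hVnn a
  have hdU := hU.det_pos hpos
  have h1 := hU.det_mul_inner_le hV hpos hVnn hVU a
  set m := n - 1 with hm
  have hmn : (m : ℝ) ≤ n := by exact_mod_cast Nat.sub_le n 1
  have hm0 : (0 : ℝ) ≤ m := Nat.cast_nonneg m
  have hk : (1 - C * s) * ⟪U a, a⟫ ≤ (1 + s) ^ m * ⟪V a, a⟫ := by
    have h2 := (mul_le_mul_of_nonneg_right hdet hUa).trans h1
    have h3 : LinearMap.det U * ((1 - C * s) * ⟪U a, a⟫) ≤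
        LinearMap.det U * ((1 + s) ^ m * ⟪V a, a⟫) := by linarith
    exact le_of_mul_le_mul_left h3 hdU
  suffices h : (1 - (m + C) * s) * ⟪U a, a⟫ ≤ ⟪V a, a⟫ by
    have : (m : ℝ) * s * ⟪U a, a⟫ ≤ n * s * ⟪U a, a⟫ := by gcongr
    nlinarith
  rcases le_or_gt 1 (C * s) with hCs | hCs
  · refine le_trans (mul_nonpos_of_nonpos_of_nonneg ?_ hUa) hVa
    nlinarith
  rcases le_or_gt 1 (m * s) with hms | hms
  · refine le_trans (mul_nonpos_of_nonpos_of_nonneg ?_ hUa) hVa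
    nlinarith [mul_nonneg hC hs.le]
  have hb : (1 - m * s) * (1 + s) ^ m ≤ 1 := by
    have hpow : (1 + s) ^ m ≤ (1 - m * s)⁻¹ := by
      have e1 : (1 + s) ^ m ≤ Real.exp (m * s) := by
        rw [Real.exp_nat_mul]
        gcongr
        linarith [Real.add_one_le_exp s]
      refine e1.trans ?_
      rw [le_inv_comm₀ (Real.exp_pos _) (by linarith), ← Real.exp_neg]
      linarith [Real.add_one_le_exp (-(m * s))]
    have := mul_le_mul_of_nonneg_left hpow (by linarith : 0 ≤ 1 - m * s)
    rwa [mul_inv_cancel₀ (by linarith)] at this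
  calc (1 - (m + C) * s) * ⟪U a, a⟫ ≤ (1 - m * s) * ((1 - C * s) * ⟪U a, a⟫) := by
        have : 0 ≤ m * s * (C * s) * ⟪U a, a⟫ := by positivity
        linarith
    _ ≤ (1 - m * s) * ((1 + s) ^ m * ⟪V a, a⟫) := by
        refine mul_le_mul_of_nonneg_left hk (by linarith)
    _ ≤ 1 * ⟪V a, a⟫ := by
        rw [← mul_assoc]
        exact mul_le_mul_of_nonneg_right hb hVa
    _ = _ := one_mul _

end Determinants

section Density

variable {n : ℕ} {Ω : Set (En n)} {u : En n → ℝ}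

lemma legendreT_of_mem_subgrad {x p : En n} (hx : x ∈ Ω) (hp : p ∈ subgrad Ω u x) :
    legendreT Ω u p = ⟪x, p⟫ - u x := by
  refine IsGreatest.csSup_eq ⟨⟨x, hx, rfl⟩, ?_⟩
  rintro _ ⟨y, hy, rfl⟩
  have := hp y hy
  rw [inner_sub_right, real_inner_comm, real_inner_comm x] at this
  simp only
  linarith

/-- The properties shared by almost every point of `Ω`. -/
structure IsGood (Ω : Set (En n)) (u : En n → ℝ) (y : En n) : Prop where
  differentiableAt : DifferentiableAt ℝ u y
  differentiableAt_subslope : DifferentiableAt ℝ (subslope Ω u) y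
  isExp : IsExp Ω u y (subslope Ω u y)
  eq_subslope : ∀ p ∈ subgrad Ω u y, p = subslope Ω u y

lemma ae_isGood (hΩo : IsOpen Ω) (hu : ConvexOn ℝ Ω u) {c C : ℝ} (hc : 0 < c)
    (hM : MABounds Ω u c C) : ∀ᵐ y, y ∈ Ω → IsGood Ω u y := by
  filter_upwards [ae_differentiableAt hΩo hu, ae_differentiableAt_subslope hΩo hu,
    ae_isExp hΩo hu hc hM] with y h1 h2 h3 hy
  have hP := subslope_mem hΩo hu hy
  refine ⟨h1 hy, h2 hy, h3 hy _ hP, fun p hp => ?_⟩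
  rw [eq_gradient_of_mem_subgrad hΩo hy (h1 hy) hp,
    eq_gradient_of_mem_subgrad hΩo hy (h1 hy) hP]

lemma IsGood.gradient_eq {y : En n} (h : IsGood Ω u y) (hΩo : IsOpen Ω) (hy : y ∈ Ω) :
    gradient u y = subslope Ω u y :=
  (eq_gradient_of_mem_subgrad hΩo hy h.differentiableAt h.isExp.1).symm

lemma exists_measurableSet_isGood (hΩo : IsOpen Ω) (hu : ConvexOn ℝ Ω u) {c C : ℝ} (hc : 0 < c)
    (hM : MABounds Ω u c C) :
    ∃ E ⊆ Ω, MeasurableSet E ∧ volume (Ω \ E) = 0 ∧ ∀ y ∈ E, IsGood Ω u y := by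
  set B := {y | ¬ (y ∈ Ω → IsGood Ω u y)} with hB
  have hB0 : volume B = 0 := ae_iff.1 (ae_isGood hΩo hu hc hM)
  refine ⟨Ω \ toMeasurable volume B, sdiff_subset,
    hΩo.measurableSet.diff (measurableSet_toMeasurable _ _), ?_, fun y hy => ?_⟩
  · refine measure_mono_null (t := toMeasurable volume B) ?_ (by rw [measure_toMeasurable, hB0])
    rintro y ⟨hy, hy'⟩
    by_contra h
    exact hy' ⟨hy, h⟩
  · by_contra h
    exact hy.2 (subset_toMeasurable _ _ fun h' => h (h' hy.1))

lemma injOn_subslope {E : Set (En n)} (hEΩ : E ⊆ Ω) (hE : ∀ y ∈ E, IsGood Ω u y) :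
    InjOn (subslope Ω u) E := by
  intro x hx y hy hxy
  by_contra hne
  have h1 := (hE x hx).isExp.2 y (hEΩ hy) (Ne.symm hne)
  have h2 := gap_eq_zero_of_mem_subgrad (hEΩ hx) (hEΩ hy) (hE x hx).isExp.1
    (hxy ▸ (hE y hy).isExp.1)
  exact h1.ne' h2

lemma MAm_eq_volume_image {E : Set (En n)} (hE : ∀ y ∈ E, IsGood Ω u y) :
    MAm Ω u E = volume (subslope Ω u '' E) := by
  unfold MAm
  congr 1
  ext p
  simp only [mem_iUnion, mem_image, exists_prop]
  constructor
  · rintro ⟨x, hx, hp⟩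
    exact ⟨x, hx, ((hE x hx).eq_subslope p hp).symm⟩
  · rintro ⟨x, hx, rfl⟩
    exact ⟨x, hx, (hE x hx).isExp.1⟩

lemma isSymmetric_deriv_subslope (hΩo : IsOpen Ω) (hu : ConvexOn ℝ Ω u) {y : En n} (hy : y ∈ Ω)
    {A : En n →L[ℝ] En n} (hA : HasFDerivAt (subslope Ω u) A y) :
    (A : En n →ₗ[ℝ] En n).IsSymmetric := fun a b =>
  (inner_deriv_subslope_symm hΩo hu hy hA a b).trans (real_inner_comm _ _)

lemma ae_det_eq (hΩo : IsOpen Ω) (hu : ConvexOn ℝ Ω u) {c C : ℝ} (hc : 0 < c)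
    (hM : MABounds Ω u c C) {g : En n → ℝ} (hg : AEMeasurable g (volume.restrict Ω))
    (hg0 : ∀ x ∈ Ω, 0 ≤ g x)
    (hMA : ∀ s ⊆ Ω, MeasurableSet s → MAm Ω u s = ∫⁻ x in s, ENNReal.ofReal (g x)) :
    ∀ᵐ y, y ∈ Ω → (fderiv ℝ (subslope Ω u) y).det = g y := by
  obtain ⟨E, hEΩ, hEm, hE0, hE⟩ := exists_measurableSet_isGood hΩo hu hc hM
  have hmeas : Measurable fun x => ENNReal.ofReal |(fderiv ℝ (subslope Ω u) x).det| := by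
    refine ENNReal.measurable_ofReal.comp ?_
    exact (ContinuousLinearMap.continuous_det.abs).measurable.comp (measurable_fderiv ℝ _)
  have key : (fun x => ENNReal.ofReal |(fderiv ℝ (subslope Ω u) x).det|)
      =ᵐ[volume.restrict E] fun x => ENNReal.ofReal (g x) := by
    refine ae_eq_of_forall_setLIntegral_eq_of_sigmaFinite₀ hmeas.aemeasurable
      (hg.mono_measure (Measure.restrict_mono_set _ hEΩ)).ennreal_ofReal fun s hs _ => ?_
    rw [Measure.restrict_restrict hs]
    have hsE : s ∩ E ⊆ E := inter_subset_right
    rw [← hMA (s ∩ E) (hsE.trans hEΩ) (hs.inter hEm),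
      MAm_eq_volume_image fun y hy => hE y (hsE hy)]
    exact lintegral_abs_det_fderiv_eq_addHaar_image volume (hs.inter hEm)
      (fun x hx => (hE x (hsE hx)).differentiableAt_subslope.hasFDerivAt.hasFDerivWithinAt)
      ((injOn_subslope hEΩ hE).mono hsE)
  have hE0' : ∀ᵐ y, y ∈ Ω → y ∈ E := by
    refine measure_mono_null (fun y hy => ?_) hE0
    simpa using hy
  filter_upwards [(ae_restrict_iff' hEm).1 key, hE0'] with y h1 h2 hy
  have hyE := h2 hy
  have h3 := h1 hyE
  have hA := (hE y hyE).differentiableAt_subslope.hasFDerivAt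
  have hdet : 0 ≤ (fderiv ℝ (subslope Ω u) y).det := by
    refine LinearMap.IsSymmetric.det_nonneg (isSymmetric_deriv_subslope hΩo hu hy hA)
      fun a => inner_deriv_subslope_nonneg hΩo hu hy hA a
  rwa [ENNReal.ofReal_eq_ofReal_iff (abs_nonneg _) (hg0 y hy), abs_of_nonneg hdet] at h3

/-- The density of the Monge–Ampère measure, in terms of the chosen subgradient. -/
def maDensity (Ω : Set (En n)) (f : En n → ℝ) (F G : En n × ℝ → ℝ) (w : En n → ℝ)
    (x : En n) : ℝ :=
  f x * F (x, w x) / G (subslope Ω w x, ⟪x, subslope Ω w x⟫ - w x)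

lemma measurable_gradient (u : En n → ℝ) : Measurable (gradient u) :=
  ((InnerProductSpace.toDual ℝ (En n)).symm.continuous.measurable).comp (measurable_fderiv ℝ u)

lemma IsGenSol.ae_det_eq (hΩo : IsOpen Ω) (hu : ConvexOn ℝ Ω u) {c C : ℝ} (hc : 0 < c)
    (hM : MABounds Ω u c C) {f : En n → ℝ} {F G : En n × ℝ → ℝ} (hf : Measurable f)
    (hF : Continuous F) (hG : Continuous G) (hf0 : ∀ x ∈ Ω, 0 ≤ f x) (hF0 : ∀ z, 0 ≤ F z)
    (hG0 : ∀ z, 0 ≤ G z) (h : IsGenSol Ω f F G u) :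
    ∀ᵐ y, y ∈ Ω → (fderiv ℝ (subslope Ω u) y).det = maDensity Ω f F G u y := by
  have hgood := ae_isGood hΩo hu hc hM
  have hae : ∀ᵐ y, y ∈ Ω → f y * F (y, u y) / G (gradient u y, legendreT Ω u (gradient u y)) =
      maDensity Ω f F G u y := by
    filter_upwards [hgood] with y hy hyΩ
    rw [(hy hyΩ).gradient_eq hΩo hyΩ, legendreT_of_mem_subgrad hyΩ (hy hyΩ).isExp.1, maDensity]
  refine _root_.ae_det_eq hΩo hu hc hM ?_ (fun x hx => ?_) fun s hs hsm => ?_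
  · have hum : AEMeasurable u (volume.restrict Ω) :=
      (hu.continuousOn hΩo).aemeasurable hΩo.measurableSet
    have hgm : AEMeasurable (gradient u) (volume.restrict Ω) := (measurable_gradient u).aemeasurable
    have h1 : AEMeasurable (fun y => f y * F (y, u y) /
        G (gradient u y, ⟪y, gradient u y⟫ - u y)) (volume.restrict Ω) := by
      refine (hf.aemeasurable.mul (hF.measurable.comp_aemeasurable
        (aemeasurable_id.prodMk hum))).div (hG.measurable.comp_aemeasurable (hgm.prodMk ?_))
      exact (aemeasurable_id.inner hgm).sub hum
    refine h1.congr ?_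
    refine (ae_restrict_iff' hΩo.measurableSet).2 ?_
    filter_upwards [hgood] with y hy hyΩ
    rw [(hy hyΩ).gradient_eq hΩo hyΩ, maDensity]
  · exact div_nonneg (mul_nonneg (hf0 x hx) (hF0 _)) (hG0 _)
  · rw [h s hs hsm]
    refine setLIntegral_congr_fun_ae hsm ?_
    filter_upwards [hae] with y hy hys
    rw [hy (hs hys)]

end Density

section LogPerturbation

open Filter

variable {n : ℕ} {Ω : Set (En n)} {u v : En n → ℝ}

/-- The function `u + α⁻¹ log (u - v + τ)`. -/
def logPert (u v : En n → ℝ) (α τ : ℝ) (X : En n) : ℝ :=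
  u X + α⁻¹ * Real.log (u X - v X + τ)

/-- The gradient of `logPert`, in terms of the chosen subgradients. -/
def logSlope (Ω : Set (En n)) (u v : En n → ℝ) (α τ : ℝ) (X : En n) : En n :=
  subslope Ω u X + (α * (u X - v X + τ))⁻¹ • (subslope Ω u X - subslope Ω v X)

lemma IsGood.hasFDerivAt {y : En n} (h : IsGood Ω u y) (hΩo : IsOpen Ω) (hy : y ∈ Ω) :
    HasFDerivAt u (innerSL ℝ (subslope Ω u y)) y := by
  have := h.differentiableAt.hasGradientAt.hasFDerivAt
  rw [h.gradient_eq hΩo hy] at this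
  exact this

lemma IsGood.eq_logSlope_of_isLocalMin (hΩo : IsOpen Ω) {x q : En n} (hx : x ∈ Ω)
    (hgu : IsGood Ω u x) (hgv : IsGood Ω v x) {α τ : ℝ}
    (hθ : 0 < u x - v x + τ)
    (hmin : ∀ᶠ X in nhds x, logPert u v α τ x - ⟪q, x⟫ ≤ logPert u v α τ X - ⟪q, X⟫) :
    q = logSlope Ω u v α τ x := by
  have hdu := hgu.hasFDerivAt hΩo hx
  have hdv := hgv.hasFDerivAt hΩo hx
  have h1 := (hdu.add ((((hdu.sub hdv).add_const τ).log hθ.ne').const_mul α⁻¹)).sub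
    (innerSL ℝ q).hasFDerivAt
  have h0 := IsLocalMin.hasFDerivAt_eq_zero (f := fun X => logPert u v α τ X - ⟪q, X⟫) hmin h1
  refine ext_inner_right ℝ fun a => ?_
  have h2 := DFunLike.congr_fun h0 a
  simp only [sub_apply, add_apply,
    smul_apply, innerSL_apply_apply, smul_eq_mul,
    zero_apply, Pi.sub_apply] at h2
  rw [logSlope, inner_add_left, real_inner_smul_left, inner_sub_left, mul_inv]
  linarith

/-- Second-order condition at a minimum of `logPert - q`. -/
lemma mul_sq_le_of_isLocalMin (hΩo : IsOpen Ω) (hu : ConvexOn ℝ Ω u) (hv : ConvexOn ℝ Ω v)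
    {x q d : En n} (hx : x ∈ Ω) {U V : En n →L[ℝ] En n}
    (hU : HasFDerivAt (subslope Ω u) U x) (hV : HasFDerivAt (subslope Ω v) V x) {α τ s : ℝ}
    (hα : 0 < α) (huv : ∀ X ∈ Ω, v X ≤ u X) (hτ : 0 < τ) (hs : s = α * (u x - v x + τ))
    (hd : q = subslope Ω u x + d) (hsd : s • d = subslope Ω u x - subslope Ω v x)
    (hmin : ∀ᶠ X in nhds x, logPert u v α τ x - ⟪q, x⟫ ≤ logPert u v α τ X - ⟪q, X⟫)
    (a : En n) :
    s * α * ⟪d, a⟫ ^ 2 ≤ (1 + s) * ⟪U a, a⟫ - ⟪V a, a⟫ := by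
  wlog ha : 0 ≤ ⟪d, a⟫ generalizing a
  · have := this (-a) (by rw [inner_neg_right]; linarith)
    simpa using this
  set θ := u x - v x + τ with hθ
  have hθ0 : 0 < θ := by linarith [huv x hx]
  set Δu := fun t : ℝ => u (x + t • a) - u x - t * ⟪subslope Ω u x, a⟫ with hΔu
  set Δv := fun t : ℝ => v (x + t • a) - v x - t * ⟪subslope Ω v x, a⟫ with hΔv
  set L := fun t : ℝ => α * (t * ⟪d, a⟫ - Δu t) with hL
  have hlu : Tendsto (fun t => Δu t / t ^ 2) (nhdsWithin 0 (Ioi 0)) (nhds (1 / 2 * ⟪U a, a⟫)) :=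
    tendsto_second_difference hΩo hu hx hU a
  have hlv : Tendsto (fun t => Δv t / t ^ 2) (nhdsWithin 0 (Ioi 0)) (nhds (1 / 2 * ⟪V a, a⟫)) :=
    tendsto_second_difference hΩo hv hx hV a
  have ht0 : Tendsto (fun t : ℝ => t) (nhdsWithin 0 (Ioi 0)) (nhds 0) := nhdsWithin_le_nhds
  have hpos : ∀ᶠ t : ℝ in nhdsWithin 0 (Ioi 0), 0 < t := self_mem_nhdsWithin
  have hlL : Tendsto (fun t => L t / t) (nhdsWithin 0 (Ioi 0)) (nhds (α * ⟪d, a⟫)) := by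
    have h1 : Tendsto (fun t => α * (⟪d, a⟫ - t * (Δu t / t ^ 2))) (nhdsWithin 0 (Ioi 0))
        (nhds (α * (⟪d, a⟫ - 0 * (1 / 2 * ⟪U a, a⟫)))) :=
      (tendsto_const_nhds.sub (ht0.mul hlu)).const_mul α
    rw [zero_mul, sub_zero] at h1
    refine h1.congr' ?_
    filter_upwards [hpos] with t ht
    simp only [hL]
    field_simp
  have hexp : ∀ᶠ t : ℝ in nhdsWithin 0 (Ioi 0),
      θ * Real.exp (L t) ≤ u (x + t • a) - v (x + t • a) + τ := by
    filter_upwards [hpos, (tendsto_ray x a).eventually hmin,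
      (tendsto_ray x a).eventually (hΩo.mem_nhds hx)] with t ht hm hmem
    have hpos' : 0 < u (x + t • a) - v (x + t • a) + τ := by linarith [huv _ hmem]
    have hlog : L t ≤ Real.log ((u (x + t • a) - v (x + t • a) + τ) / θ) := by
      rw [Real.log_div hpos'.ne' hθ0.ne']
      simp only [logPert, hd, inner_add_left, inner_add_right, real_inner_smul_right] at hm
      have h2 : t * ⟪d, a⟫ - Δu t ≤ α⁻¹ * (Real.log (u (x + t • a) - v (x + t • a) + τ) -
          Real.log θ) := by
        simp only [hΔu]
        linarith
      have := mul_le_mul_of_nonneg_left h2 hα.le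
      rwa [← mul_assoc, mul_inv_cancel₀ hα.ne', one_mul] at this
    rw [Real.le_log_iff_exp_le (div_pos hpos' hθ0), le_div_iff₀ hθ0] at hlog
    linarith
  have hquad : ∀ᶠ t : ℝ in nhdsWithin 0 (Ioi 0),
      (⟪d, a⟫ ≠ 0 → θ * (1 + L t + L t ^ 2 / 2) ≤ u (x + t • a) - v (x + t • a) + τ) ∧
      θ * (1 + L t) ≤ u (x + t • a) - v (x + t • a) + τ := by
    have hLpos : ⟪d, a⟫ ≠ 0 → ∀ᶠ t : ℝ in nhdsWithin 0 (Ioi 0), 0 ≤ L t := fun hne => by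
      have h0 : 0 < α * ⟪d, a⟫ := mul_pos hα (lt_of_le_of_ne ha (Ne.symm hne))
      filter_upwards [hlL.eventually_const_lt h0, hpos] with t h1 h2
      exact ((div_pos_iff_of_pos_right h2).1 h1).le
    have hLpos' : ∀ᶠ t : ℝ in nhdsWithin 0 (Ioi 0), ⟪d, a⟫ ≠ 0 → 0 ≤ L t := by
      by_cases h : ⟪d, a⟫ = 0
      · exact Eventually.of_forall fun t hne => absurd h hne
      · filter_upwards [hLpos h] with t ht _ using ht
    filter_upwards [hexp, hLpos'] with t h1 h2
    refine ⟨fun hne => le_trans ?_ h1, le_trans ?_ h1⟩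
    · exact mul_le_mul_of_nonneg_left (Real.quadratic_le_exp_of_nonneg (h2 hne)) hθ0.le
    · exact mul_le_mul_of_nonneg_left (by linarith [Real.add_one_le_exp (L t)]) hθ0.le
  have hid : ∀ t, u (x + t • a) - v (x + t • a) + τ - θ * (1 + L t) =
      (1 + s) * Δu t - Δv t := fun t => by
    have h1 : s * ⟪d, a⟫ = ⟪subslope Ω u x, a⟫ - ⟪subslope Ω v x, a⟫ := by
      rw [← real_inner_smul_left, hsd, inner_sub_left]
    have h2 : θ * L t = t * (s * ⟪d, a⟫) - s * Δu t := by
      simp only [hL, hs]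
      ring
    rw [mul_add, h2, h1]
    simp only [hΔu, hΔv, hθ]
    ring
  have hlim : Tendsto (fun t => (1 + s) * (Δu t / t ^ 2) - Δv t / t ^ 2)
      (nhdsWithin 0 (Ioi 0)) (nhds ((1 + s) * (1 / 2 * ⟪U a, a⟫) - 1 / 2 * ⟪V a, a⟫)) :=
    (hlu.const_mul _).sub hlv
  have hlim' : Tendsto (fun t => θ / 2 * (L t / t) ^ 2) (nhdsWithin 0 (Ioi 0))
      (nhds (θ / 2 * (α * ⟪d, a⟫) ^ 2)) := (hlL.pow 2).const_mul _
  by_cases hz : ⟪d, a⟫ = 0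
  · have : 0 ≤ (1 + s) * (1 / 2 * ⟪U a, a⟫) - 1 / 2 * ⟪V a, a⟫ := by
      refine ge_of_tendsto hlim ?_
      filter_upwards [hquad, hpos] with t h1 ht
      have h2 : 0 ≤ ((1 + s) * Δu t - Δv t) / t ^ 2 :=
        div_nonneg (by rw [← hid]; linarith [h1.2]) (sq_nonneg t)
      rwa [sub_div, mul_div_assoc] at h2
    rw [hz]
    linarith
  · have : θ / 2 * (α * ⟪d, a⟫) ^ 2 ≤ (1 + s) * (1 / 2 * ⟪U a, a⟫) - 1 / 2 * ⟪V a, a⟫ := by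
      refine le_of_tendsto_of_tendsto hlim' hlim ?_
      filter_upwards [hquad, hpos] with t h1 ht
      have h2 : θ / 2 * L t ^ 2 ≤ (1 + s) * Δu t - Δv t := by
        rw [← hid]
        linarith [h1.1 hz]
      have h3 := div_le_div_of_nonneg_right h2 (sq_nonneg t)
      rw [sub_div, mul_div_assoc] at h3
      rwa [div_pow, ← mul_div_assoc, ← mul_div_assoc] at *
    have e : s * α * ⟪d, a⟫ ^ 2 = 2 * (θ / 2 * (α * ⟪d, a⟫) ^ 2) := by rw [hs]; ring
    rw [e]
    linarith

lemma hasFDerivAt_logSlope (hΩo : IsOpen Ω) {x : En n} (hx : x ∈ Ω) (hgu : IsGood Ω u x)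
    (hgv : IsGood Ω v x) {U V : En n →L[ℝ] En n}
    (hU : HasFDerivAt (subslope Ω u) U x) (hV : HasFDerivAt (subslope Ω v) V x) {α τ : ℝ}
    (hα : 0 < α) (hθ : 0 < u x - v x + τ) {d : En n}
    (hsd : (α * (u x - v x + τ)) • d = subslope Ω u x - subslope Ω v x) :
    ∃ Q : En n →L[ℝ] En n, HasFDerivAt (logSlope Ω u v α τ) Q x ∧
      ∀ a, Q a = U a + (α * (u x - v x + τ))⁻¹ • (U a - V a) - (α * ⟪d, a⟫) • d := by
  have hs : α * (u x - v x + τ) ≠ 0 := (mul_pos hα hθ).ne'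
  have hc : HasFDerivAt (fun X => (α * (u X - v X + τ))⁻¹) _ x :=
    (hasFDerivAt_inv hs).comp x
      ((((hgu.hasFDerivAt hΩo hx).sub (hgv.hasFDerivAt hΩo hx)).add_const τ).const_mul α)
  refine ⟨_, hU.add (hc.smul (hU.sub hV)), fun a => ?_⟩
  have h1 : α * (u x - v x + τ) * ⟪d, a⟫ = ⟪subslope Ω u x, a⟫ - ⟪subslope Ω v x, a⟫ := by
    rw [← real_inner_smul_left, hsd, inner_sub_left]
  simp only [sub_apply, add_apply,
    smul_apply, innerSL_apply_apply, smul_eq_mul,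
    ContinuousLinearMap.smulRight_apply, ContinuousLinearMap.comp_apply,
    ContinuousLinearMap.toSpanSingleton_apply, ← h1, ← hsd, smul_smul]
  rw [add_sub_assoc, sub_eq_add_neg _ ((α * ⟪d, a⟫) • d), ← neg_smul]
  congr 3
  field_simp

end LogPerturbation

section PerturbationBounds

variable {n : ℕ} {Ω : Set (En n)} {u v : En n → ℝ}

lemma smul_sub_subslope {x q : En n} {α τ : ℝ} (hα : 0 < α) (hθ : 0 < u x - v x + τ)
    (hq : q = logSlope Ω u v α τ x) :
    (α * (u x - v x + τ)) • (q - subslope Ω u x) = subslope Ω u x - subslope Ω v x := by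
  rw [hq, logSlope, add_sub_cancel_left, smul_smul, mul_inv_cancel₀ (mul_pos hα hθ).ne', one_smul]

lemma logSlope_bounds (hΩo : IsOpen Ω) (hu : ConvexOn ℝ Ω u) (hv : ConvexOn ℝ Ω v)
    (huv : ∀ X ∈ Ω, v X ≤ u X) {x q : En n} (hx : x ∈ Ω) (hgu : IsGood Ω u x)
    (hgv : IsGood Ω v x) {α τ C : ℝ} (hα : 0 < α) (hτ : 0 < τ) (hC : 0 ≤ C)
    (hmin : ∀ᶠ X in nhds x, logPert u v α τ x - ⟪q, x⟫ ≤ logPert u v α τ X - ⟪q, X⟫)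
    (hq : q = logSlope Ω u v α τ x)
    (hpos : 0 < (fderiv ℝ (subslope Ω u) x).det)
    (hdet : (1 - C * (α * (u x - v x + τ))) * (fderiv ℝ (subslope Ω u) x).det ≤
      (fderiv ℝ (subslope Ω v) x).det) :
    DifferentiableAt ℝ (logSlope Ω u v α τ) x ∧
    |(fderiv ℝ (logSlope Ω u v α τ) x).det| ≤
      (C + n + 1) ^ n * (fderiv ℝ (subslope Ω u) x).det ∧
    α * ‖q - subslope Ω u x‖ ^ 2 ≤ (C + n + 1) * ‖fderiv ℝ (subslope Ω u) x‖ := by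
  have hθ : 0 < u x - v x + τ := by linarith [huv x hx]
  have hsd := smul_sub_subslope hα hθ hq
  set d := q - subslope Ω u x with hd
  set s := α * (u x - v x + τ) with hs
  have hs0 : 0 < s := mul_pos hα hθ
  have hU := hgu.differentiableAt_subslope.hasFDerivAt
  have hV := hgv.differentiableAt_subslope.hasFDerivAt
  obtain ⟨Q, hQ, hQa⟩ := hasFDerivAt_logSlope hΩo hx hgu hgv hU hV hα hθ hsd
  have h2 := mul_sq_le_of_isLocalMin hΩo hu hv hx hU hV hα huv hτ hs
    (by rw [hd, add_sub_cancel]) hsd hmin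
  set U := fderiv ℝ (subslope Ω u) x
  set V := fderiv ℝ (subslope Ω v) x
  have hUs := isSymmetric_deriv_subslope hΩo hu hx hU
  have hVs := isSymmetric_deriv_subslope hΩo hv hx hV
  have hVnn : ∀ a, 0 ≤ ⟪V a, a⟫ := inner_deriv_subslope_nonneg hΩo hv hx hV
  have hUpos : ∀ a, a ≠ 0 → 0 < ⟪U a, a⟫ := fun a ha =>
    hUs.inner_pos_of_det_ne_zero (inner_deriv_subslope_nonneg hΩo hu hx hU) hpos.ne' ha
  have hVU : ∀ a, ⟪V a, a⟫ ≤ (1 + s) * ⟪U a, a⟫ := fun a => by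
    have : 0 ≤ s * α * ⟪d, a⟫ ^ 2 := by positivity
    linarith [h2 a]
  have h3 : ∀ a, (1 + s) * ⟪U a, a⟫ - ⟪V a, a⟫ ≤ (C + n + 1) * s * ⟪U a, a⟫ :=
    hUs.inner_sub_le hVs hUpos hVnn hs0 hC hVU hdet
  have hQin : ∀ a, s * ⟪Q a, a⟫ = (1 + s) * ⟪U a, a⟫ - ⟪V a, a⟫ - s * α * ⟪d, a⟫ ^ 2 :=
    fun a => by
    rw [hQa, inner_sub_left, inner_add_left, real_inner_smul_left, real_inner_smul_left,
      inner_sub_left, ← hs]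
    field_simp
    ring
  have hQs : (Q : En n →ₗ[ℝ] En n).IsSymmetric := fun a b => by
    have e1 : ⟪U a, b⟫ = ⟪a, U b⟫ := hUs a b
    have e2 : ⟪V a, b⟫ = ⟪a, V b⟫ := hVs a b
    simp only [ContinuousLinearMap.coe_coe, hQa, inner_sub_left, inner_add_left,
      real_inner_smul_left, inner_sub_right, inner_add_right, real_inner_smul_right, e1, e2,
      real_inner_comm a d]
    ring
  have hQnn : ∀ a, 0 ≤ ⟪Q a, a⟫ := fun a => by
    refine nonneg_of_mul_nonneg_right ?_ hs0
    rw [hQin]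
    linarith [h2 a]
  have hQU : ∀ a, ⟪Q a, a⟫ ≤ (C + n + 1) * ⟪U a, a⟫ := fun a => by
    refine le_of_mul_le_mul_left ?_ hs0
    rw [hQin]
    have : 0 ≤ s * α * ⟪d, a⟫ ^ 2 := by positivity
    linarith [h3 a]
  refine ⟨hQ.differentiableAt, ?_, ?_⟩
  · rw [hQ.fderiv, abs_of_nonneg (hQs.det_nonneg hQnn)]
    exact hUs.det_le hQs hUpos hQnn hQU
  · have h4 := (h2 d).trans (h3 d)
    have h5 : α * ⟪d, d⟫ ^ 2 ≤ (C + n + 1) * ⟪U d, d⟫ :=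
      le_of_mul_le_mul_left (by linarith) hs0
    have h6 : ⟪U d, d⟫ ≤ ‖U‖ * ‖d‖ ^ 2 := by
      refine (real_inner_le_norm _ _).trans ?_
      rw [pow_two, ← mul_assoc]
      exact mul_le_mul_of_nonneg_right (U.le_opNorm d) (norm_nonneg d)
    rw [real_inner_self_eq_norm_sq] at h5
    rcases eq_or_ne ‖d‖ 0 with h0 | h0
    · rw [h0]
      have : 0 ≤ (C + n + 1) * ‖U‖ := by positivity
      simpa using this
    · have hd2 : 0 < ‖d‖ ^ 2 := by positivity
      refine le_of_mul_le_mul_right ?_ hd2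
      have h7 := mul_le_mul_of_nonneg_left h6 (by positivity : 0 ≤ C + n + 1)
      linarith

lemma maDensity_bounds {f : En n → ℝ} {F G : En n × ℝ → ℝ} {lam Lam : ℝ} (hlam : 0 < lam)
    (hfb : ∀ x ∈ Ω, lam ≤ f x ∧ f x ≤ Lam) (hFb : ∀ z, lam ≤ F z ∧ F z ≤ Lam)
    (hGb : ∀ z, lam ≤ G z ∧ G z ≤ Lam) {x : En n} (hx : x ∈ Ω) :
    0 < maDensity Ω f F G u x ∧ maDensity Ω f F G u x ≤ Lam * Lam / lam := by
  have h1 := hfb x hx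
  have h2 := hFb (x, u x)
  have h3 := hGb (subslope Ω u x, ⟪x, subslope Ω u x⟫ - u x)
  have hL : 0 < Lam := by linarith
  unfold maDensity
  constructor
  · have : 0 < f x := by linarith
    have : 0 < F (x, u x) := by linarith
    exact div_pos (by positivity) (by linarith)
  · refine div_le_div₀ (by positivity) ?_ hlam h3.1
    exact mul_le_mul h1.2 h2.2 (by linarith) hL.le

/-- The densities of `u` and `v` are close where `u - v` and the slopes are close. -/
lemma exists_maDensity_sub_le (hΩo : IsOpen Ω) (hu : ConvexOn ℝ Ω u) (hv : ConvexOn ℝ Ω v)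
    {f : En n → ℝ} {F G : En n × ℝ → ℝ} {lam Lam : ℝ} (hlam : 0 < lam)
    (hfb : ∀ x ∈ Ω, lam ≤ f x ∧ f x ≤ Lam) (hFb : ∀ z, lam ≤ F z ∧ F z ≤ Lam)
    (hGb : ∀ z, lam ≤ G z ∧ G z ≤ Lam) (hF : LocallyLipschitz F) (hG : LocallyLipschitz G)
    {K : Set (En n)} (hK : IsCompact K) (hKΩ : K ⊆ Ω) {B : ℝ} (hB : 0 ≤ B) :
    ∃ C : ℝ, 0 ≤ C ∧ ∀ x ∈ K, ∀ s : ℝ, 0 ≤ s → |u x - v x| ≤ s →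
      ‖subslope Ω u x - subslope Ω v x‖ ≤ B * s →
      (1 - C * s) * maDensity Ω f F G u x ≤ maDensity Ω f F G v x := by
  obtain ⟨Ru, hRu, hPu⟩ := exists_subgrad_bound hΩo hu hK hKΩ
  obtain ⟨Rv, hRv, hPv⟩ := exists_subgrad_bound hΩo hv hK hKΩ
  obtain ⟨R, hR⟩ := hK.isBounded.exists_norm_le
  obtain ⟨Mu, hMu⟩ := hK.exists_bound_of_continuousOn ((hu.continuousOn hΩo).mono hKΩ)
  obtain ⟨Mv, hMv⟩ := hK.exists_bound_of_continuousOn ((hv.continuousOn hΩo).mono hKΩ)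
  set R' := max R 0 with hR'
  have hR0 : 0 ≤ R' := le_max_right _ _
  have hRx : ∀ x ∈ K, ‖x‖ ≤ R' := fun x hx => (hR x hx).trans (le_max_left _ _)
  set M := max Mu Mv with hM
  set P := max Ru Rv with hP
  obtain ⟨k, hk⟩ := hF.locallyLipschitzOn.exists_lipschitzOnWith_of_compact
    (isCompact_closedBall (0 : En n × ℝ) (max R' M))
  obtain ⟨l, hl⟩ := hG.locallyLipschitzOn.exists_lipschitzOnWith_of_compact
    (isCompact_closedBall (0 : En n × ℝ) (max P (R' * P + M)))
  set D := R' * B + B + 1 with hD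
  have hL : 0 < Lam := by linarith [hFb 0]
  have hmem : ∀ (a : En n) (t A T : ℝ), ‖a‖ ≤ A → |t| ≤ T →
      (a, t) ∈ Metric.closedBall (0 : En n × ℝ) (max A T) := fun a t A T ha ht => by
    rw [mem_closedBall_zero_iff, Prod.norm_def]
    exact max_le_max ha ht
  refine ⟨(Lam / lam) * (k / lam + Lam * (l * D) / lam ^ 2), by positivity,
    fun x hx s hs hus hPs => ?_⟩
  set pu := subslope Ω u x
  set pv := subslope Ω v x
  have hnx := hRx x hx
  have hpu : ‖pu‖ ≤ P := (hPu x hx _ (subslope_mem hΩo hu (hKΩ hx))).trans (le_max_left _ _)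
  have hpv : ‖pv‖ ≤ P := (hPv x hx _ (subslope_mem hΩo hv (hKΩ hx))).trans (le_max_right _ _)
  have hux : |u x| ≤ M := (hMu x hx).trans (le_max_left _ _)
  have hvx : |v x| ≤ M := (hMv x hx).trans (le_max_right _ _)
  have hleg : ∀ (p : En n) (t : ℝ), ‖p‖ ≤ P → |t| ≤ M → |⟪x, p⟫ - t| ≤ R' * P + M :=
    fun p t hp ht => by
      refine (abs_sub _ _).trans (add_le_add ?_ ht)
      exact (abs_real_inner_le_norm _ _).trans (mul_le_mul hnx hp (norm_nonneg _) hR0)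
  have hFs : F (x, u x) - F (x, v x) ≤ k * s := by
    have := hk.dist_le_mul _ (hmem x (u x) R' M hnx hux) _ (hmem x (v x) R' M hnx hvx)
    rw [Prod.dist_eq, dist_self, max_eq_right dist_nonneg, Real.dist_eq, Real.dist_eq] at this
    refine (le_abs_self _).trans (this.trans ?_)
    gcongr
  have hGs : G (pv, ⟪x, pv⟫ - v x) - G (pu, ⟪x, pu⟫ - u x) ≤ l * D * s := by
    have := hl.dist_le_mul _ (hmem pv _ P _ hpv (hleg pv (v x) hpv hvx))
      _ (hmem pu _ P _ hpu (hleg pu (u x) hpu hux))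
    rw [Real.dist_eq] at this
    refine (le_abs_self _).trans (this.trans ?_)
    rw [mul_assoc]
    refine mul_le_mul_of_nonneg_left ?_ l.2
    rw [dist_comm, Prod.dist_eq, dist_eq_norm, Real.dist_eq]
    have hRB : 0 ≤ R' * B * s := by positivity
    have hBs : 0 ≤ B * s := by positivity
    refine max_le (hPs.trans ?_) ?_
    · simp only [hD]
      linarith
    · have e : ⟪x, pu⟫ - u x - (⟪x, pv⟫ - v x) = ⟪x, pu - pv⟫ - (u x - v x) := by
        rw [inner_sub_right]; ring
      rw [e]
      refine (abs_sub _ _).trans ?_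
      have h1 : |⟪x, pu - pv⟫| ≤ R' * (B * s) :=
        (abs_real_inner_le_norm _ _).trans (mul_le_mul hnx hPs (norm_nonneg _) hR0)
      simp only [hD]
      linarith
  have hf := hfb x (hKΩ hx)
  unfold maDensity
  set Fu := F (x, u x)
  set Fv := F (x, v x)
  have hFu := hFb (x, u x)
  have hFv := hFb (x, v x)
  have hGu := hGb (pu, ⟪x, pu⟫ - u x)
  have hGv := hGb (pv, ⟪x, pv⟫ - v x)
  change _ * (f x * Fu / G (pu, ⟪x, pu⟫ - u x)) ≤ f x * Fv / G (pv, ⟪x, pv⟫ - v x)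
  generalize G (pu, ⟪x, pu⟫ - u x) = Gu at *
  generalize G (pv, ⟪x, pv⟫ - v x) = Gv at *
  have hGu0 : 0 < Gu := by linarith
  have hGv0 : 0 < Gv := by linarith
  have hfx : 0 < f x := by linarith
  have hk1 : (Fu - Fv) / Gu ≤ k * s / lam := by
    refine (div_le_div_of_nonneg_right hFs hGu0.le).trans ?_
    exact div_le_div_of_nonneg_left (by positivity) hlam hGu.1
  have hk2 : Fv * (Gv - Gu) / (Gu * Gv) ≤ Lam * (l * D * s) / lam ^ 2 := by
    refine (div_le_div_of_nonneg_right (c := Gu * Gv) (b := Lam * (l * D * s)) ?_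
      (by positivity)).trans ?_
    · refine (mul_le_mul_of_nonneg_left hGs (by linarith)).trans ?_
      exact mul_le_mul_of_nonneg_right hFv.2 (by positivity)
    · refine div_le_div_of_nonneg_left (by positivity) (by positivity) ?_
      rw [pow_two]
      exact mul_le_mul hGu.1 hGv.1 hlam.le hGu0.le
  have e1 : f x * Fu / Gu - f x * Fv / Gv =
      f x * ((Fu - Fv) / Gu + Fv * (Gv - Gu) / (Gu * Gv)) := by
    field_simp
    ring
  have hsum : f x * Fu / Gu - f x * Fv / Gv ≤
      f x * (s * (k / lam + Lam * (l * D) / lam ^ 2)) := by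
    rw [e1]
    refine mul_le_mul_of_nonneg_left ?_ hfx.le
    have e2 : s * (k / lam + Lam * (l * D) / lam ^ 2) =
      k * s / lam + Lam * (l * D * s) / lam ^ 2 := by ring
    rw [e2]
    exact add_le_add hk1 hk2
  have hlow : f x ≤ (Lam / lam) * (f x * Fu / Gu) := by
    have : lam / Lam ≤ Fu / Gu := div_le_div₀ (by linarith) hFu.1 hGu0 hGu.2
    have h1 := mul_le_mul_of_nonneg_left this (by positivity : 0 ≤ Lam / lam * f x)
    have e3 : Lam / lam * f x * (lam / Lam) = f x := by field_simp
    rw [e3] at h1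
    refine h1.trans (le_of_eq ?_)
    ring
  have h0 : 0 ≤ s * (k / lam + Lam * (l * D) / lam ^ 2) := by positivity
  have := mul_le_mul_of_nonneg_right hlow h0
  linarith

end PerturbationBounds

section SlopeCovering

open Filter

variable {n : ℕ} {Ω : Set (En n)} {u v : En n → ℝ}

lemma inner_le_max_of_mem_excessSlopes (hu : ConvexOn ℝ Ω u) {S : Set (En n)} (hS : Convex ℝ S)
    (hSΩ : S ⊆ Ω) {x p m X : En n} {H : ℝ} (hH : 0 < H) (hx : x ∈ S)
    (hm : m ∈ excessSlopes u S x p H) (hX : X ∈ S) :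
    ⟪m - p, X - x⟫ ≤ 1 / 8 * max H (gap u x p X) := by
  rcases le_total (gap u x p X) H with h | h
  · exact (hm X hX h).trans (mul_le_mul_of_nonneg_left (le_max_left _ _) (by norm_num))
  · rw [max_eq_right h]
    exact inner_le_of_section ((convexOn_gap hu x p).subset hSΩ hS) hx (gap_self u x p) hH hm hX h

lemma gap_le_of_mem_excessSlopes (hu : ConvexOn ℝ Ω u) {S : Set (En n)} (hS : Convex ℝ S)
    (hSΩ : S ⊆ Ω) {x₁ p₁ x₂ p₂ m : En n} {H : ℝ} (hH : 0 < H) (hx₁ : x₁ ∈ S) (hx₂ : x₂ ∈ S)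
    (hp₂ : p₂ ∈ subgrad Ω u x₂)
    (hm₁ : m ∈ excessSlopes u S x₁ p₁ H) (hm₂ : m ∈ excessSlopes u S x₂ p₂ H) :
    gap u x₁ p₁ x₂ ≤ 1 / 4 * H := by
  have h1 := inner_le_max_of_mem_excessSlopes hu hS hSΩ hH hx₁ hm₁ hx₂
  have h2 := inner_le_max_of_mem_excessSlopes hu hS hSΩ hH hx₂ hm₂ hx₁
  have h3 := mem_subgrad_iff.1 hp₂ x₁ (hSΩ hx₁)
  have e1 : gap u x₁ p₁ x₂ + gap u x₂ p₂ x₁ = ⟪m - p₁, x₂ - x₁⟫ + ⟪m - p₂, x₁ - x₂⟫ := by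
    simp only [gap, inner_sub_left, inner_sub_right]
    ring
  rcases max_cases H (gap u x₁ p₁ x₂) with ⟨ha, -⟩ | ⟨ha, ha'⟩ <;>
  rcases max_cases H (gap u x₂ p₂ x₁) with ⟨hb, -⟩ | ⟨hb, hb'⟩ <;>
  rw [ha] at h1 <;> rw [hb] at h2 <;> linarith

/-- If slopes `q ∈ A` have contact points whose small sections lie in `O`, then `A` is small. -/
lemma volume_slopes_le (hΩo : IsOpen Ω) (hu : ConvexOn ℝ Ω u) {c C : ℝ}
    (hM : MABounds Ω u c C) {S : Set (En n)} (hS : Convex ℝ S) (hSc : IsCompact S) (hSΩ : S ⊆ Ω)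
    {O : Set (En n)} (hO : IsOpen O) (hOΩ : O ⊆ Ω) {H K : ℝ} (hH : 0 < H) (hK : 0 < K)
    {A : Set (En n)} {x p : En n → En n} {Φ : En n → ℝ} (hx : ∀ q ∈ A, x q ∈ S)
    (hp : ∀ q ∈ A, p q ∈ subgrad Ω u (x q))
    (hsec : ∀ q ∈ A, ∀ X ∈ S, gap u (x q) (p q) X ≤ H → X ∈ O ∧ X ∈ interior S)
    (hΦ : ∀ q ∈ A, ∀ X ∈ S, 0 ≤ Φ X - Φ (x q) - ⟪q, X - x q⟫ ∧
      Φ X - Φ (x q) - ⟪q, X - x q⟫ ≤ K * gap u (x q) (p q) X) :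
    volume A ≤ ENNReal.ofReal ((16 * K) ^ n) * (ENNReal.ofReal C * volume O) := by
  set Q : En n → Set (En n) := fun q => excessSlopes u S (x q) (p q) H with hQ
  have hQne : ∀ q ∈ A, (interior (Q q)).Nonempty := fun q hq =>
    ⟨p q, mem_interior_excessSlopes hSc.isBounded _ _ hH⟩
  obtain ⟨I, hIA, hId, hIc⟩ := Vitali.exists_disjoint_subfamily_covering_enlargement Q A (fun _ => 1) 2
    one_lt_two (fun _ _ => zero_le_one) 1 (fun _ _ => le_rfl)
    (fun q hq => (hQne q hq).mono interior_subset)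
  have hIcount : I.Countable :=
    hId.countable_of_nonempty_interior fun q hq => hQne q (hIA hq)
  have hQO : ∀ q ∈ A, Q q ⊆ ⋃ X ∈ O, subgrad Ω u X := fun q hq m hm => by
    have hSS : {X | X ∈ S ∧ gap u (x q) (p q) X ≤ H} ⊆ interior S := fun X hX =>
      (hsec q hq X hX.1 hX.2).2
    have hcl : IsCompact {X | X ∈ S ∧ gap u (x q) (p q) X ≤ H} := by
      have := ((continuousOn_gap hΩo hu (x q) (p q)).mono hSΩ).preimage_isClosed_of_isClosed
        hSc.isClosed (isClosed_Iic (a := H))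
      exact hSc.of_isClosed_subset this fun X hX => hX.1
    obtain ⟨X, hX, hXm⟩ := exists_contact hΩo hu hS hSΩ (r := m - p q) (hx q hq) hH
      (by norm_num : (1 / 8 : ℝ) ≤ 1) hcl hSS hm
    rw [add_sub_cancel] at hXm
    exact mem_biUnion (hsec q hq X hX.1 hX.2).1 hXm
  have hcov : A ⊆ ⋃ k ∈ I, (fun r => (k - (16 * K) • p k) + (16 * K) • r) '' Q k := by
    intro q hq
    obtain ⟨k, hk, ⟨m, hm, hm'⟩, -⟩ := hIc q hq
    have hkA := hIA hk
    refine mem_biUnion hk ⟨p k + (16 * K)⁻¹ • (q - k), fun X hX hXH => ?_, ?_⟩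
    · have h1 := gap_le_of_mem_excessSlopes hu hS hSΩ hH (hx q hq) (hx k hkA) (hp k hkA) hm hm'
      have h2 := (hΦ q hq (x k) (hx k hkA)).2
      have h3 := (hΦ q hq X hX).1
      have h4 := (hΦ k hkA X hX).2
      have h5 := mul_le_mul_of_nonneg_left h1 hK.le
      have h6 := mul_le_mul_of_nonneg_left hXH hK.le
      have h7 : ⟪q - k, X - x k⟫ ≤ 2 * K * H := by
        have hKH : 0 < K * H := mul_pos hK hH
        simp only [inner_sub_left, inner_sub_right] at *
        linarith
      rw [add_sub_cancel_left, real_inner_smul_left]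
      have h8 := mul_le_mul_of_nonneg_left h7 (by positivity : 0 ≤ (16 * K)⁻¹)
      refine h8.trans (le_of_eq ?_)
      field_simp
      norm_num
    · simp only [smul_add, smul_smul]
      rw [mul_inv_cancel₀ (by positivity), one_smul]
      abel
  calc volume A ≤ ∑' k : I, volume ((fun r => ((k : En n) - (16 * K) • p k) + (16 * K) • r) '' Q k) :=
        (measure_mono hcov).trans (measure_biUnion_le _ hIcount _)
    _ = ENNReal.ofReal ((16 * K) ^ n) * ∑' k : I, volume (Q k) := by
        rw [← ENNReal.tsum_mul_left]
        refine tsum_congr fun k => ?_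
        rw [volume_image_affine, abs_of_pos (by positivity)]
    _ = ENNReal.ofReal ((16 * K) ^ n) * volume (⋃ k ∈ I, Q k) := by
        rw [measure_biUnion hIcount hId fun k _ => (isClosed_excessSlopes _ _ _ _).measurableSet]
    _ ≤ _ := by
        refine mul_le_mul_right ?_ _
        refine le_trans (measure_mono ?_) (hM O hOΩ hO.measurableSet).2
        exact iUnion₂_subset fun k hk => hQO k (hIA hk)

/-- A minimum of `logPert - q` yields a comparison with a supporting function of `u`. -/
lemma exists_subgrad_of_logPert_min (hΩo : IsOpen Ω) (hu : ConvexOn ℝ Ω u) (hv : ConvexOn ℝ Ω v)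
    (huv : ∀ X ∈ Ω, v X ≤ u X) {S : Set (En n)} (hSΩ : S ⊆ Ω) {α τ : ℝ} (hα : 0 < α) (hτ : 0 < τ)
    {x q : En n} (hx : x ∈ interior S)
    (hmin : ∀ X ∈ S, logPert u v α τ x - ⟪q, x⟫ ≤ logPert u v α τ X - ⟪q, X⟫) :
    ∃ p ∈ subgrad Ω u x, ∀ X ∈ S,
      0 ≤ logPert u v α τ X - logPert u v α τ x - ⟪q, X - x⟫ ∧
      logPert u v α τ X - logPert u v α τ x - ⟪q, X - x⟫ ≤
        (1 + 1 / (α * τ)) * gap u x p X := by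
  have hxΩ : x ∈ Ω := hSΩ (interior_subset hx)
  obtain ⟨pv, hpv⟩ := subgrad_nonempty hΩo hv hxΩ
  set θ := u x - v x + τ with hθ
  have hθτ : τ ≤ θ := by linarith [huv x hxΩ]
  have hθ0 : 0 < θ := by linarith
  set s := α * θ with hs
  have hs0 : 0 < s := mul_pos hα hθ0
  have key : ∀ X ∈ S, logPert u v α τ X - logPert u v α τ x - ⟪q, X - x⟫ ≤
      (1 + 1 / s) * gap u x ((1 + s)⁻¹ • (s • q + pv)) X := fun X hX => by
    have hθX : 0 < u X - v X + τ := by linarith [huv X (hSΩ hX)]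
    have h1 : Real.log (u X - v X + τ) - Real.log θ ≤ (u X - v X + τ) / θ - 1 := by
      rw [← Real.log_div hθX.ne' hθ0.ne']
      exact Real.log_le_sub_one_of_pos (div_pos hθX hθ0)
    have h2 := mul_le_mul_of_nonneg_left h1 (inv_nonneg.2 hα.le)
    have e1 : α⁻¹ * ((u X - v X + τ) / θ - 1) = 1 / s * ((u X - v X) - (u x - v x)) := by
      have e0 : (u X - v X + τ) = θ + ((u X - v X) - (u x - v x)) := by rw [hθ]; ring
      rw [e0, hs]
      field_simp
      ring
    have h3 := hpv X (hSΩ hX)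
    have e2 : (1 + 1 / s) * gap u x ((1 + s)⁻¹ • (s • q + pv)) X =
        (u X - u x) - ⟪q, X - x⟫ + 1 / s * ((u X - u x) - ⟪pv, X - x⟫) := by
      have : 1 + s ≠ 0 := by positivity
      rw [gap, real_inner_smul_left, inner_add_left, real_inner_smul_left]
      field_simp
      ring
    have h4 : 1 / s * ((u X - v X) - (u x - v x)) ≤ 1 / s * ((u X - u x) - ⟪pv, X - x⟫) :=
      mul_le_mul_of_nonneg_left (by linarith) (by positivity)
    rw [e2]
    simp only [logPert]
    rw [e1] at h2
    rw [mul_sub] at h2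
    linarith
  have hnn : ∀ X ∈ S, 0 ≤ logPert u v α τ X - logPert u v α τ x - ⟪q, X - x⟫ := fun X hX => by
    have := hmin X hX
    rw [inner_sub_right]
    linarith
  have hgap : ∀ X ∈ S, 0 ≤ gap u x ((1 + s)⁻¹ • (s • q + pv)) X := fun X hX =>
    nonneg_of_mul_nonneg_right ((hnn X hX).trans (key X hX)) (by positivity)
  refine ⟨(1 + s)⁻¹ • (s • q + pv), ?_, fun X hX => ⟨hnn X hX, (key X hX).trans ?_⟩⟩
  · refine mem_subgrad_of_eventually hu hxΩ ?_
    filter_upwards [mem_interior_iff_mem_nhds.1 hx] with X hX using hgap X hX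
  · refine mul_le_mul_of_nonneg_right ?_ (hgap X hX)
    have : α * τ ≤ s := mul_le_mul_of_nonneg_left hθτ hα.le
    have := one_div_le_one_div_of_le (mul_pos hα hτ) this
    linarith

/-- Slopes whose unique minimizer of `logPert - q` lies in a null set form a null set. -/
lemma volume_slopes_of_null (hΩo : IsOpen Ω) (hu : ConvexOn ℝ Ω u) (hv : ConvexOn ℝ Ω v)
    (huv : ∀ X ∈ Ω, v X ≤ u X) {c C : ℝ} (hM : MABounds Ω u c C) {S : Set (En n)}
    (hS : Convex ℝ S) (hSc : IsCompact S) (hSΩ : S ⊆ Ω) {α τ : ℝ} (hα : 0 < α) (hτ : 0 < τ)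
    {N : Set (En n)} (hN : volume N = 0) :
    volume {q | ∃ x ∈ interior S, x ∈ N ∧
      ∀ X ∈ S, X ≠ x → logPert u v α τ x - ⟪q, x⟫ < logPert u v α τ X - ⟪q, X⟫} = 0 := by
  set A := {q | ∃ x ∈ interior S, x ∈ N ∧
      ∀ X ∈ S, X ≠ x → logPert u v α τ x - ⟪q, x⟫ < logPert u v α τ X - ⟪q, X⟫} with hA
  set K := 1 + 1 / (α * τ) with hK
  have hK0 : 0 < K := by positivity
  have hch : ∀ q ∈ A, ∃ x p : En n, x ∈ interior S ∧ x ∈ N ∧ p ∈ subgrad Ω u x ∧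
      (∀ X ∈ S, X ≠ x → logPert u v α τ x - ⟪q, x⟫ < logPert u v α τ X - ⟪q, X⟫) ∧
      ∀ X ∈ S, 0 ≤ logPert u v α τ X - logPert u v α τ x - ⟪q, X - x⟫ ∧
      logPert u v α τ X - logPert u v α τ x - ⟪q, X - x⟫ ≤ K * gap u x p X := by
    rintro q ⟨x, hx, hxN, hmin⟩
    obtain ⟨p, hp, hp'⟩ := exists_subgrad_of_logPert_min hΩo hu hv huv hSΩ hα hτ (q := q) hx
      fun X hX => by
        rcases eq_or_ne X x with rfl | h
        · exact le_rfl
        · exact (hmin X hX h).le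
    exact ⟨x, p, hx, hxN, hp, hmin, hp'⟩
  choose! x p hx hxN hp hmin hΦ using hch
  have hgap : ∀ q ∈ A, ∀ X ∈ S, X ≠ x q → 0 < gap u (x q) (p q) X := fun q hq X hX hne => by
    have h1 := hmin q hq X hX hne
    have h2 := (hΦ q hq X hX).2
    rw [inner_sub_right] at h2
    exact pos_of_mul_pos_right (a := K) (by linarith) hK0.le
  have hopen : ∀ O : Set (En n), IsOpen O → N ⊆ O →
      volume A ≤ ENNReal.ofReal ((16 * K) ^ n) * (ENNReal.ofReal C * volume O) := by
    intro O hO hNO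
    set A' : ℕ → Set (En n) := fun j => {q | q ∈ A ∧ ∀ X ∈ S,
      gap u (x q) (p q) X ≤ 1 / ((j : ℝ) + 1) → X ∈ O ∩ interior S} with hA'
    have hmono : Monotone A' := by
      intro i j hij q hq
      refine ⟨hq.1, fun X hX hXg => hq.2 X hX (hXg.trans ?_)⟩
      exact one_div_le_one_div_of_le (by positivity) (by gcongr)
    have hAU : A ⊆ ⋃ j, A' j := by
      intro q hq
      by_contra hcon
      simp only [hA', mem_iUnion, mem_ofPred_eq, not_exists, not_and, not_forall] at hcon
      have h1 : ∀ j : ℕ, ∃ X ∈ S, gap u (x q) (p q) X ≤ 1 / ((j : ℝ) + 1) ∧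
          X ∉ O ∩ interior S := fun j => by
        obtain ⟨X, hX, hXg, hXn⟩ := hcon j hq
        exact ⟨X, hX, hXg, hXn⟩
      choose X hX hXg hXn using h1
      obtain ⟨z, hz, φ, hφ, hlim⟩ := hSc.tendsto_subseq hX
      have hcont : Tendsto (fun j => gap u (x q) (p q) (X (φ j))) atTop
          (nhds (gap u (x q) (p q) z)) :=
        ((continuousOn_gap hΩo hu (x q) (p q)).continuousAt (hΩo.mem_nhds (hSΩ hz))).tendsto.comp
          hlim
      have h0 : gap u (x q) (p q) z ≤ 0 := by
        refine le_of_tendsto_of_tendsto' hcont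
          (tendsto_one_div_add_atTop_nhds_zero_nat.comp hφ.tendsto_atTop) fun j => hXg _
      have hzx : z = x q := by
        by_contra hne
        exact absurd h0 (hgap q hq z hz hne).not_ge
      have hnhds : O ∩ interior S ∈ nhds z := by
        rw [hzx]
        exact (hO.inter isOpen_interior).mem_nhds ⟨hNO (hxN q hq), hx q hq⟩
      obtain ⟨j, hj⟩ := (hlim.eventually hnhds).exists
      exact hXn _ hj
    refine (measure_mono hAU).trans ?_
    rw [hmono.measure_iUnion]
    refine iSup_le fun j => ?_
    have := volume_slopes_le hΩo hu hM hS hSc hSΩ (hO.inter isOpen_interior)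
      (inter_subset_right.trans (interior_subset.trans hSΩ))
      (by positivity : 0 < 1 / ((j : ℝ) + 1)) hK0 (A := A' j) (x := x) (p := p)
      (Φ := logPert u v α τ) (fun q hq => interior_subset (hx q hq.1)) (fun q hq => hp q hq.1)
      (fun q hq X hX hXg => ⟨hq.2 X hX hXg, (hq.2 X hX hXg).2⟩) (fun q hq => hΦ q hq.1)
    refine this.trans ?_
    gcongr
    exact inter_subset_left
  refine le_antisymm (ENNReal.le_of_forall_pos_le_add fun ε hε _ => ?_) (zero_le)
  set k := ENNReal.ofReal ((16 * K) ^ n) * ENNReal.ofReal C with hk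
  have hkt : k ≠ ⊤ := ENNReal.mul_ne_top ENNReal.ofReal_ne_top ENNReal.ofReal_ne_top
  have hε' : (ε : ℝ≥0∞) / (k + 1) ≠ 0 := by
    rw [ne_eq, ENNReal.div_eq_zero_iff, not_or]
    exact ⟨by simpa using hε.ne', by simp [hkt]⟩
  obtain ⟨O, hNO, hO, hOv⟩ := N.exists_isOpen_le_add volume hε'
  rw [hN, zero_add] at hOv
  refine (hopen O hO hNO).trans ?_
  rw [zero_add, ← mul_assoc, ← hk]
  calc k * volume O ≤ (k + 1) * (ε / (k + 1)) := mul_le_mul' le_self_add hOv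
    _ ≤ ε := ENNReal.mul_div_le

end SlopeCovering

section ContactSections

open Filter

variable {n : ℕ} {Ω : Set (En n)} {u v : En n → ℝ}

lemma exists_volume_fderiv_gt_lt (P : En n → En n) {K : Set (En n)} (hK : IsCompact K)
    {ε : ℝ≥0∞} (hε : 0 < ε) : ∃ T : ℝ, 0 ≤ T ∧ volume {x | x ∈ K ∧ T < ‖fderiv ℝ P x‖} < ε := by
  set s : ℕ → Set (En n) := fun j => {x | x ∈ K ∧ (j : ℝ) < ‖fderiv ℝ P x‖} with hs
  have hmeas : ∀ j, MeasurableSet (s j) := fun j =>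
    hK.measurableSet.inter (measurableSet_lt measurable_const (measurable_fderiv ℝ P).norm)
  have hanti : Antitone s := fun i j hij x hx =>
    ⟨hx.1, lt_of_le_of_lt (by exact_mod_cast hij) hx.2⟩
  have hlim := tendsto_measure_iInter_atTop (μ := volume) (fun j => (hmeas j).nullMeasurableSet)
    hanti ⟨0, ((measure_mono fun x hx => hx.1).trans_lt hK.measure_lt_top).ne⟩
  have hemp : ⋂ j, s j = ∅ := by
    refine eq_empty_of_forall_notMem fun x hx => ?_
    obtain ⟨j, hj⟩ := exists_nat_gt ‖fderiv ℝ P x‖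
    exact absurd (mem_iInter.1 hx j).2 hj.not_gt
  rw [hemp, measure_empty] at hlim
  obtain ⟨j, hj⟩ := (hlim.eventually_lt_const hε).exists
  exact ⟨j, Nat.cast_nonneg j, hj⟩

lemma gap_mem_Ioo_of_logPert_le {x x₀ y p q : En n} {α τ β ε₀ h₀ h₂ η R : ℝ} (hα : 1 ≤ α)
    (hτ : 0 < τ) (hlog : Real.log τ = -(α * β)) (hε₀ : 0 < ε₀) (hβ : β = h₂ + |Real.log ε₀|)
    (hx₀ : u x₀ = v x₀) (hvx : v x ≤ u x) (hq : ‖q - p‖ ≤ η) (hx : ‖x - y‖ ≤ R)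
    (hx₀y : ‖x₀ - y‖ ≤ R) (hgap : 0 ≤ gap u y p x) (hη : 2 * (η * R) < h₂ - gap u y p x₀)
    (hh₀ : gap u y p x ≤ h₀ → ε₀ ≤ u x - v x)
    (hmin : logPert u v α τ x - ⟪q, x⟫ ≤ logPert u v α τ x₀ - ⟪q, x₀⟫) :
    h₀ < gap u y p x ∧ gap u y p x < h₂ := by
  have hα0 : 0 < α := by linarith
  have hη0 : 0 ≤ η := (norm_nonneg _).trans hq
  have hin : ∀ z, ‖z - y‖ ≤ R → |⟪q - p, z - y⟫| ≤ η * R := fun z hz =>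
    (abs_real_inner_le_norm _ _).trans (mul_le_mul hq hz (norm_nonneg _) hη0)
  have hid : ∀ z, u z - ⟪q, z⟫ = gap u y p z + u y - ⟪q - p, z - y⟫ - ⟪q, y⟫ := fun z => by
    simp only [gap, inner_sub_left, inner_sub_right]
    ring
  have h1 := abs_le.1 (hin x hx)
  have h2 := abs_le.1 (hin x₀ hx₀y)
  have hxx := hid x
  have hxx₀ := hid x₀
  have hlog₀ : α⁻¹ * Real.log (u x₀ - v x₀ + τ) = -β := by
    rw [hx₀, sub_self, zero_add, hlog]
    field_simp
  simp only [logPert] at hmin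
  rw [hlog₀] at hmin
  have hmain : gap u y p x + α⁻¹ * Real.log (u x - v x + τ) + β < h₂ := by linarith
  constructor
  · by_contra! hcon
    have h3 := hh₀ hcon
    have h4 : Real.log ε₀ ≤ Real.log (u x - v x + τ) := Real.log_le_log hε₀ (by linarith)
    have h5 : -|Real.log ε₀| ≤ α⁻¹ * Real.log (u x - v x + τ) := by
      have h6 : -|Real.log ε₀| ≤ Real.log (u x - v x + τ) := (neg_abs_le _).trans h4
      have h7 : α⁻¹ ≤ 1 := inv_le_one_of_one_le₀ hα
      have h8 : 0 < α⁻¹ := inv_pos.2 hα0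
      calc -|Real.log ε₀| ≤ α⁻¹ * -|Real.log ε₀| := by
            nlinarith [abs_nonneg (Real.log ε₀)]
        _ ≤ _ := mul_le_mul_of_nonneg_left h6 h8.le
    linarith
  · have h4 : Real.log τ ≤ Real.log (u x - v x + τ) := Real.log_le_log hτ (by linarith)
    have h5 := mul_le_mul_of_nonneg_left h4 (inv_pos.2 hα0).le
    rw [hlog] at h5
    have e : α⁻¹ * -(α * β) = -β := by field_simp
    rw [e] at h5
    linarith

/-- Two ordered solutions of the same Monge–Ampère equation. -/
structure IsSolPair (Ω : Set (En n)) (f : En n → ℝ) (F G : En n × ℝ → ℝ) (lam Lam : ℝ)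
    (u v : En n → ℝ) : Prop where
  isOpen : IsOpen Ω
  measurable : Measurable f
  pos : 0 < lam
  le : lam ≤ Lam
  f_bounds : ∀ x ∈ Ω, lam ≤ f x ∧ f x ≤ Lam
  F_bounds : ∀ z, lam ≤ F z ∧ F z ≤ Lam
  G_bounds : ∀ z, lam ≤ G z ∧ G z ≤ Lam
  F_lip : LocallyLipschitz F
  G_lip : LocallyLipschitz G
  convex_left : ConvexOn ℝ Ω u
  convex_right : ConvexOn ℝ Ω v
  order : ∀ x ∈ Ω, v x ≤ u x
  sol_left : IsGenSol Ω f F G u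
  sol_right : IsGenSol Ω f F G v

variable {f : En n → ℝ} {F G : En n × ℝ → ℝ} {lam Lam : ℝ}

lemma IsSolPair.maBounds_left (h : IsSolPair Ω f F G lam Lam u v) :
    MABounds Ω u (lam * lam / Lam) (Lam * Lam / lam) :=
  h.sol_left.maBounds h.pos h.le h.f_bounds h.F_bounds h.G_bounds

lemma IsSolPair.maBounds_right (h : IsSolPair Ω f F G lam Lam u v) :
    MABounds Ω v (lam * lam / Lam) (Lam * Lam / lam) :=
  h.sol_right.maBounds h.pos h.le h.f_bounds h.F_bounds h.G_bounds

lemma IsSolPair.lower_pos (h : IsSolPair Ω f F G lam Lam u v) : 0 < lam * lam / Lam :=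
  div_pos (mul_pos h.pos h.pos) (h.pos.trans_le h.le)

lemma IsSolPair.upper_pos (h : IsSolPair Ω f F G lam Lam u v) : 0 < Lam * Lam / lam :=
  div_pos (mul_pos (h.pos.trans_le h.le) (h.pos.trans_le h.le)) h.pos

lemma IsSolPair.ae_det_eq (h : IsSolPair Ω f F G lam Lam u v) :
    ∀ᵐ y, y ∈ Ω → IsGood Ω u y ∧ IsGood Ω v y ∧
      (fderiv ℝ (subslope Ω u) y).det = maDensity Ω f F G u y ∧
      (fderiv ℝ (subslope Ω v) y).det = maDensity Ω f F G v y := by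
  have hf0 : ∀ x ∈ Ω, 0 ≤ f x := fun x hx => h.pos.le.trans (h.f_bounds x hx).1
  have hF0 : ∀ z, 0 ≤ F z := fun z => h.pos.le.trans (h.F_bounds z).1
  have hG0 : ∀ z, 0 ≤ G z := fun z => h.pos.le.trans (h.G_bounds z).1
  filter_upwards [ae_isGood h.isOpen h.convex_left h.lower_pos h.maBounds_left,
    ae_isGood h.isOpen h.convex_right h.lower_pos h.maBounds_right,
    h.sol_left.ae_det_eq h.isOpen h.convex_left h.lower_pos h.maBounds_left h.measurable
      h.F_lip.continuous h.G_lip.continuous hf0 hF0 hG0,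
    h.sol_right.ae_det_eq h.isOpen h.convex_right h.lower_pos h.maBounds_right h.measurable
      h.F_lip.continuous h.G_lip.continuous hf0 hF0 hG0] with y h1 h2 h3 h4 hy
  exact ⟨h1 hy, h2 hy, h3 hy, h4 hy⟩

/-- A compact section of `u` at an exposed point off the contact set does not meet the
contact set. -/
lemma IsSolPair.not_contact_of_section (h : IsSolPair Ω f F G lam Lam u v) {y p x₀ : En n}
    (hy : y ∈ Ω) (hvy : v y < u y) (hp : IsExp Ω u y p) {h₂ : ℝ}
    (hSc : IsCompact {X | X ∈ Ω ∧ gap u y p X ≤ h₂}) (hx₀ : x₀ ∈ Ω)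
    (hx₀h : gap u y p x₀ < h₂) : u x₀ ≠ v x₀ := by
  intro hx₀e
  have hΩo := h.isOpen
  have hu := h.convex_left
  have hv := h.convex_right
  set S := {X | X ∈ Ω ∧ gap u y p X ≤ h₂} with hSdef
  have hgc := continuousOn_gap hΩo hu y p
  have hSconv : Convex ℝ S := (convexOn_gap hu y p).convex_le h₂
  have hSΩ : S ⊆ Ω := fun X hX => hX.1
  have hSint : ∀ X ∈ Ω, gap u y p X < h₂ → X ∈ interior S := fun X hX hXh => by
    rw [mem_interior_iff_mem_nhds]
    filter_upwards [hΩo.mem_nhds hX,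
      (hgc.continuousAt (hΩo.mem_nhds hX)).eventually_lt_const hXh] with z h1 h2
    exact ⟨h1, h2.le⟩
  have hx₀S : x₀ ∈ S := ⟨hx₀, hx₀h.le⟩
  have hgn : ∀ X ∈ Ω, 0 ≤ gap u y p X := mem_subgrad_iff.1 hp.1
  obtain ⟨h₀, ε₀, hh₀, hε₀, hnear⟩ : ∃ h₀ ε₀ : ℝ, 0 < h₀ ∧ 0 < ε₀ ∧
      ∀ X ∈ Ω, gap u y p X ≤ h₀ → ε₀ ≤ u X - v X := by
    have hcu := (hu.continuousOn hΩo).continuousAt (hΩo.mem_nhds hy)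
    have hcv := (hv.continuousOn hΩo).continuousAt (hΩo.mem_nhds hy)
    have h1 := (hcu.sub hcv).eventually_const_lt (show (u y - v y) / 2 < u y - v y by linarith)
    obtain ⟨r, hr, hrs⟩ := Metric.nhds_basis_closedBall.mem_iff.1 (h1.and (hΩo.mem_nhds hy))
    obtain ⟨h₀, hh₀, hev⟩ := exists_section_subset hΩo hu hp hr fun z hz => (hrs hz).2
    refine ⟨h₀, (u y - v y) / 2, hh₀, by linarith, fun X hX hXh => ?_⟩
    exact (hrs (Metric.ball_subset_closedBall (hev.self_of_nhds hp.1 hy X hX hXh))).1.le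
  obtain ⟨R, hR0, hR⟩ := hSc.isBounded.subset_closedBall_lt 0 y
  have hRx : ∀ X ∈ S, ‖X - y‖ ≤ R := fun X hX => mem_closedBall_iff_norm.1 (hR hX)
  set η := min ((h₂ - gap u y p x₀) / (4 * R)) (h₀ / (2 * R)) with hη
  have hη0 : 0 < η := lt_min (div_pos (by linarith) (by positivity)) (by positivity)
  have hηR : 2 * (η * R) < h₂ - gap u y p x₀ := by
    have h1 : η ≤ (h₂ - gap u y p x₀) / (4 * R) := min_le_left _ _
    rw [le_div_iff₀ (by positivity)] at h1
    nlinarith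
  have hη' : η ≤ h₀ / (2 * R) := min_le_right _ _
  set κ := h₀ / (2 * R) with hκ
  have hκ0 : 0 < κ := by positivity
  set β := h₂ + |Real.log ε₀| with hβ
  obtain ⟨Ru, hRu0, hRu⟩ := exists_subgrad_bound hΩo hu hSc hSΩ
  obtain ⟨C, hC0, hC⟩ := exists_maDensity_sub_le hΩo hu hv h.pos h.f_bounds h.F_bounds h.G_bounds
    h.F_lip h.G_lip hSc hSΩ (B := ‖p‖ + η + Ru) (by positivity)
  set C₁ := C + n + 1 with hC₁
  have hC₁0 : 0 < C₁ := by positivity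
  have hg0 := h.upper_pos
  set C' := C₁ ^ n * (Lam * Lam / lam) with hC'
  have hC'0 : 0 < C' := by positivity
  have hball : volume (Metric.ball p η) ≠ 0 := (Metric.measure_ball_pos volume p hη0).ne'
  obtain ⟨T, hT0, hT⟩ := exists_volume_fderiv_gt_lt (subslope Ω u) hSc
    (ENNReal.div_pos hball (ENNReal.ofReal_ne_top (r := C')))
  set α := 1 + T * C₁ / κ ^ 2 with hα
  have hα1 : 1 ≤ α := le_add_of_nonneg_right (by positivity)
  have hα0 : 0 < α := by linarith
  set τ := Real.exp (-(α * β)) with hτ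
  have hτ0 : 0 < τ := Real.exp_pos _
  set N := toMeasurable volume {y | ¬ (y ∈ Ω → IsGood Ω u y ∧ IsGood Ω v y ∧
      (fderiv ℝ (subslope Ω u) y).det = maDensity Ω f F G u y ∧
      (fderiv ℝ (subslope Ω v) y).det = maDensity Ω f F G v y)} with hNdef
  have hN0 : volume N = 0 := by rw [hNdef, measure_toMeasurable]; exact ae_iff.1 h.ae_det_eq
  have hNm : MeasurableSet N := measurableSet_toMeasurable _ _
  have hNgood : ∀ x ∈ Ω, x ∉ N → IsGood Ω u x ∧ IsGood Ω v x ∧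
      (fderiv ℝ (subslope Ω u) x).det = maDensity Ω f F G u x ∧
      (fderiv ℝ (subslope Ω v) x).det = maDensity Ω f F G v x := fun x hx hxN => by
    by_contra hcon
    exact hxN (subset_toMeasurable _ _ fun h' => hcon (h' hx))
  set lq := logSlope Ω u v α τ with hq'
  set Y := {x | (x ∈ S ∧ T < ‖fderiv ℝ (subslope Ω u) x‖) ∧ DifferentiableAt ℝ lq x ∧
    |(fderiv ℝ lq x).det| ≤ C'} with hY
  have hYm : MeasurableSet Y := by
    have h1 : MeasurableSet {x | |(fderiv ℝ lq x).det| ≤ C'} :=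
      measurableSet_le ((ContinuousLinearMap.continuous_det.abs).measurable.comp
        (measurable_fderiv ℝ lq)) measurable_const
    have h2 : MeasurableSet {x | DifferentiableAt ℝ lq x} := measurableSet_of_differentiableAt ℝ lq
    exact (hSc.measurableSet.inter
      (measurableSet_lt measurable_const (measurable_fderiv ℝ _).norm)).inter (h2.inter h1)
  have hYv : volume (lq '' Y) < volume (Metric.ball p η) := by
    calc volume (lq '' Y) ≤ ∫⁻ x in Y, ENNReal.ofReal |(fderiv ℝ lq x).det| :=
          addHaar_image_le_lintegral_abs_det_fderiv volume hYm
            fun x hx => hx.2.1.hasFDerivAt.hasFDerivWithinAt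
      _ ≤ ∫⁻ _ in Y, ENNReal.ofReal C' :=
          setLIntegral_mono measurable_const fun x hx => ENNReal.ofReal_le_ofReal hx.2.2
      _ = ENNReal.ofReal C' * volume Y := setLIntegral_const _ _
      _ ≤ ENNReal.ofReal C' * volume {x | x ∈ S ∧ T < ‖fderiv ℝ (subslope Ω u) x‖} := by
          gcongr
          exact fun x hx => hx.1
      _ < ENNReal.ofReal C' * (volume (Metric.ball p η) / ENNReal.ofReal C') :=
          ENNReal.mul_lt_mul_right (ENNReal.ofReal_pos.2 hC'0).ne' ENNReal.ofReal_ne_top hT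
      _ ≤ volume (Metric.ball p η) := ENNReal.mul_div_le
  have hΦc : ContinuousOn (logPert u v α τ) S := by
    have h1 := (hu.continuousOn hΩo).mono hSΩ
    have h2 := (hv.continuousOn hΩo).mono hSΩ
    refine h1.add (continuousOn_const.mul (((h1.sub h2).add continuousOn_const).log
      fun X hX => ?_))
    have := h.order X (hSΩ hX)
    have : 0 < u X - v X + τ := by linarith
    exact this.ne'
  obtain ⟨m, -, hm⟩ := hSc.exists_isMinOn ⟨x₀, hx₀S⟩ hΦc
  have huniq := ae_unique_minimizer hSc (m := logPert u v α τ m) fun X hX => hm hX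
  set B₁ := {q | ¬ ∀ x ∈ S, ∀ z ∈ S,
    (∀ X ∈ S, logPert u v α τ x - ⟪q, x⟫ ≤ logPert u v α τ X - ⟪q, X⟫) →
    (∀ X ∈ S, logPert u v α τ z - ⟪q, z⟫ ≤ logPert u v α τ X - ⟪q, X⟫) → x = z} with hB₁
  have hB₁0 : volume B₁ = 0 := ae_iff.1 huniq
  set B₂ := {q | ∃ x ∈ interior S, x ∈ N ∧
      ∀ X ∈ S, X ≠ x → logPert u v α τ x - ⟪q, x⟫ < logPert u v α τ X - ⟪q, X⟫} with hB₂
  have hB₂0 : volume B₂ = 0 :=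
    volume_slopes_of_null hΩo hu hv h.order h.maBounds_left hSconv hSc hSΩ hα0 hτ0 hN0
  have hcov : Metric.ball p η ⊆ B₁ ∪ B₂ ∪ lq '' Y := by
    intro q hq
    by_cases hq1 : q ∈ B₁
    · exact Or.inl (Or.inl hq1)
    have hqη : ‖q - p‖ ≤ η := (mem_ball_iff_norm.1 hq).le
    obtain ⟨x, hxS, hx⟩ := hSc.exists_isMinOn ⟨x₀, hx₀S⟩
      (hΦc.sub (innerSL ℝ q).continuous.continuousOn)
    replace hx : ∀ X ∈ S, logPert u v α τ x - ⟪q, x⟫ ≤ logPert u v α τ X - ⟪q, X⟫ :=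
      fun X hX => hx hX
    have hxΩ := hSΩ hxS
    have hvx := h.order x hxΩ
    obtain ⟨hlo, hhi⟩ := gap_mem_Ioo_of_logPert_le hα1 hτ0 (Real.log_exp _) hε₀ hβ hx₀e hvx
      hqη (hRx x hxS) (hRx x₀ hx₀S) (hgn x hxΩ) hηR (hnear x hxΩ) (hx x₀ hx₀S)
    have hxi := hSint x hxΩ hhi
    by_cases hxN : x ∈ N
    · refine Or.inl (Or.inr ⟨x, hxi, hxN, fun X hX hne => ?_⟩)
      refine lt_of_le_of_ne (hx X hX) fun heq => hne ?_
      refine ((not_not.1 hq1) x hxS X hX hx fun Z hZ => ?_).symm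
      rw [← heq]
      exact hx Z hZ
    · refine Or.inr ?_
      obtain ⟨hgu, hgv, hdu, hdv⟩ := hNgood x hxΩ hxN
      have hθ : 0 < u x - v x + τ := by linarith
      have hev : ∀ᶠ X in nhds x, logPert u v α τ x - ⟪q, x⟫ ≤ logPert u v α τ X - ⟪q, X⟫ := by
        filter_upwards [mem_interior_iff_mem_nhds.1 hxi] with X hX using hx X hX
      have hqs : q = logSlope Ω u v α τ x := hgu.eq_logSlope_of_isLocalMin hΩo hxΩ hgv hθ hev
      set s := α * (u x - v x + τ) with hs
      have hs0 : 0 < s := mul_pos hα0 hθ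
      have hPu : ‖subslope Ω u x‖ ≤ Ru := hRu x hxS _ hgu.isExp.1
      have hqn : ‖q - subslope Ω u x‖ ≤ ‖p‖ + η + Ru := by
        have h1 : ‖q‖ ≤ ‖p‖ + η := by
          have := norm_sub_norm_le q p
          linarith
        exact (norm_sub_le _ _).trans (add_le_add h1 hPu)
      have hdiff : ‖subslope Ω u x - subslope Ω v x‖ ≤ (‖p‖ + η + Ru) * s := by
        rw [← smul_sub_subslope hα0 hθ hqs, norm_smul, Real.norm_of_nonneg hs0.le, mul_comm]
        exact mul_le_mul_of_nonneg_right hqn hs0.le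
      have hφs : |u x - v x| ≤ s := by
        rw [abs_of_nonneg (by linarith), hs]
        nlinarith
      have hden := hC x hxS s hs0.le hφs hdiff
      have hgb := maDensity_bounds (u := u) h.pos h.f_bounds h.F_bounds h.G_bounds hxΩ
      obtain ⟨hD, hdet, hα2⟩ := logSlope_bounds hΩo hu hv h.order hxΩ hgu hgv hα0 hτ0 hC0 hev hqs
        (by rw [hdu]; exact hgb.1) (by rw [hdu, hdv]; exact hden)
      refine ⟨x, ⟨⟨hxS, ?_⟩, hD, hdet.trans ?_⟩, hqs.symm⟩
      · have hnorm : κ ≤ ‖q - subslope Ω u x‖ := by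
          have h1 := mem_subgrad_iff.1 hgu.isExp.1 y hy
          have h2 : gap u y p x ≤ ⟪subslope Ω u x - p, x - y⟫ := by
            simp only [gap, inner_sub_left, inner_sub_right] at *
            linarith
          have h3 : h₀ < ‖subslope Ω u x - p‖ * R :=
            hlo.trans_le (h2.trans ((real_inner_le_norm _ _).trans
              (mul_le_mul_of_nonneg_left (hRx x hxS) (norm_nonneg _))))
          have h4 : ‖subslope Ω u x - p‖ ≤ ‖q - p‖ + ‖q - subslope Ω u x‖ := by
            rw [norm_sub_rev q (subslope Ω u x)]
            have e : subslope Ω u x - p = (q - p) + (subslope Ω u x - q) := by abel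
            rw [e]
            exact norm_add_le _ _
          have h5 : 2 * κ ≤ ‖subslope Ω u x - p‖ := by
            have e : 2 * κ * R = h₀ := by rw [hκ]; field_simp
            refine le_of_mul_le_mul_right ?_ hR0
            rw [e]
            exact h3.le
          linarith
        have h6 : α * κ ^ 2 ≤ α * ‖q - subslope Ω u x‖ ^ 2 := by gcongr
        have h7 : α * κ ^ 2 = κ ^ 2 + T * C₁ := by
          rw [hα]
          field_simp
        have h8 : C₁ * T < C₁ * ‖fderiv ℝ (subslope Ω u) x‖ := by
          have : 0 < κ ^ 2 := by positivity
          linarith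
        exact lt_of_mul_lt_mul_left h8 hC₁0.le
      · rw [hdu]
        exact mul_le_mul_of_nonneg_left hgb.2 (by positivity)
  have hle : volume (Metric.ball p η) ≤ volume (lq '' Y) := by
    refine (measure_mono hcov).trans ((measure_union_le _ _).trans ?_)
    rw [measure_union_null hB₁0 hB₂0, zero_add]
  exact absurd hYv hle.not_gt

end ContactSections

section ContactSet

open Filter

variable {n : ℕ} {Ω : Set (En n)} {u v : En n → ℝ}

lemma IsStrictConvexPt.isExp (hu : ConvexOn ℝ Ω u) {x p : En n} (hx : x ∈ Ω)
    (hs : IsStrictConvexPt Ω u x) (hp : p ∈ subgrad Ω u x) : IsExp Ω u x p := by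
  refine ⟨hp, fun z hz hne => ?_⟩
  have hm : (1 / 2 : ℝ) • (z + x) ∈ Ω := by
    rw [smul_add]
    exact hu.1 hz hx (by norm_num) (by norm_num) (by norm_num)
  have h1 := mem_subgrad_iff.1 hp _ hm
  have h2 := hs z hz hne
  have h3 : (1 / 2 : ℝ) • (z + x) - x = (1 / 2 : ℝ) • (z - x) := by module
  rw [gap, h3, inner_smul_right] at h1
  rw [gap]
  linarith

lemma IsExp.of_le {x p : En n} (hp : IsExp Ω v x p) (huv : ∀ z ∈ Ω, v z ≤ u z)
    (hx : u x = v x) : IsExp Ω u x p := by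
  have hle : ∀ z ∈ Ω, gap v x p z ≤ gap u x p z := fun z hz => by
    have := huv z hz
    simp only [gap, hx]
    linarith
  exact ⟨mem_subgrad_iff.2 fun z hz => (mem_subgrad_iff.1 hp.1 z hz).trans (hle z hz),
    fun z hz hne => (hp.2 z hz hne).trans_le (hle z hz)⟩

variable {f : En n → ℝ} {F G : En n × ℝ → ℝ} {lam Lam : ℝ}

lemma IsSolPair.exists_isExp_of_notMem (h : IsSolPair Ω f F G lam Lam u v) {x : En n}
    (hx : x ∈ Ω) (hxe : u x = v x) (hxs : x ∉ SigmaSet Ω u ∩ SigmaSet Ω v) :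
    ∃ p, IsExp Ω u x p := by
  by_cases hs : IsStrictConvexPt Ω u x
  · obtain ⟨p, hp⟩ := subgrad_nonempty h.isOpen h.convex_left hx
    exact ⟨p, hs.isExp h.convex_left hx hp⟩
  · have hs' : IsStrictConvexPt Ω v x := by
      by_contra hcon
      exact hxs ⟨⟨hx, hs⟩, ⟨hx, hcon⟩⟩
    obtain ⟨p, hp⟩ := subgrad_nonempty h.isOpen h.convex_right hx
    exact ⟨p, (hs'.isExp h.convex_right hx hp).of_le h.order hxe⟩

lemma IsSolPair.eventually_eq_of_isExp (h : IsSolPair Ω f F G lam Lam u v) {x p : En n}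
    (hx : x ∈ Ω) (hxe : u x = v x) (hp : IsExp Ω u x p) : ∀ᶠ y in nhds x, u y = v y := by
  have hΩo := h.isOpen
  have hu := h.convex_left
  have huc := hu.continuousOn hΩo
  have hvc := h.convex_right.continuousOn hΩo
  by_contra hcon
  have hfreq : ∃ᶠ y in nhds x, y ∈ Ω ∧ v y < u y ∧ ∀ q ∈ subgrad Ω u y, IsExp Ω u y q := by
    rw [frequently_iff]
    intro U hU
    obtain ⟨z, hzu, hz⟩ := frequently_iff.1 (not_eventually.1 hcon)
      (inter_mem (interior_mem_nhds.2 hU) (hΩo.mem_nhds hx))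
    have hop : IsOpen (interior U ∩ (Ω ∩ (fun y => u y - v y) ⁻¹' Ioi 0)) :=
      isOpen_interior.inter ((huc.sub hvc).isOpen_inter_preimage hΩo isOpen_Ioi)
    have hd := Measure.dense_of_ae (ae_isExp hΩo hu h.lower_pos h.maBounds_left)
    obtain ⟨y, ⟨hyU, hyΩ, hy⟩, hye⟩ := hd.inter_open_nonempty _ hop ⟨z, hzu.1, hzu.2,
      sub_pos.2 (lt_of_le_of_ne (h.order z hzu.2) (Ne.symm hz))⟩
    exact ⟨y, interior_subset hyU, hyΩ, sub_pos.1 hy, hye hyΩ⟩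
  obtain ⟨ys, hys, hY⟩ := exists_seq_forall_of_frequently hfreq
  choose ps hps using fun k => subgrad_nonempty hΩo hu (hY k).1
  obtain ⟨p', hp', φ, hφ, hlim⟩ := exists_subgrad_subseq hΩo hu hx hys (Eventually.of_forall hps)
  obtain rfl : p' = p := hp.eq_of_mem_subgrad hΩo hu h.lower_pos h.upper_pos h.maBounds_left hx hp'
  have hysφ := hys.comp hφ.tendsto_atTop
  obtain ⟨r, hr, hrs⟩ := Metric.nhds_basis_closedBall.mem_iff.mp (hΩo.mem_nhds hx)
  obtain ⟨t, ht, hev⟩ := exists_section_subset hΩo hu hp hr hrs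
  have hgap : Tendsto (fun k => gap u (ys (φ k)) (ps (φ k)) x) atTop (nhds 0) := by
    have h1 : Tendsto (fun k => u (ys (φ k))) atTop (nhds (u x)) :=
      (huc.continuousAt (hΩo.mem_nhds hx)).tendsto.comp hysφ
    have h2 : Tendsto (fun k => ⟪ps (φ k), x - ys (φ k)⟫) atTop (nhds ⟪p', x - x⟫) :=
      hlim.inner (tendsto_const_nhds.sub hysφ)
    simpa [gap] using (tendsto_const_nhds (x := u x)).sub h1 |>.sub h2
  obtain ⟨k, hk1, hk2⟩ :=
    (((hysφ.prodMk_nhds hlim).eventually hev).and (hgap.eventually_lt_const ht)).exists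
  obtain ⟨hyΩ, hvy, hye⟩ := hY (φ k)
  refine h.not_contact_of_section hyΩ hvy (hye _ (hps _)) ?_ hx hk2 hxe
  exact isCompact_section hΩo hu (isCompact_closedBall x r) hrs fun X hX hXt =>
    Metric.ball_subset_closedBall (hk1 (hps _) hyΩ X hX hXt)

lemma exists_mem_Icc_frontier {W : Set ℝ} (h0 : 0 ∈ W) (h1 : 1 ∉ W) :
    ∃ t ∈ Icc (0 : ℝ) 1, t ∈ frontier W := by
  have hc : IsPreconnected (Icc (0 : ℝ) 1) := isPreconnected_Icc
  by_contra! hcon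
  have hsub : Icc (0 : ℝ) 1 ⊆ interior W ∪ (closure W)ᶜ := fun t ht => by
    by_cases hi : t ∈ interior W
    · exact Or.inl hi
    · exact Or.inr fun hcl => hcon t ht ⟨hcl, hi⟩
  have m0 : (0 : ℝ) ∈ Icc (0 : ℝ) 1 := ⟨le_rfl, zero_le_one⟩
  have m1 : (1 : ℝ) ∈ Icc (0 : ℝ) 1 := ⟨zero_le_one, le_rfl⟩
  obtain ⟨t, -, ht1, ht2⟩ := hc _ _ isOpen_interior isClosed_closure.isOpen_compl hsub
    ⟨0, m0, (hsub m0).resolve_right fun hn => hn (subset_closure h0)⟩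
    ⟨1, m1, (hsub m1).resolve_left fun hn => h1 (interior_subset hn)⟩
  exact ht2 (subset_closure (interior_subset ht1))

lemma IsSolPair.not_isExp_of_contact (h : IsSolPair Ω f F G lam Lam u v) (hΩc : IsConnected Ω)
    (hne : ¬ ∀ x ∈ Ω, u x = v x) {x p : En n} (hx : x ∈ Ω) (hxe : u x = v x) :
    ¬ IsExp Ω u x p := by
  intro hp
  have hΩo := h.isOpen
  have hu := h.convex_left
  have huvc := (hu.continuousOn hΩo).sub (h.convex_right.continuousOn hΩo)
  set W := {y | ∀ᶠ z in nhds y, u z = v z} with hW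
  have hWo : IsOpen W := isOpen_setOfPred_eventually_nhds
  have hWe : ∀ y ∈ W, u y = v y := fun y hy => hy.self_of_nhds
  have hcl : ∀ y ∈ Ω, y ∈ closure W → u y = v y := fun y hy hyW => by
    by_contra hcon
    have hop := huvc.isOpen_inter_preimage hΩo (isOpen_compl_singleton (x := (0 : ℝ)))
    obtain ⟨z, ⟨-, hz⟩, hzW⟩ := mem_closure_iff.1 hyW _ hop ⟨hy, sub_ne_zero.2 hcon⟩
    exact hz (sub_eq_zero.2 (hWe z hzW))
  have hnexp : ∀ y ∈ Ω, y ∈ closure W → y ∉ W → ∀ q ∈ subgrad Ω u y, ¬ IsExp Ω u y q :=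
    fun y hy hyW hn q _ hq => hn (h.eventually_eq_of_isExp hy (hcl y hy hyW) hq)
  have hxW : x ∈ W := h.eventually_eq_of_isExp hx hxe hp
  obtain ⟨x₀, hx₀, hx₀c, hx₀W⟩ : ∃ x₀ ∈ Ω, x₀ ∈ closure W ∧ x₀ ∉ W := by
    by_contra! hcon
    push Not at hne
    obtain ⟨z, hz, hzne⟩ := hne
    obtain ⟨y, -, hy1, hy2⟩ := hΩc.isPreconnected W (closure W)ᶜ hWo
      isClosed_closure.isOpen_compl
      (fun y hy => or_iff_not_imp_right.2 fun hyc => hcon y hy (not_not.1 hyc))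
      ⟨x, hx, hxW⟩ ⟨z, hz, fun hzc => hzne (hcl z hz hzc)⟩
    exact hy2 (subset_closure hy1)
  obtain ⟨r, hr, hrs⟩ := Metric.nhds_basis_closedBall.mem_iff.mp (hΩo.mem_nhds hx₀)
  obtain ⟨a, ha, haW⟩ := mem_closure_iff.1 hx₀c _ Metric.isOpen_ball (Metric.mem_ball_self hr)
  obtain ⟨b, hb, hbne⟩ := frequently_iff.1 (not_eventually.1 hx₀W) (Metric.ball_mem_nhds x₀ hr)
  have hbW : b ∉ closure W := fun hbc => hbne (hcl b (hrs (Metric.ball_subset_closedBall hb)) hbc)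
  set e := b - a with he
  have hV : ∀ᶠ c in nhds a, c ∈ W ∧ c ∈ Metric.ball x₀ r ∧ c + e ∉ closure W ∧
      c + e ∈ Metric.ball x₀ r := by
    have hae : Tendsto (fun c => c + e) (nhds a) (nhds b) := by
      have := (continuous_add_const e).tendsto a
      rwa [he, add_sub_cancel] at this
    filter_upwards [hWo.mem_nhds haW, Metric.isOpen_ball.mem_nhds ha,
      hae (isClosed_closure.isOpen_compl.mem_nhds hbW), hae (Metric.isOpen_ball.mem_nhds hb)]
      with c h1 h2 h3 h4 using ⟨h1, h2, h3, h4⟩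
  obtain ⟨ρ, hρ, hρs⟩ := Metric.eventually_nhds_iff_ball.1 hV
  have hnull := volume_sweep_not_isExp_eq_zero hΩo hu h.lower_pos h.maBounds_left
    (convex_closedBall x₀ r) (isCompact_closedBall x₀ r) hrs (-e)
  refine (Metric.measure_ball_pos volume a hρ).ne' (measure_mono_null (fun c hc => ?_) hnull)
  obtain ⟨hcW, hcr, hceW, hcer⟩ := hρs c hc
  have hcont : Continuous fun t : ℝ => c + t • e := by fun_prop
  obtain ⟨t, ht, htf⟩ := exists_mem_Icc_frontier (W := (fun t : ℝ => c + t • e) ⁻¹' W)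
    (by simpa using hcW) fun h1 => hceW (subset_closure (by simpa using h1))
  have htW : c + t • e ∉ W := fun hn => htf.2 ((hWo.preimage hcont).interior_eq.symm ▸ hn)
  have htc : c + t • e ∈ closure W := hcont.closure_preimage_subset W htf.1
  have htr : c + t • e ∈ Metric.ball x₀ r := by
    have := (convex_ball x₀ r) hcr hcer (sub_nonneg.2 ht.2) ht.1 (sub_add_cancel 1 t)
    convert this using 1
    module
  refine ⟨(c + t • e, t), ⟨⟨Metric.ball_subset_closedBall htr, ?_⟩, ht⟩, by simp⟩
  exact hnexp _ (hrs (Metric.ball_subset_closedBall htr)) htc htW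

end ContactSet

/-- Theorem 1.4 (Theorem `thm:smp 1`): the strong maximum principle for generalized
solutions of `det D²w = f(x)·F(x,w)/G(∇w, w*∘∇w)` with nondegenerate `f`. -/
theorem statement_2 {n : ℕ} (Ω : Set (En n)) (hΩo : IsOpen Ω) (hΩc : IsConnected Ω)
    (f : En n → ℝ) (hfm : Measurable f)
    (F G : En n × ℝ → ℝ)
    (lam Lam : ℝ) (hlam : 0 < lam) (hLam : lam ≤ Lam)
    (hfb : ∀ x ∈ Ω, lam ≤ f x ∧ f x ≤ Lam)
    (hFb : ∀ p : En n × ℝ, lam ≤ F p ∧ F p ≤ Lam)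
    (hGb : ∀ p : En n × ℝ, lam ≤ G p ∧ G p ≤ Lam)
    (hFlip : LocallyLipschitz F) (hGlip : LocallyLipschitz G)
    (u v : En n → ℝ) (hu : ConvexOn ℝ Ω u) (hv : ConvexOn ℝ Ω v)
    (huv : ∀ x ∈ Ω, v x ≤ u x)
    (hMu : IsGenSol Ω f F G u) (hMv : IsGenSol Ω f F G v)
    (hne : ¬ (∀ x ∈ Ω, u x = v x)) :
    ∀ x ∈ Ω, u x = v x → x ∈ SigmaSet Ω u ∩ SigmaSet Ω v := by
  intro x hx hxe
  by_contra hxs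
  have h : IsSolPair Ω f F G lam Lam u v :=
    ⟨hΩo, hfm, hlam, hLam, hfb, hFb, hGb, hFlip, hGlip, hu, hv, huv, hMu, hMv⟩
  obtain ⟨p, hp⟩ := h.exists_isExp_of_notMem hx hxe hxs
  exact h.not_isExp_of_contact hΩc hne hx hxe hp
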